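/- arXiv:1808.10440 — 19 statements merged into one kernel-verified Lean document; each statement's English description precedes it below -/
import Mathlib

section
/- Let F be a finite field with at most 3 elements (i.e., F = 𝔽₂ or F = 𝔽₃). Then every irreducible polynomial of degree 2 over F admits a visibly irreducible decomposition of degree 2. -/
open Polynomial

/-- A *visibly irreducible decomposition* (VID) of degree `d` of `f` over a finite field `F`:
a list of `r ≥ 2` nonzero polynomials, each of degree at most `d`, summing to `f`, such that
exactly one entry has degree `d`, and every monic irreducible polynomial of degree at most
`d / 2` divides all but exactly one of the entries. -/
def IsVID {F : Type*} [Field F] (d : ℕ) (f : F[X]) (l : List F[X]) : Prop :=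
  2 ≤ l.length ∧
  (∀ g ∈ l, g ≠ 0 ∧ g.natDegree ≤ d) ∧
  l.sum = f ∧
  (∃! i : Fin l.length, (l.get i).natDegree = d) ∧
  ∀ p : F[X], p.Monic → Irreducible p → 2 * p.natDegree ≤ d →
    ∃! i : Fin l.length, ¬ p ∣ l.get i

/-- A pair `[g, h]` with `g` quadratic and `h` of degree at most one is a VID of degree `2` as soon
as every element of the field is a root of exactly one of `g` and `h`. -/
theorem isVID_two_pair {F : Type*} [Field F] {f g h : F[X]} (hg : g.natDegree = 2)
    (hh : h.natDegree ≤ 1) (h0 : h ≠ 0) (hsum : g + h = f)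
    (hroot : ∀ t, g.IsRoot t ↔ ¬ h.IsRoot t) : IsVID 2 f [g, h] := by
  have g0 : g ≠ 0 := by
    rintro rfl
    simp at hg
  refine ⟨by simp, ?_, by simp [hsum], ⟨(0 : Fin 2), by simpa using hg, ?_⟩, ?_⟩
  · simp only [List.mem_cons, List.not_mem_nil, or_false, forall_eq_or_imp, forall_eq]
    exact ⟨⟨g0, hg.le⟩, h0, by omega⟩
  · intro (i : Fin 2) hi
    fin_cases i
    · rfl
    · simp at hi
      omega
  · intro p hp hirr hpd
    have hp1 : p.natDegree = 1 := by
      have := hirr.natDegree_pos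
      omega
    obtain ⟨t, rfl⟩ : ∃ t, p = X - C t :=
      ⟨-p.coeff 0, by simpa using hp.eq_X_add_C hp1⟩
    have ht := hroot t
    rw [← dvd_iff_isRoot, ← dvd_iff_isRoot] at ht
    by_cases hd : X - C t ∣ g
    · refine ⟨(1 : Fin 2), by simpa using ht.1 hd, ?_⟩
      intro (i : Fin 2) hi
      fin_cases i
      · exact absurd hd hi
      · rfl
    · refine ⟨(0 : Fin 2), by simpa using hd, ?_⟩
      intro (i : Fin 2) hi
      fin_cases i
      · rfl
      · exact absurd (ht.2 hi) hd

theorem eq_zero_or_one_of_card_eq_two {F : Type*} [Field F] [Fintype F]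
    (hF : Fintype.card F = 2) (x : F) : x = 0 ∨ x = 1 := by
  have h := FiniteField.pow_card x
  rw [hF] at h
  have : x * (x - 1) = 0 := by linear_combination h
  simpa [sub_eq_zero] using this

theorem eq_zero_or_one_or_neg_one_of_card_eq_three {F : Type*} [Field F] [Fintype F]
    (hF : Fintype.card F = 3) (x : F) : x = 0 ∨ x = 1 ∨ x = -1 := by
  have h := FiniteField.pow_card x
  rw [hF] at h
  have : x * ((x - 1) * (x + 1)) = 0 := by linear_combination h
  simpa [sub_eq_zero, add_eq_zero_iff_eq_neg] using this

/-- Over the field with three elements, a quadratic without roots takes at some point the value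
opposite to its leading coefficient. -/
theorem exists_quadratic_eq_neg_leadingCoeff {F : Type*} [Field F] [Fintype F]
    (hF : Fintype.card F = 3) {a b c : F} (ha : a ≠ 0)
    (hroot : ∀ t, a * t ^ 2 + b * t + c ≠ 0) : ∃ e, a * e ^ 2 + b * e + c = -a := by
  have h3 : (3 : F) = 0 := by
    have := Nat.cast_card_eq_zero F
    rw [hF] at this
    exact_mod_cast this
  have key : ∀ e, a * e ^ 2 + b * e + c ≠ -a → a * e ^ 2 + b * e + c = a := by
    intro e he
    have h := hroot e
    generalize a * e ^ 2 + b * e + c = v at *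
    rcases eq_zero_or_one_or_neg_one_of_card_eq_three hF a with rfl | rfl | rfl <;>
    rcases eq_zero_or_one_or_neg_one_of_card_eq_three hF v with rfl | rfl | rfl <;> simp_all
  by_contra! hne
  have e0 := key 0 (hne 0)
  have e1 := key 1 (hne 1)
  have e2 := key (-1) (hne (-1))
  exact ha (by linear_combination 2 * e0 - e1 - e2 + a * h3)

theorem quadratics_have_VID {F : Type*} [Field F] [Fintype F] (hF : Fintype.card F ≤ 3)
    (f : F[X]) (hf : Irreducible f) (hdeg : f.natDegree = 2) :
    ∃ l : List F[X], IsVID 2 f l := by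
  obtain ⟨a, b, c, ha, rfl⟩ : ∃ a b c : F, a ≠ 0 ∧ C a * X ^ 2 + C b * X + C c = f :=
    ⟨_, _, _, by rw [← hdeg]; exact leadingCoeff_ne_zero.2 hf.ne_zero,
      (eq_quadratic_of_degree_le_two (natDegree_le_iff_degree_le.1 hdeg.le)).symm⟩
  have hroot : ∀ t, a * t ^ 2 + b * t + c ≠ 0 := by
    intro t ht
    refine hf.not_isRoot_of_natDegree_ne_one (by omega) (x := t) ?_
    simpa using ht
  have hcard : Fintype.card F = 2 ∨ Fintype.card F = 3 := by
    have := Fintype.one_lt_card (α := F)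
    omega
  rcases hcard with hF | hF
  · have h2 : (2 : F) = 0 := by
      have := Nat.cast_card_eq_zero F
      rw [hF] at this
      exact_mod_cast this
    have key := eq_zero_or_one_of_card_eq_two hF
    have hone : ∀ {x : F}, x ≠ 0 → x = 1 := fun {x} hx => (key x).resolve_left hx
    have hc : c ≠ 0 := by simpa using hroot 0
    obtain rfl := hone ha
    obtain rfl := hone hc
    have hb : b = 1 := hone fun hb => hroot 1 (by rw [hb]; linear_combination h2)
    subst hb
    refine ⟨_, isVID_two_pair (g := C 1 * X ^ 2 + C 1 * X + C 0) (h := C 1)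
      (natDegree_quadratic one_ne_zero) (by simp) (by simp) (by simp) fun t => ?_⟩
    rcases key t with rfl | rfl
    · simp
    · simpa [one_add_one_eq_two] using h2
  · have h3 : (3 : F) = 0 := by
      have := Nat.cast_card_eq_zero F
      rw [hF] at this
      exact_mod_cast this
    obtain ⟨e, he⟩ := exists_quadratic_eq_neg_leadingCoeff hF ha hroot
    have hd : b - a * e ≠ 0 := by
      intro hd
      apply hroot (e + 1)
      linear_combination he + hd + a * e * h3
    refine ⟨_, isVID_two_pair
      (g := C a * X ^ 2 + C (a * e) * X + C (a * e ^ 2 - a)) (h := C (b - a * e) * (X - C e))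
      (natDegree_quadratic ha) ?_ ?_ ?_ fun t => ?_⟩
    · exact (natDegree_C_mul_le _ _).trans (natDegree_X_sub_C_le e)
    · exact mul_ne_zero (C_ne_zero.2 hd) (X_sub_C_ne_zero e)
    · have hc : c = a * e ^ 2 - a - (b - a * e) * e := by
        linear_combination he - a * e ^ 2 * h3
      rw [hc]
      simp only [C_sub, C_mul, C_pow]
      ring
    · have hfac : a * t ^ 2 + a * e * t + (a * e ^ 2 - a) = a * ((t - e - 1) * (t - e + 1)) := by
        linear_combination a * e * t * h3
      have hcase := eq_zero_or_one_or_neg_one_of_card_eq_three hF (t - e)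
      simp only [IsRoot.def, eval_add, eval_mul, eval_C, eval_pow, eval_X, eval_sub, hfac]
      rcases hcase with h | h | h <;> simp [h, ha, hd, sub_ne_zero.2 (sub_ne_zero.1 hd).symm]
end

section
/- Let F be a finite field with at most 5 elements (i.e., F has 2, 3, 4, or 5 elements). Then every irreducible polynomial of degree 3 over F admits a visibly irreducible decomposition of degree 3. -/
open Polynomial

/-- A cubic without roots that agrees with a split quadratic away from the roots of the latter
has a visibly irreducible decomposition. -/
lemma exists_isVID_of_eval_eq {F : Type*} [Field F] {f : F[X]} (hdeg : f.natDegree = 3)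
    (hroot : ∀ x, f.eval x ≠ 0) {m c d : F} (hm : m ≠ 0)
    (h : ∀ x, x ≠ c → x ≠ d → f.eval x = m * ((x - c) * (x - d))) :
    ∃ l : List F[X], IsVID 3 f l := by
  set q : F[X] := C m * ((X - C c) * (X - C d)) with hq
  have hqeval (x : F) : q.eval x = m * ((x - c) * (x - d)) := by simp [hq]
  have hqdeg : q.natDegree = 2 := by
    rw [hq, natDegree_C_mul hm, natDegree_mul (X_sub_C_ne_zero c) (X_sub_C_ne_zero d)]
    simp
  have hgdeg : (f - q).natDegree = 3 := by
    rw [natDegree_sub_eq_left_of_natDegree_lt (by omega), hdeg]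
  refine ⟨[f - q, q], by simp, ?_, by simp, ⟨0, hgdeg, ?_⟩, ?_⟩
  · simp only [List.mem_cons, List.not_mem_nil, or_false, forall_eq_or_imp, forall_eq]
    exact ⟨⟨ne_zero_of_natDegree_gt (n := 0) (by omega), hgdeg.le⟩,
      ne_zero_of_natDegree_gt (n := 0) (by omega), by omega⟩
  · intro i hi
    fin_cases i
    · rfl
    · simp [hqdeg] at hi
  · intro p hp hirr hpdeg
    have hp1 : p.natDegree = 1 := by
      have := hirr.natDegree_pos
      omega
    obtain ⟨x, rfl⟩ : ∃ x, p = X - C x :=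
      ⟨-p.coeff 0, by rw [C_neg, sub_neg_eq_add]; exact hp.eq_X_add_C hp1⟩
    simp only [dvd_iff_isRoot, IsRoot.def]
    by_cases hx : x = c ∨ x = d
    · have hx0 : q.eval x = 0 := by rcases hx with rfl | rfl <;> simp [hq]
      refine ⟨0, by simpa [hx0] using hroot x, fun i hi => ?_⟩
      fin_cases i
      · rfl
      · exact absurd hx0 hi
    · push Not at hx
      have hx0 : q.eval x = f.eval x := by rw [hqeval, h x hx.1 hx.2]
      refine ⟨1, by simpa [hx0] using hroot x, fun i hi => ?_⟩
      fin_cases i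
      · exact absurd (by simp [hx0]) hi
      · rfl

/-- A monic cubic without roots over `ZMod 5` agrees with a split quadratic away from the roots
of the latter. -/
lemma ZMod.exists_quadratic_eq_cubic : ∀ s t u : ZMod 5,
    (∀ x, x ^ 3 + s * x ^ 2 + t * x + u ≠ 0) → ∃ m c d : ZMod 5, m ≠ 0 ∧
      ∀ x, x ≠ c → x ≠ d → x ^ 3 + s * x ^ 2 + t * x + u = m * ((x - c) * (x - d)) := by
  decide +kernel

lemma exists_quadratic_eq_of_card_eq_five {F : Type*} [Field F] [Fintype F]
    (hF : Fintype.card F = 5) {f : F[X]} (hdeg : f.natDegree = 3)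
    (hroot : ∀ x, f.eval x ≠ 0) :
    ∃ m c d : F, m ≠ 0 ∧ ∀ x, x ≠ c → x ≠ d → f.eval x = m * ((x - c) * (x - d)) := by
  have e : ZMod 5 ≃+* F := ZMod.ringEquivOfPrime F (by norm_num) hF
  set k := f.coeff 3 with hk
  have hk0 : k ≠ 0 := by
    rw [hk, ← hdeg, coeff_natDegree]
    exact leadingCoeff_ne_zero.mpr (ne_zero_of_natDegree_gt (n := 0) (by omega))
  have heval (x : ZMod 5) : f.eval (e x) =
      k * e (x ^ 3 + e.symm (f.coeff 2 / k) * x ^ 2 + e.symm (f.coeff 1 / k) * x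
        + e.symm (f.coeff 0 / k)) := by
    rw [eval_eq_sum_range, hdeg]
    simp only [Finset.sum_range_succ, Finset.sum_range_zero, map_add, map_mul, map_pow,
      RingEquiv.apply_symm_apply, ← hk]
    field_simp
    ring
  obtain ⟨m, c, d, hm, h⟩ := ZMod.exists_quadratic_eq_cubic (e.symm (f.coeff 2 / k))
    (e.symm (f.coeff 1 / k)) (e.symm (f.coeff 0 / k)) fun x hx => hroot (e x) (by simp [heval, hx])
  refine ⟨k * e m, e c, e d, mul_ne_zero hk0 (by simpa using hm), fun x hc hd => ?_⟩
  obtain ⟨x, rfl⟩ := e.surjective x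
  rw [heval, h x (by rintro rfl; exact hc rfl) (by rintro rfl; exact hd rfl)]
  simp [mul_assoc]

lemma exists_quadratic_eq_of_card_eq_four {F : Type*} [Field F] [Fintype F]
    (hF : Fintype.card F = 4) {v : F → F} (hv : ∀ x, v x ≠ 0) :
    ∃ m c d : F, m ≠ 0 ∧ ∀ x, x ≠ c → x ≠ d → v x = m * ((x - c) * (x - d)) := by
  classical
  obtain ⟨a, b, hab, hvab⟩ : ∃ a b, a ≠ b ∧ v a = v b := by
    obtain ⟨a, -, b, -, hab, h⟩ := Finset.exists_ne_map_eq_of_card_lt_of_maps_to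
      (s := Finset.univ) (t := Finset.univ.erase (0 : F)) (f := v)
      (by simp [Finset.card_erase_of_mem, hF]) (by intro x _; simp [hv x])
    exact ⟨a, b, hab, h⟩
  obtain ⟨c, d, hcd, hS⟩ := Finset.card_eq_two.mp
    (show ((Finset.univ.erase a).erase b : Finset F).card = 2 by rw [Finset.card_erase_of_mem (by simp [hab.symm]),
      Finset.card_erase_of_mem (by simp), Finset.card_univ, hF])
  have hmem (x : F) : x ≠ b ∧ x ≠ a ↔ x = c ∨ x = d := by
    simpa using Finset.ext_iff.mp hS x
  obtain ⟨hcb, hca⟩ := (hmem c).mpr (.inl rfl)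
  obtain ⟨hdb, hda⟩ := (hmem d).mpr (.inr rfl)
  have hsum : a + b + c + d = 0 := by
    have h := FiniteField.sum_pow_lt_card_sub_one F 1 (by omega)
    simp only [pow_one] at h
    rw [← Finset.add_sum_erase _ _ (Finset.mem_univ a),
      ← Finset.add_sum_erase _ _ (show b ∈ Finset.univ.erase a by simp [hab.symm]), hS,
      Finset.sum_pair hcd] at h
    linear_combination h
  have h2 : (2 : F) = 0 := by
    have h : ((Fintype.card F : ℕ) : F) = 0 := Nat.cast_card_eq_zero F
    rw [hF] at h
    exact pow_eq_zero_iff (n := 2) two_ne_zero |>.mp (by push_cast at h; linear_combination h)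
  have hquad : (a - c) * (a - d) = (b - c) * (b - d) := by
    linear_combination (a - b) * hsum - (a - b) * (c + d) * h2
  have hne : (a - c) * (a - d) ≠ 0 :=
    mul_ne_zero (sub_ne_zero.mpr hca.symm) (sub_ne_zero.mpr hda.symm)
  refine ⟨v a / ((a - c) * (a - d)), c, d, div_ne_zero (hv a) hne, fun x hxc hxd => ?_⟩
  have hx : x = b ∨ x = a := by
    by_contra! hx
    exact ((hmem x).mp hx).elim hxc hxd
  rcases hx with rfl | rfl
  · rw [← hquad, div_mul_cancel₀ _ hne, hvab]
  · rw [div_mul_cancel₀ _ hne]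

lemma exists_quadratic_eq_of_card_le_three {F : Type*} [Field F] [Fintype F]
    (hF : Fintype.card F ≤ 3) {v : F → F} (hv : ∀ x, v x ≠ 0) :
    ∃ m c d : F, m ≠ 0 ∧ ∀ x, x ≠ c → x ≠ d → v x = m * ((x - c) * (x - d)) := by
  classical
  by_cases ha : ∃ a : F, a ≠ 0 ∧ a ≠ 1
  · obtain ⟨a, ha0, ha1⟩ := ha
    have hne : (a - 0) * (a - 1) ≠ 0 :=
      mul_ne_zero (sub_ne_zero.mpr ha0) (sub_ne_zero.mpr ha1)
    refine ⟨v a / ((a - 0) * (a - 1)), 0, 1, div_ne_zero (hv a) hne, fun x hx0 hx1 => ?_⟩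
    obtain rfl : x = a := by
      by_contra hxa
      have h := Finset.card_le_univ ({x, a, 0, 1} : Finset F)
      rw [Finset.card_insert_of_notMem (by simp [hxa, hx0, hx1]),
        Finset.card_insert_of_notMem (by simp [ha0, ha1]), Finset.card_pair zero_ne_one] at h
      omega
    rw [div_mul_cancel₀ _ hne]
  · push Not at ha
    exact ⟨1, 0, 1, one_ne_zero, fun x hx0 hx1 => absurd (ha x hx0) hx1⟩

theorem cubics_have_VID {F : Type*} [Field F] [Fintype F] (hF : Fintype.card F ≤ 5)
    (f : F[X]) (hf : Irreducible f) (hdeg : f.natDegree = 3) :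
    ∃ l : List F[X], IsVID 3 f l := by
  have hroot (x : F) : f.eval x ≠ 0 :=
    hf.not_isRoot_of_natDegree_ne_one (by omega)
  obtain ⟨m, c, d, hm, h⟩ : ∃ m c d : F, m ≠ 0 ∧
      ∀ x, x ≠ c → x ≠ d → f.eval x = m * ((x - c) * (x - d)) := by
    obtain h | h | h : Fintype.card F ≤ 3 ∨ Fintype.card F = 4 ∨ Fintype.card F = 5 := by omega
    · exact exists_quadratic_eq_of_card_le_three h hroot
    · exact exists_quadratic_eq_of_card_eq_four h hroot
    · exact exists_quadratic_eq_of_card_eq_five h hdeg hroot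
  exact exists_isVID_of_eval_eq hdeg hroot hm h
end

section
/- Every irreducible polynomial of degree 4 over 𝔽₂ = ZMod 2 admits a visibly irreducible decomposition of degree 4. -/
open Polynomial

/-- A two-term VID of an irreducible `a + b` arises when every small irreducible divides `a * b`. -/
theorem IsVID.pair {F : Type*} [Field F] {d : ℕ} {a b : F[X]}
    (hf : Irreducible (a + b)) (hfd : d < 2 * (a + b).natDegree) (ha : a.natDegree = d)
    (hb : b.natDegree < d) (hb0 : b ≠ 0)
    (h : ∀ p : F[X], p.Monic → Irreducible p → 2 * p.natDegree ≤ d → p ∣ a * b) :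
    IsVID d (a + b) [a, b] := by
  refine ⟨by simp, ?_, by simp, ⟨(0 : Fin 2), by simpa using ha, ?_⟩, fun p hm hp hd => ?_⟩
  · have ha0 : a ≠ 0 := by rintro rfl; simp at ha; omega
    simp only [List.mem_cons, List.not_mem_nil, or_false]
    rintro g (rfl | rfl)
    exacts [⟨ha0, ha.le⟩, ⟨hb0, hb.le⟩]
  · intro i hi
    change Fin 2 at i
    fin_cases i
    · rfl
    · exact absurd hi hb.ne
  · have hnot : ¬ p ∣ a + b := fun hdvd => by
      have := natDegree_eq_of_degree_eq
        (degree_eq_degree_of_associated (hp.associated_of_dvd hf hdvd))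
      omega
    rcases hp.prime.dvd_or_dvd (h p hm hp hd) with hpa | hpb
    · have hpb : ¬ p ∣ b := fun hpb => hnot (dvd_add hpa hpb)
      refine ⟨(1 : Fin 2), hpb, fun i hi => ?_⟩
      change Fin 2 at i
      fin_cases i
      · exact absurd hpa hi
      · rfl
    · have hpa : ¬ p ∣ a := fun hpa => hnot (dvd_add hpa hpb)
      refine ⟨(0 : Fin 2), hpa, fun i hi => ?_⟩
      change Fin 2 at i
      fin_cases i
      · rfl
      · exact absurd hpb hi

theorem ZMod.eq_zero_or_eq_one_of_two (a : ZMod 2) : a = 0 ∨ a = 1 := by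
  revert a; decide

theorem Irreducible.eval_eq_one_of_one_lt_natDegree {f : (ZMod 2)[X]} (hf : Irreducible f)
    (hdeg : 1 < f.natDegree) (x : ZMod 2) : f.eval x = 1 :=
  (ZMod.eq_zero_or_eq_one_of_two _).resolve_left fun h =>
    hdeg.ne' (natDegree_eq_of_degree_eq_some (degree_eq_one_of_irreducible_of_root hf h))

theorem Irreducible.dvd_X_pow_four_add_X {p : (ZMod 2)[X]} (hp : Irreducible p)
    (hd : p.natDegree ≤ 2) : p ∣ X ^ 4 + X := by
  have hdvd : p.natDegree ∣ 2 := by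
    have := hp.natDegree_pos
    interval_cases p.natDegree <;> decide
  simpa [CharTwo.sub_eq_add] using hp.natDegree_dvd_iff_dvd_X_pow_card_pow_sub_X.1 hdvd

theorem Irreducible.eq_of_natDegree_eq_four {f : (ZMod 2)[X]} (hf : Irreducible f)
    (hdeg : f.natDegree = 4) :
    f = X ^ 4 + X + 1 ∨ f = X ^ 4 + (X ^ 3 + 1) ∨ f = X ^ 4 + 1 + (X ^ 3 + X ^ 2 + X) := by
  have h2 : (2 : (ZMod 2)[X]) = 0 := by exact_mod_cast CharP.cast_eq_zero (ZMod 2)[X] 2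
  have hs := f.as_sum_range' 5 (by omega)
  simp only [Finset.sum_range_succ, Finset.sum_range_zero, ← C_mul_X_pow_eq_monomial] at hs
  have e0 := hf.eval_eq_one_of_one_lt_natDegree (by omega) 0
  have e1 := hf.eval_eq_one_of_one_lt_natDegree (by omega) 1
  have c4 : f.coeff 4 = 1 := (ZMod.eq_zero_or_eq_one_of_two _).resolve_left fun h => by
    have hlead := leadingCoeff_ne_zero.2 hf.ne_zero
    rw [leadingCoeff, hdeg] at hlead
    exact hlead h
  rw [hs] at e0 e1
  simp only [eval_add, eval_mul, eval_C, eval_pow, eval_X, eval_zero, c4] at e0 e1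
  have c0 : f.coeff 0 = 1 := by simpa using e0
  have key : ∀ a b c : ZMod 2,
      1 + a + b + c + 1 = 1 →
      a = 1 ∧ b = 0 ∧ c = 0 ∨ a = 0 ∧ b = 0 ∧ c = 1 ∨ a = 1 ∧ b = 1 ∧ c = 1 ∨
        a = 0 ∧ b = 1 ∧ c = 0 := by decide
  simp only [c0, one_pow, mul_one, zero_add] at e1
  rcases key _ _ _ e1 with ⟨c1, c2, c3⟩ | ⟨c1, c2, c3⟩ | ⟨c1, c2, c3⟩ | ⟨c1, c2, c3⟩ <;>
    simp only [c0, c1, c2, c3, c4, map_zero, map_one] at hs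
  · exact .inl (hs.trans (by ring))
  · exact .inr (.inl (hs.trans (by ring)))
  · exact .inr (.inr (hs.trans (by ring)))
  · have hsq : f = (X ^ 2 + X + 1) * (X ^ 2 + X + 1) := by
      rw [hs]; linear_combination -(X ^ 3 + X ^ 2 + X) * h2
    have hu : IsUnit (X ^ 2 + X + 1 : (ZMod 2)[X]) := (hf.isUnit_or_isUnit hsq).elim id id
    have hd : (X ^ 2 + X + 1 : (ZMod 2)[X]).natDegree = 2 := by compute_degree!
    have := natDegree_eq_zero_of_isUnit hu
    omega

theorem quartics_over_F2_have_VID (f : (ZMod 2)[X]) (hf : Irreducible f)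
    (hdeg : f.natDegree = 4) :
    ∃ l : List (ZMod 2)[X], IsVID 4 f l := by
  have h2 : (2 : (ZMod 2)[X]) = 0 := by exact_mod_cast CharP.cast_eq_zero (ZMod 2)[X] 2
  rcases hf.eq_of_natDegree_eq_four hdeg with rfl | rfl | rfl
  · refine ⟨_, IsVID.pair hf (by omega) (by compute_degree!) (by simp) one_ne_zero
      fun p _ hp hd => ?_⟩
    exact (hp.dvd_X_pow_four_add_X (by omega)).mul_right _
  · have hb : (X ^ 3 + 1 : (ZMod 2)[X]).natDegree = 3 := by compute_degree!
    refine ⟨_, IsVID.pair hf (by omega) (by compute_degree!) (by omega)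
      (ne_zero_of_natDegree_gt (n := 0) (by omega)) fun p _ hp hd => ?_⟩
    exact (hp.dvd_X_pow_four_add_X (by omega)).trans ⟨X ^ 3, by ring⟩
  · have hb : (X ^ 3 + X ^ 2 + X : (ZMod 2)[X]).natDegree = 3 := by compute_degree!
    refine ⟨_, IsVID.pair hf (by omega) (by compute_degree!) (by omega)
      (ne_zero_of_natDegree_gt (n := 0) (by omega)) fun p _ hp hd => ?_⟩
    refine (hp.dvd_X_pow_four_add_X (by omega)).trans ⟨(X + 1) ^ 3, ?_⟩
    linear_combination -(X ^ 6 + X ^ 5 + X ^ 4 + X ^ 3 + X ^ 2) * h2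
end

section
/- Every irreducible polynomial of degree 5 over 𝔽₂ = ZMod 2 admits a visibly irreducible decomposition of degree 5. -/
open Polynomial

/-- A monic irreducible polynomial over `𝔽₂` of degree at most two is one of
`X`, `X + 1`, `X ^ 2 + X + 1`. -/
lemma monic_irreducible_ZMod_two_of_natDegree_le_two {p : (ZMod 2)[X]} (hm : p.Monic)
    (hp : Irreducible p) (hd : p.natDegree ≤ 2) :
    p = X ∨ p = X + 1 ∨ p = X ^ 2 + X + 1 := by
  have hpos := hp.natDegree_pos
  have bit : ∀ a : ZMod 2, a = 0 ∨ a = 1 := by decide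
  obtain h | h : p.natDegree = 1 ∨ p.natDegree = 2 := by omega
  · have hc : p.coeff 1 = 1 := by rw [← h]; exact hm
    have he := p.as_sum_range_C_mul_X_pow
    rw [h] at he
    simp only [Finset.sum_range_succ, Finset.sum_range_zero, hc] at he
    rcases bit (p.coeff 0) with h0 | h0 <;> rw [h0] at he
    · left; rw [he]; simp
    · right; left; rw [he]; simp [add_comm]
  · have hc : p.coeff 2 = 1 := by simpa [Monic, leadingCoeff, h] using hm
    have he := p.as_sum_range_C_mul_X_pow
    rw [h] at he
    simp only [Finset.sum_range_succ, Finset.sum_range_zero, hc] at he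
    have noroot : ∀ a, ¬ p.IsRoot a := fun a ha => by
      have : p.natDegree = 1 :=
        natDegree_eq_of_degree_eq_some (degree_eq_one_of_irreducible_of_root hp ha)
      omega
    have e0 : p.eval 0 ≠ 0 := noroot 0
    have e1 : p.eval 1 ≠ 0 := noroot 1
    have c0 : p.coeff 0 = 1 := by
      rw [coeff_zero_eq_eval_zero]
      exact (bit _).resolve_left e0
    have c1 : p.coeff 1 = 1 := by
      refine (bit _).resolve_left fun h1 => e1 ?_
      rw [he, c0, h1]
      simp
      decide
    right; right
    rw [he, c0, c1]
    simp
    ring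

lemma monic_X_sq_add_X_add_one : (X ^ 2 + X + 1 : (ZMod 2)[X]).Monic := by
  monicity!

/-- Over `𝔽₂`, each of the four entries is divisible by all but at most one of `X`, `X + 1`,
`X ^ 2 + X + 1`, and only the last one has degree five. -/
lemma isVID_five_of_linear_ne_zero {a b c : ZMod 2} (hs : (C a * X + C b : (ZMod 2)[X]) ≠ 0) :
    IsVID 5 ((X ^ 3 + 1) + ((X ^ 3 + X ^ 2 + X) + ((X ^ 2 + X) * (C a * X + C b) +
      (X ^ 4 + X) * (X + C c))))
      [X ^ 3 + 1, X ^ 3 + X ^ 2 + X, (X ^ 2 + X) * (C a * X + C b), (X ^ 4 + X) * (X + C c)] := by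
  have two : (2 : (ZMod 2)[X]) = 0 := CharTwo.two_eq_zero
  have d0 : (X ^ 3 + 1 : (ZMod 2)[X]).natDegree = 3 := by compute_degree!
  have d1 : (X ^ 3 + X ^ 2 + X : (ZMod 2)[X]).natDegree = 3 := by compute_degree!
  have d2' : (C a * X + C b : (ZMod 2)[X]).natDegree ≤ 1 := natDegree_linear_le
  have dq : (X ^ 2 + X : (ZMod 2)[X]).natDegree = 2 := by compute_degree!
  have nq : (X ^ 2 + X : (ZMod 2)[X]) ≠ 0 := ne_zero_of_natDegree_gt (n := 0) (by omega)
  have n2 := mul_ne_zero nq hs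
  have d2 : ((X ^ 2 + X) * (C a * X + C b) : (ZMod 2)[X]).natDegree ≤ 3 := by
    rw [natDegree_mul nq hs]; omega
  have d3 : ((X ^ 4 + X) * (X + C c) : (ZMod 2)[X]).natDegree = 5 := by
    have m : (X ^ 4 + X : (ZMod 2)[X]).Monic := by monicity!
    have d : (X ^ 4 + X : (ZMod 2)[X]).natDegree = 4 := by compute_degree!
    rw [m.natDegree_mul (monic_X_add_C c), d, natDegree_X_add_C]
  refine ⟨by simp, ?_, by simp, ⟨3, d3, ?_⟩, ?_⟩
  · intro g hg
    simp only [List.mem_cons, List.not_mem_nil, or_false] at hg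
    rcases hg with rfl | rfl | rfl | rfl
    · exact ⟨ne_zero_of_natDegree_gt (n := 0) (by omega), by omega⟩
    · exact ⟨ne_zero_of_natDegree_gt (n := 0) (by omega), by omega⟩
    · exact ⟨n2, by omega⟩
    · exact ⟨ne_zero_of_natDegree_gt (n := 0) (by omega), by omega⟩
  · intro i hi
    change Fin 4 at i
    fin_cases i <;> simp at hi ⊢ <;> omega
  · intro p hm hp hd
    rcases monic_irreducible_ZMod_two_of_natDegree_le_two hm hp (by omega) with rfl | rfl | rfl
    · refine ⟨0, ?_, ?_⟩
      · change ¬ X ∣ (X ^ 3 + 1 : (ZMod 2)[X])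
        simp [X_dvd_iff]
      · intro i hi
        change Fin 4 at i
        fin_cases i
        · rfl
        · exact absurd ⟨X ^ 2 + X + 1, by simp; ring⟩ hi
        · exact absurd ⟨(X + 1) * (C a * X + C b), by simp; ring⟩ hi
        · exact absurd ⟨(X ^ 3 + 1) * (X + C c), by simp; ring⟩ hi
    · refine ⟨1, ?_, ?_⟩
      · change ¬ X + 1 ∣ (X ^ 3 + X ^ 2 + X : (ZMod 2)[X])
        intro h
        have := eval_dvd (x := 1) h
        simp at this
        revert this
        decide
      · intro i hi
        change Fin 4 at i
        fin_cases i
        · exact absurd ⟨X ^ 2 + X + 1, by simp; linear_combination (-X ^ 2 - X) * two⟩ hi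
        · rfl
        · exact absurd ⟨X * (C a * X + C b), by simp; ring⟩ hi
        · exact absurd ⟨X * (X ^ 2 + X + 1) * (X + C c), by
            simp; linear_combination (-X ^ 3 - X ^ 2) * (X + C c) * two⟩ hi
    · refine ⟨2, ?_, ?_⟩
      · change ¬ X ^ 2 + X + 1 ∣ (X ^ 2 + X) * (C a * X + C b)
        have dp : (X ^ 2 + X + 1 : (ZMod 2)[X]).natDegree = 2 := by compute_degree!
        intro h
        rcases hp.prime.dvd_or_dvd h with h | h
        · exact hp.not_isUnit (isUnit_of_dvd_one
            ((dvd_add_right h).mp (dvd_refl (X ^ 2 + X + 1 : (ZMod 2)[X]))))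
        · have := natDegree_le_of_dvd h hs
          omega
      · intro i hi
        change Fin 4 at i
        fin_cases i
        · exact absurd ⟨X + 1, by simp; linear_combination (-X ^ 2 - X) * two⟩ hi
        · exact absurd ⟨X, by simp; ring⟩ hi
        · rfl
        · exact absurd ⟨X * (X + 1) * (X + C c), by
            simp; linear_combination (-X ^ 3 - X ^ 2) * (X + C c) * two⟩ hi

theorem quintics_over_F2_have_VID (f : (ZMod 2)[X]) (hf : Irreducible f)
    (hdeg : f.natDegree = 5) :
    ∃ l : List (ZMod 2)[X], IsVID 5 f l := by
  have bit : ∀ a : ZMod 2, a ≠ 0 → a = 1 := by decide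
  have two : (2 : (ZMod 2)[X]) = 0 := CharTwo.two_eq_zero
  have noroot : ∀ a, ¬ f.IsRoot a := fun a ha => by
    have : f.natDegree = 1 :=
      natDegree_eq_of_degree_eq_some (degree_eq_one_of_irreducible_of_root hf ha)
    omega
  have e0 : f.eval 0 = 1 := bit _ (noroot 0)
  have e1 : f.eval 1 = 1 := bit _ (noroot 1)
  have h0 : f.coeff 0 = 1 := by rw [coeff_zero_eq_eval_zero, e0]
  have h5 : f.coeff 5 = 1 := bit _ (by
    rw [← hdeg]; exact leadingCoeff_ne_zero.mpr hf.ne_zero)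
  have he := f.as_sum_range_C_mul_X_pow
  rw [hdeg] at he
  simp only [Finset.sum_range_succ, Finset.sum_range_zero, h0, h5] at he
  have h1 : f.coeff 1 = 1 + f.coeff 2 + f.coeff 3 + f.coeff 4 := by
    rw [he] at e1
    simp only [eval_add, eval_mul, eval_C, eval_pow, eval_X, one_pow, mul_one, eval_zero] at e1
    generalize f.coeff 1 = a, f.coeff 2 = b, f.coeff 3 = c, f.coeff 4 = d at e1 ⊢
    revert a b c d
    decide
  rw [h1] at he
  generalize f.coeff 2 = b, f.coeff 3 = c, f.coeff 4 = d at he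
  have key : f = (X ^ 3 + 1) + ((X ^ 3 + X ^ 2 + X) +
      ((X ^ 2 + X) * (C c * X + C (b + c)) + (X ^ 4 + X) * (X + C d))) := by
    rw [he]
    simp only [C_add, C_1]
    linear_combination (-X ^ 3 - X ^ 2 - C c * X ^ 2) * two
  by_cases hs : (C c * X + C (b + c) : (ZMod 2)[X]) = 0
  · exfalso
    rw [hs] at key
    have dp : (X ^ 2 + X + 1 : (ZMod 2)[X]).natDegree = 2 := by compute_degree!
    obtain ⟨g, hg⟩ : X ^ 2 + X + 1 ∣ f := ⟨X + 1 + X + X * (X + 1) * (X + C d), by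
      rw [key]
      linear_combination (-X ^ 2 - X - (X ^ 3 + X ^ 2) * (X + C d)) * two⟩
    have hg0 : g ≠ 0 := by rintro rfl; exact hf.ne_zero (by simpa using hg)
    have hd := congrArg natDegree hg
    rw [monic_X_sq_add_X_add_one.natDegree_mul' hg0, dp, hdeg] at hd
    rcases hf.isUnit_or_isUnit hg with hu | hu <;>
      have := natDegree_eq_zero_of_isUnit hu <;> omega
  · exact ⟨_, key ▸ isVID_five_of_linear_ne_zero hs⟩
end

section
/- Every irreducible polynomial of degree 6 over 𝔽₂ = ZMod 2 admits a visibly irreducible decomposition of degree 6. -/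
open Polynomial

/-- The product of the monic irreducible polynomials of degree at most three over `ZMod 2`. -/
noncomputable def prodIrreducibleDegreeLeThree : (ZMod 2)[X] :=
  X * (1 + X) * (1 + X + X ^ 2) * (1 + X + X ^ 3) * (1 + X ^ 2 + X ^ 3)

theorem dvd_prodIrreducibleDegreeLeThree {p : (ZMod 2)[X]} (hp : Irreducible p)
    (hdeg : p.natDegree ≤ 3) : p ∣ prodIrreducibleDegreeLeThree := by
  unfold prodIrreducibleDegreeLeThree
  by_cases h0 : p.eval 0 = 0
  · have hX : X ∣ p := by simpa using dvd_iff_isRoot.mpr h0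
    exact (((((irreducible_X.associated_of_dvd hp hX).symm.dvd.mul_right _).mul_right _).mul_right
      _).mul_right _)
  by_cases h1 : p.eval 1 = 0
  · have hX : X - C 1 ∣ p := dvd_iff_isRoot.mpr h1
    have hpX : p ∣ 1 + X := by
      have := ((irreducible_X_sub_C (1 : ZMod 2)).associated_of_dvd hp hX).symm.dvd
      rwa [sub_eq_add_neg, ← C_neg, ZMod.neg_eq_self_mod_two, C_1, add_comm] at this
    exact (((hpX.mul_left _).mul_right _).mul_right _).mul_right _
  have hs := p.as_sum_range' 4 (by omega)
  simp only [Finset.sum_range_succ, Finset.sum_range_zero, ← C_mul_X_pow_eq_monomial] at hs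
  generalize p.coeff 0 = a at hs
  generalize p.coeff 1 = b at hs
  generalize p.coeff 2 = c at hs
  generalize p.coeff 3 = d at hs
  have hu : p ≠ 1 := hp.ne_one
  rw [hs] at h0 h1
  simp at h0 h1
  have ha := a.eq_zero_or_eq_one_of_two.resolve_left h0
  subst ha
  rcases b.eq_zero_or_eq_one_of_two with rfl | rfl <;>
  rcases c.eq_zero_or_eq_one_of_two with rfl | rfl <;>
  rcases d.eq_zero_or_eq_one_of_two with rfl | rfl <;>
  first
  | exact absurd (by decide) h1
  | simp at hs
  · exact absurd hs hu
  all_goals rw [hs]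
  · exact Dvd.intro_left _ rfl
  · exact (Dvd.intro_left _ rfl).mul_right _
  · exact ((Dvd.intro_left _ rfl).mul_right _).mul_right _

theorem isVID_six_pair {f g h : (ZMod 2)[X]} (hf : Irreducible f) (hfgh : f = g + h)
    (hg : g.natDegree = 6) {m : ℕ} (hh : h.natDegree = m) (hm0 : m ≠ 0) (hm : m < 6)
    (hgh : prodIrreducibleDegreeLeThree ∣ g * h) : IsVID 6 f [g, h] := by
  subst hfgh hh
  have hh0 : h ≠ 0 := by rintro rfl; simp at hm0
  have hg0 : g ≠ 0 := by rintro rfl; simp at hg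
  have hdeg : (g + h).natDegree = 6 := by
    rw [natDegree_add_eq_left_of_natDegree_lt (by omega), hg]
  refine ⟨by simp, ?_, by simp, ⟨0, by simpa using hg, ?_⟩, ?_⟩
  · intro q hq
    simp only [List.mem_cons, List.not_mem_nil, or_false] at hq
    rcases hq with rfl | rfl
    · exact ⟨hg0, hg.le⟩
    · exact ⟨hh0, hm.le⟩
  · intro i hi
    fin_cases i
    · rfl
    · exact absurd hi hm.ne
  · intro p _ hp hpd
    have hpf : ¬ p ∣ g + h := fun hd => by
      have := natDegree_eq_of_degree_eq (degree_eq_degree_of_associated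
        (hp.associated_of_dvd hf hd))
      omega
    rcases hp.prime.dvd_or_dvd ((dvd_prodIrreducibleDegreeLeThree hp (by omega)).trans hgh)
      with hd | hd
    · refine ⟨1, fun hd' => hpf (dvd_add hd hd'), fun i hi => ?_⟩
      fin_cases i
      · exact absurd hd hi
      · rfl
    · refine ⟨0, fun hd' => hpf (dvd_add hd' hd), fun i hi => ?_⟩
      fin_cases i
      · rfl
      · exact absurd hd hi

theorem eq_of_irreducible_of_natDegree_eq_six {f : (ZMod 2)[X]} (hf : Irreducible f)
    (hdeg : f.natDegree = 6) :
    f = 1 + X + X ^ 6 ∨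
    f = 1 + X ^ 3 + X ^ 6 ∨
    f = 1 + X + X ^ 2 + X ^ 4 + X ^ 6 ∨
    f = 1 + X + X ^ 3 + X ^ 4 + X ^ 6 ∨
    f = 1 + X ^ 5 + X ^ 6 ∨
    f = 1 + X + X ^ 2 + X ^ 5 + X ^ 6 ∨
    f = 1 + X ^ 2 + X ^ 3 + X ^ 5 + X ^ 6 ∨
    f = 1 + X + X ^ 4 + X ^ 5 + X ^ 6 ∨
    f = 1 + X ^ 2 + X ^ 4 + X ^ 5 + X ^ 6 := by
  have root : ∀ x, f.eval x ≠ 0 := fun x hx => by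
    have := natDegree_eq_of_degree_eq (degree_eq_degree_of_associated
      ((irreducible_X_sub_C x).associated_of_dvd hf (dvd_iff_isRoot.mpr hx)))
    rw [natDegree_X_sub_C] at this
    omega
  have h0 := root 0
  have h1 := root 1
  have hmul : ∀ u v : (ZMod 2)[X], u.natDegree ≠ 0 → v.natDegree ≠ 0 → f ≠ u * v := by
    rintro u v hu hv rfl
    rcases hf.isUnit_or_isUnit rfl with h | h
    · exact hu (natDegree_eq_zero_of_isUnit h)
    · exact hv (natDegree_eq_zero_of_isUnit h)
  have hred₁ : f ≠ 1 + X ^ 2 + X ^ 6 := fun h =>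
    hmul (1 + X + X ^ 3) (1 + X + X ^ 3)
      (ne_of_eq_of_ne (b := 3) (by compute_degree!) (by norm_num))
      (ne_of_eq_of_ne (b := 3) (by compute_degree!) (by norm_num))
      (h.trans (by ring_nf; reduce_mod_char))
  have hred₂ : f ≠ 1 + X + X ^ 2 + X ^ 3 + X ^ 6 := fun h =>
    hmul (1 + X + X ^ 2) (1 + X ^ 3 + X ^ 4)
      (ne_of_eq_of_ne (b := 2) (by compute_degree!) (by norm_num))
      (ne_of_eq_of_ne (b := 4) (by compute_degree!) (by norm_num))
      (h.trans (by ring_nf; reduce_mod_char))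
  have hred₃ : f ≠ 1 + X ^ 4 + X ^ 6 := fun h =>
    hmul (1 + X ^ 2 + X ^ 3) (1 + X ^ 2 + X ^ 3)
      (ne_of_eq_of_ne (b := 3) (by compute_degree!) (by norm_num))
      (ne_of_eq_of_ne (b := 3) (by compute_degree!) (by norm_num))
      (h.trans (by ring_nf; reduce_mod_char))
  have hred₄ : f ≠ 1 + X ^ 2 + X ^ 3 + X ^ 4 + X ^ 6 := fun h =>
    hmul (1 + X + X ^ 2) (1 + X + X ^ 2 + X ^ 3 + X ^ 4)
      (ne_of_eq_of_ne (b := 2) (by compute_degree!) (by norm_num))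
      (ne_of_eq_of_ne (b := 4) (by compute_degree!) (by norm_num))
      (h.trans (by ring_nf; reduce_mod_char))
  have hred₅ : f ≠ 1 + X + X ^ 3 + X ^ 5 + X ^ 6 := fun h =>
    hmul (1 + X + X ^ 2) (1 + X ^ 2 + X ^ 4)
      (ne_of_eq_of_ne (b := 2) (by compute_degree!) (by norm_num))
      (ne_of_eq_of_ne (b := 4) (by compute_degree!) (by norm_num))
      (h.trans (by ring_nf; reduce_mod_char))
  have hred₆ : f ≠ 1 + X ^ 3 + X ^ 4 + X ^ 5 + X ^ 6 := fun h =>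
    hmul (1 + X + X ^ 2) (1 + X + X ^ 4)
      (ne_of_eq_of_ne (b := 2) (by compute_degree!) (by norm_num))
      (ne_of_eq_of_ne (b := 4) (by compute_degree!) (by norm_num))
      (h.trans (by ring_nf; reduce_mod_char))
  have hred₇ : f ≠ 1 + X + X ^ 2 + X ^ 3 + X ^ 4 + X ^ 5 + X ^ 6 := fun h =>
    hmul (1 + X + X ^ 3) (1 + X ^ 2 + X ^ 3)
      (ne_of_eq_of_ne (b := 3) (by compute_degree!) (by norm_num))
      (ne_of_eq_of_ne (b := 3) (by compute_degree!) (by norm_num))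
      (h.trans (by ring_nf; reduce_mod_char))
  have hs := f.as_sum_range' 7 (by omega)
  have h6 : f.coeff 6 = 1 := (ZMod.eq_zero_or_eq_one_of_two _).resolve_left fun h => hf.ne_zero
    (leadingCoeff_eq_zero.mp (by rwa [leadingCoeff, hdeg]))
  simp only [Finset.sum_range_succ, Finset.sum_range_zero, ← C_mul_X_pow_eq_monomial, h6] at hs
  generalize f.coeff 0 = a at hs
  generalize f.coeff 1 = b at hs
  generalize f.coeff 2 = c at hs
  generalize f.coeff 3 = d at hs
  generalize f.coeff 4 = e at hs
  generalize f.coeff 5 = g at hs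
  rw [hs] at h0 h1
  simp at h0 h1
  have ha := a.eq_zero_or_eq_one_of_two.resolve_left h0
  subst ha
  rcases b.eq_zero_or_eq_one_of_two with rfl | rfl <;>
  rcases c.eq_zero_or_eq_one_of_two with rfl | rfl <;>
  rcases d.eq_zero_or_eq_one_of_two with rfl | rfl <;>
  rcases e.eq_zero_or_eq_one_of_two with rfl | rfl <;>
  rcases g.eq_zero_or_eq_one_of_two with rfl | rfl <;>
  first
  | exact absurd (by decide) h1
  | simp only [map_one, map_zero, zero_mul, one_mul, add_zero, zero_add, pow_zero, pow_one] at hs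
  all_goals simp only [hs, not_true_eq_false, ne_eq, true_or, or_true] at *

theorem sextics_over_F2_have_VID (f : (ZMod 2)[X]) (hf : Irreducible f)
    (hdeg : f.natDegree = 6) :
    ∃ l : List (ZMod 2)[X], IsVID 6 f l := by
  rcases eq_of_irreducible_of_natDegree_eq_six hf hdeg with
    rfl | rfl | rfl | rfl | rfl | rfl | rfl | rfl | rfl
  · exact ⟨_, isVID_six_pair (g := X + X ^ 4 + X ^ 5 + X ^ 6) (h := 1 + X ^ 4 + X ^ 5)
      (m := 5) hf (by ring_nf; reduce_mod_char) (by compute_degree!) (by compute_degree!)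
      (by simp) (by simp)
      ⟨1 + X, by unfold prodIrreducibleDegreeLeThree; ring_nf; reduce_mod_char⟩⟩
  · exact ⟨_, isVID_six_pair (g := 1 + X + X ^ 4 + X ^ 6) (h := X + X ^ 3 + X ^ 4)
      (m := 4) hf (by ring_nf; reduce_mod_char) (by compute_degree!) (by compute_degree!)
      (by simp) (by simp)
      ⟨1, by unfold prodIrreducibleDegreeLeThree; ring_nf; reduce_mod_char⟩⟩
  · exact ⟨_, isVID_six_pair (g := X ^ 2 + X ^ 4 + X ^ 5 + X ^ 6) (h := 1 + X + X ^ 5)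
      (m := 5) hf (by ring_nf; reduce_mod_char) (by compute_degree!) (by compute_degree!)
      (by simp) (by simp)
      ⟨X, by unfold prodIrreducibleDegreeLeThree; ring_nf; reduce_mod_char⟩⟩
  · exact ⟨_, isVID_six_pair (g := X + X ^ 2 + X ^ 6) (h := 1 + X ^ 2 + X ^ 3 + X ^ 4)
      (m := 4) hf (by ring_nf; reduce_mod_char) (by compute_degree!) (by compute_degree!)
      (by simp) (by simp)
      ⟨1, by unfold prodIrreducibleDegreeLeThree; ring_nf; reduce_mod_char⟩⟩
  · exact ⟨_, isVID_six_pair (g := X + X ^ 2 + X ^ 6) (h := 1 + X + X ^ 2 + X ^ 5)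
      (m := 5) hf (by ring_nf; reduce_mod_char) (by compute_degree!) (by compute_degree!)
      (by simp) (by simp)
      ⟨1 + X, by unfold prodIrreducibleDegreeLeThree; ring_nf; reduce_mod_char⟩⟩
  · exact ⟨_, isVID_six_pair (g := 1 + X + X ^ 4 + X ^ 6) (h := X ^ 2 + X ^ 4 + X ^ 5)
      (m := 5) hf (by ring_nf; reduce_mod_char) (by compute_degree!) (by compute_degree!)
      (by simp) (by simp)
      ⟨X, by unfold prodIrreducibleDegreeLeThree; ring_nf; reduce_mod_char⟩⟩
  · exact ⟨_, isVID_six_pair (g := X + X ^ 2 + X ^ 3 + X ^ 6) (h := 1 + X + X ^ 5)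
      (m := 5) hf (by ring_nf; reduce_mod_char) (by compute_degree!) (by compute_degree!)
      (by simp) (by simp)
      ⟨1 + X, by unfold prodIrreducibleDegreeLeThree; ring_nf; reduce_mod_char⟩⟩
  · exact ⟨_, isVID_six_pair (g := 1 + X ^ 2 + X ^ 5 + X ^ 6) (h := X + X ^ 2 + X ^ 4)
      (m := 4) hf (by ring_nf; reduce_mod_char) (by compute_degree!) (by compute_degree!)
      (by simp) (by simp)
      ⟨1, by unfold prodIrreducibleDegreeLeThree; ring_nf; reduce_mod_char⟩⟩
  · exact ⟨_, isVID_six_pair (g := X + X ^ 5 + X ^ 6) (h := 1 + X + X ^ 2 + X ^ 4)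
      (m := 4) hf (by ring_nf; reduce_mod_char) (by compute_degree!) (by compute_degree!)
      (by simp) (by simp)
      ⟨1, by unfold prodIrreducibleDegreeLeThree; ring_nf; reduce_mod_char⟩⟩
end

section
/- Every irreducible polynomial of degree 7 over 𝔽₂ = ZMod 2 admits a visibly irreducible decomposition of degree 7. -/
open Polynomial

/-- A splitting `f = A + B` of an irreducible polynomial such that every monic irreducible of degree
at most `d / 2` divides one of the two summands is a visibly irreducible decomposition. -/
theorem isVID_pair {F : Type*} [Field F] {d : ℕ} {f A B : F[X]} (hf : Irreducible f)
    (hdeg : f.natDegree = d) (hsum : A + B = f) (hA : A ≠ 0) (hAdeg : A.natDegree < d)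
    (hdvd : ∀ p : F[X], Irreducible p → 2 * p.natDegree ≤ d → p ∣ A ∨ p ∣ B) :
    IsVID d f [A, B] := by
  have hBdeg : B.natDegree = d := by
    have : B = f - A := by rw [← hsum]; ring
    rw [this, natDegree_sub_eq_left_of_natDegree_lt (by omega), hdeg]
  have hB : B ≠ 0 := by
    rintro rfl
    simp at hBdeg
    omega
  refine ⟨by simp, ?_, by simpa using hsum, ⟨1, by simpa using hBdeg, ?_⟩, ?_⟩
  · simp [hA, hB, hAdeg.le, hBdeg]
  · intro i hi
    fin_cases i
    · simp at hi
      omega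
    · rfl
  · intro p _ hp hpd
    have hpf : ¬ p ∣ A + B := by
      rw [hsum]
      intro h
      have := natDegree_eq_of_degree_eq (degree_eq_degree_of_associated (hp.associated_of_dvd hf h))
      omega
    rcases hdvd p hp hpd with h | h
    · refine ⟨1, by simpa using fun hB => hpf (dvd_add h hB), fun i hi => ?_⟩
      fin_cases i
      · exact absurd h hi
      · rfl
    · refine ⟨0, by simpa using fun hA => hpf (dvd_add hA h), fun i hi => ?_⟩
      fin_cases i
      · rfl
      · exact absurd h hi

theorem two_eq_zero_F2X : (2 : (ZMod 2)[X]) = 0 :=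
  CharTwo.two_eq_zero

theorem eq_zero_or_eq_one_F2 : ∀ a : ZMod 2, a = 0 ∨ a = 1 := by decide

theorem X_add_one_eq_X_sub_C_F2 : (X + 1 : (ZMod 2)[X]) = X - C 1 := by
  rw [C_1]
  linear_combination two_eq_zero_F2X

theorem irreducible_X_add_one_F2 : Irreducible (X + 1 : (ZMod 2)[X]) := by
  rw [X_add_one_eq_X_sub_C_F2]
  exact irreducible_X_sub_C 1

/-- A polynomial over `𝔽₂` without the factor `X` has constant term `1`. -/
theorem X_dvd_sub_one_F2 {f : (ZMod 2)[X]} (h : ¬ X ∣ f) : X ∣ f - 1 := by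
  rw [X_dvd_iff] at h ⊢
  rcases eq_zero_or_eq_one_F2 (f.coeff 0) with h0 | h0
  · exact absurd h0 h
  · simp [h0]

theorem X_add_one_dvd_iff_F2 {f : (ZMod 2)[X]} : X + 1 ∣ f ↔ f.eval 1 = 0 := by
  rw [X_add_one_eq_X_sub_C_F2, dvd_iff_isRoot, IsRoot.def]

theorem X_add_one_dvd_sub_one_F2 {f : (ZMod 2)[X]} (h : ¬ X + 1 ∣ f) : X + 1 ∣ f - 1 := by
  rw [X_add_one_dvd_iff_F2] at h ⊢
  rcases eq_zero_or_eq_one_F2 (f.eval 1) with h0 | h0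
  · exact absurd h0 h
  · simp [h0]

/-- The nonzero residues modulo `X ^ 2 + X + 1` over `𝔽₂`. -/
theorem quadratic_dvd_sub_F2 {f : (ZMod 2)[X]} (h : ¬ X ^ 2 + X + 1 ∣ f) :
    X ^ 2 + X + 1 ∣ f - 1 ∨ X ^ 2 + X + 1 ∣ f - X ∨ X ^ 2 + X + 1 ∣ f - (X + 1) := by
  have hm : (X ^ 2 + X + 1 : (ZMod 2)[X]).Monic := by monicity!
  have hd : (X ^ 2 + X + 1 : (ZMod 2)[X]).natDegree = 2 := by compute_degree!
  have hr : (f %ₘ (X ^ 2 + X + 1)).natDegree ≤ 1 := by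
    have := natDegree_modByMonic_lt f hm (by intro h; rw [h] at hd; simp at hd)
    omega
  have hdvd : X ^ 2 + X + 1 ∣ f - f %ₘ (X ^ 2 + X + 1) :=
    ⟨f /ₘ (X ^ 2 + X + 1), by linear_combination - modByMonic_add_div f (X ^ 2 + X + 1)⟩
  obtain ⟨a, b, hab⟩ := exists_eq_X_add_C_of_natDegree_le_one hr
  rw [hab] at hdvd
  rcases eq_zero_or_eq_one_F2 a with rfl | rfl <;>
    rcases eq_zero_or_eq_one_F2 b with rfl | rfl <;> simp at hdvd <;> tauto

/-- Every irreducible polynomial over `𝔽₂` of degree at most `3` is one of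
`X`, `X + 1`, `X² + X + 1`, `X³ + X + 1` and `X³ + X² + 1`. -/
theorem dvd_of_irreducible_of_natDegree_le_three_F2 {p : (ZMod 2)[X]} (hp : Irreducible p)
    (hd : p.natDegree ≤ 3) :
    p ∣ X ∨ p ∣ X + 1 ∨ p ∣ X ^ 2 + X + 1 ∨ p ∣ X ^ 3 + X + 1 ∨ p ∣ X ^ 3 + X ^ 2 + 1 := by
  by_cases h0 : X ∣ p
  · exact Or.inl (irreducible_X.dvd_symm hp h0)
  by_cases h1 : X + 1 ∣ p
  · exact Or.inr (Or.inl (irreducible_X_add_one_F2.dvd_symm hp h1))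
  have hsum := p.as_sum_range_C_mul_X_pow' (n := 4) (by omega)
  simp only [Finset.sum_range_succ, Finset.sum_range_zero] at hsum
  rw [X_dvd_iff] at h0
  rw [X_add_one_dvd_iff_F2] at h1
  generalize p.coeff 0 = a, p.coeff 1 = b, p.coeff 2 = c, p.coeff 3 = e at hsum h0
  subst hsum
  simp at h1
  have key : ∀ a b c e : ZMod 2, a ≠ 0 → a + b + c + e ≠ 0 →
      a = 1 ∧ (b = 0 ∧ c = 0 ∧ e = 0 ∨ b = 1 ∧ c = 1 ∧ e = 0 ∨ b = 1 ∧ c = 0 ∧ e = 1 ∨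
        b = 0 ∧ c = 1 ∧ e = 1) := by decide
  obtain ⟨rfl, ⟨rfl, rfl, rfl⟩ | ⟨rfl, rfl, rfl⟩ | ⟨rfl, rfl, rfl⟩ | ⟨rfl, rfl, rfl⟩⟩ :=
    key a b c e h0 h1
  · simp at hp
  · exact Or.inr (Or.inr (Or.inl (dvd_of_eq (by simp; ring))))
  · exact Or.inr (Or.inr (Or.inr (Or.inl (dvd_of_eq (by simp; ring)))))
  · exact Or.inr (Or.inr (Or.inr (Or.inr (dvd_of_eq (by simp; ring)))))

/-- `(X⁷ - 1) / (X - 1)` is the product of the two irreducible cubics over `𝔽₂`. -/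
theorem cubic_mul_cubic_F2 : (X ^ 6 + X ^ 5 + X ^ 4 + X ^ 3 + X ^ 2 + X + 1 : (ZMod 2)[X]) =
    (X ^ 3 + X + 1) * (X ^ 3 + X ^ 2 + 1) := by
  linear_combination -X ^ 3 * two_eq_zero_F2X

theorem septimics_over_F2_have_VID (f : (ZMod 2)[X]) (hf : Irreducible f)
    (hdeg : f.natDegree = 7) :
    ∃ l : List (ZMod 2)[X], IsVID 7 f l := by
  have hlead : f.coeff 7 = 1 := by
    have : f.leadingCoeff ≠ 0 := leadingCoeff_ne_zero.mpr hf.ne_zero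
    rw [leadingCoeff, hdeg] at this
    exact (eq_zero_or_eq_one_F2 _).resolve_left this
  have hlt : ∀ g : (ZMod 2)[X], g.natDegree ≤ 7 → g.coeff 7 = 1 → (f - g).natDegree < 7 := by
    intro g hg hg7
    have hle : (f - g).natDegree ≤ 7 := (natDegree_sub_le f g).trans (by omega)
    refine lt_of_le_of_ne hle fun h => ?_
    have hz : (f - g).leadingCoeff = 0 := by simp [leadingCoeff, h, hlead, hg7]
    rw [leadingCoeff_eq_zero] at hz
    simp [hz] at h
  have hndvd : ∀ p : (ZMod 2)[X], 0 < p.natDegree → p.natDegree < 7 → ¬ p ∣ f := by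
    intro p hp hp7 h
    rcases hf.dvd_iff.mp h with hu | ha
    · have := natDegree_eq_zero_of_isUnit hu
      omega
    · have := natDegree_eq_of_degree_eq (degree_eq_degree_of_associated ha)
      omega
  have nX : ¬ X ∣ f := hndvd _ (by simp) (by simp)
  have d1 : (X + 1 : (ZMod 2)[X]).natDegree = 1 := by compute_degree!
  have nX1 : ¬ X + 1 ∣ f := hndvd _ (by omega) (by omega)
  have dq : (X ^ 2 + X + 1 : (ZMod 2)[X]).natDegree = 2 := by compute_degree!
  have hX := X_dvd_sub_one_F2 nX
  have hX1 := X_add_one_dvd_sub_one_F2 nX1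
  have hS := cubic_mul_cubic_F2
  set S : (ZMod 2)[X] := X ^ 6 + X ^ 5 + X ^ 4 + X ^ 3 + X ^ 2 + X + 1 with hSdef
  have hc1 : X ^ 3 + X + 1 ∣ S := ⟨_, hS⟩
  have hc2 : X ^ 3 + X ^ 2 + 1 ∣ S := ⟨_, hS.trans (mul_comm _ _)⟩
  have dS : S.natDegree = 6 := by rw [hSdef]; compute_degree!
  rcases quadratic_dvd_sub_F2 (hndvd _ (by omega) (by omega)) with hq | hq | hq
  · refine ⟨_, isVID_pair (A := S) (B := f - S) hf hdeg (by ring) ?_ (by omega) ?_⟩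
    · intro h
      simp [h] at dS
    · intro p hp hpd
      rcases dvd_of_irreducible_of_natDegree_le_three_F2 hp (by omega) with h | h | h | h | h
      · refine Or.inr (h.trans ?_)
        obtain ⟨g, hg⟩ := hX
        exact ⟨g - (X ^ 5 + X ^ 4 + X ^ 3 + X ^ 2 + X + 1), by linear_combination hg - hSdef⟩
      · refine Or.inr (h.trans ?_)
        obtain ⟨g, hg⟩ := hX1
        exact ⟨g - (X ^ 5 + X ^ 3 + X), by linear_combination hg - hSdef⟩
      · refine Or.inr (h.trans ?_)
        obtain ⟨g, hg⟩ := hq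
        exact ⟨g - (X ^ 4 + X), by linear_combination hg - hSdef⟩
      · exact Or.inl (h.trans hc1)
      · exact Or.inl (h.trans hc2)
  · refine ⟨_, isVID_pair (A := f - X * S) (B := X * S) hf hdeg (by ring) ?_ (hlt _ ?_ ?_) ?_⟩
    · intro h
      exact nX ⟨S, sub_eq_zero.mp h⟩
    · exact natDegree_mul_le.trans (by simp [dS])
    · simp [hSdef, coeff_X, coeff_one]
    · intro p hp hpd
      rcases dvd_of_irreducible_of_natDegree_le_three_F2 hp (by omega) with h | h | h | h | h
      · exact Or.inr (h.mul_right _)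
      · refine Or.inl (h.trans ?_)
        obtain ⟨g, hg⟩ := hX1
        exact ⟨g - (X ^ 6 + X ^ 4 + X ^ 2 + 1), by
          linear_combination hg - X * hSdef + two_eq_zero_F2X⟩
      · refine Or.inl (h.trans ?_)
        obtain ⟨g, hg⟩ := hq
        exact ⟨g - (X ^ 5 + X ^ 2), by linear_combination hg - X * hSdef⟩
      · exact Or.inr ((h.trans hc1).mul_left _)
      · exact Or.inr ((h.trans hc2).mul_left _)
  · refine ⟨_, isVID_pair (A := f - (X + 1) * S) (B := (X + 1) * S) hf hdeg (by ring) ?_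
      (hlt _ ?_ ?_) ?_⟩
    · intro h
      exact nX1 ⟨S, sub_eq_zero.mp h⟩
    · exact natDegree_mul_le.trans (by omega)
    · simp [hSdef, add_mul, coeff_X, coeff_one]
    · intro p hp hpd
      rcases dvd_of_irreducible_of_natDegree_le_three_F2 hp (by omega) with h | h | h | h | h
      · refine Or.inl (h.trans ?_)
        obtain ⟨g, hg⟩ := hX
        exact ⟨g - (S + X ^ 5 + X ^ 4 + X ^ 3 + X ^ 2 + X + 1), by
          linear_combination hg - hSdef⟩
      · exact Or.inr (h.mul_right _)
      · refine Or.inl (h.trans ?_)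
        obtain ⟨g, hg⟩ := hq
        exact ⟨g - (X + 1) * (X ^ 4 + X), by linear_combination hg - (X + 1) * hSdef⟩
      · exact Or.inr ((h.trans hc1).mul_left _)
      · exact Or.inr ((h.trans hc2).mul_left _)
end

section
/- The number of monic irreducible polynomials of degree 5 over 𝔽₃ = ZMod 3 that admit a visibly irreducible decomposition of degree 5 is exactly 24 (i.e., exactly half of the 48 monic irreducible quintics over 𝔽₃). -/
open Polynomial

namespace VisiblyIrreducible

/-- The monic irreducible polynomials of degree at most two over `ZMod 3`. -/
noncomputable def smallPrime : Fin 6 → (ZMod 3)[X] :=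
  ![X, X + 1, X - 1, X ^ 2 + 1, X ^ 2 + X - 1, X ^ 2 - X - 1]

/-- The degrees of the polynomials `smallPrime`. -/
def smallDegree : Fin 6 → ℕ := ![1, 1, 1, 2, 2, 2]

/-- The product of the residue rings of `(ZMod 3)[X]` at its three monic irreducible quadratics. -/
abbrev ResidueRing : Type :=
  QuadraticAlgebra (ZMod 3) (-1) 0 × QuadraticAlgebra (ZMod 3) 1 (-1) × QuadraticAlgebra (ZMod 3) 1 1

/-- The residue class of `X`. -/
def residueX : ResidueRing := (⟨0, 1⟩, ⟨0, 1⟩, ⟨0, 1⟩)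

/-- The residue classes of the polynomials `smallPrime`. -/
def smallResidue : Fin 6 → ResidueRing :=
  ![residueX, residueX + 1, residueX - 1, residueX ^ 2 + 1, residueX ^ 2 + residueX - 1,
    residueX ^ 2 - residueX - 1]

lemma aeval_smallPrime (i : Fin 6) : aeval residueX (smallPrime i) = smallResidue i := by
  fin_cases i <;> simp [smallPrime, smallResidue]

lemma smallPrime_injective : Function.Injective smallPrime := by
  have h : Function.Injective smallResidue := by decide +kernel
  intro i j hij
  exact h (by rw [← aeval_smallPrime, ← aeval_smallPrime, hij])

lemma monic_smallPrime (i : Fin 6) : (smallPrime i).Monic := by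
  fin_cases i <;> simp only [smallPrime] <;> simp <;> monicity!

lemma natDegree_smallPrime (i : Fin 6) : (smallPrime i).natDegree = smallDegree i := by
  fin_cases i <;> simp only [smallPrime, smallDegree] <;> simp <;> compute_degree!

lemma irreducible_smallPrime (i : Fin 6) : Irreducible (smallPrime i) := by
  by_cases hi : smallDegree i = 1
  · exact irreducible_of_degree_eq_one (degree_eq_iff_natDegree_eq_of_pos one_pos |>.2
      (by rw [natDegree_smallPrime, hi]))
  · refine irreducible_of_degree_le_three_of_not_isRoot ?_ ?_
    · rw [natDegree_smallPrime]
      revert i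
      decide
    · intro x
      fin_cases i <;> simp [smallDegree] at hi <;> simp [smallPrime] <;> revert x <;> decide

lemma exists_eq_smallPrime {p : (ZMod 3)[X]} (hm : p.Monic) (hp : Irreducible p)
    (hd : p.natDegree ≤ 2) : ∃ i, p = smallPrime i := by
  have hpos := hp.natDegree_pos
  obtain h | h : p.natDegree = 1 ∨ p.natDegree = 2 := by omega
  · have hc : p.coeff 1 = 1 := by rw [← h]; exact hm
    have hX : p = X + C (p.coeff 0) := by
      conv_lhs => rw [eq_X_add_C_of_natDegree_le_one h.le]
      simp [hc]
    generalize p.coeff 0 = a at hX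
    have hall : ∀ a : ZMod 3, a = 0 ∨ a = 1 ∨ a = -1 := by decide
    obtain rfl | rfl | rfl : a = 0 ∨ a = 1 ∨ a = -1 := hall a
    · exact ⟨0, by simp [hX, smallPrime]⟩
    · exact ⟨1, by simp [hX, smallPrime]⟩
    · exact ⟨2, by simp [hX, smallPrime, sub_eq_add_neg]⟩
  · have hc : p.coeff 2 = 1 := by rw [← h]; exact hm
    have hX : p = X ^ 2 + C (p.coeff 1) * X + C (p.coeff 0) := by
      conv_lhs => rw [p.as_sum_range' 3 (by omega)]
      simp [Finset.sum_range_succ, hc, ← C_mul_X_pow_eq_monomial]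
      ring
    have hroot : ∀ x, ¬ p.IsRoot x := fun x hx => by
      have := natDegree_eq_of_degree_eq_some (degree_eq_one_of_irreducible_of_root hp hx)
      rw [h] at this
      exact absurd this (by decide)
    generalize p.coeff 0 = b at hX
    generalize p.coeff 1 = a at hX
    have hab : ∀ x : ZMod 3, x ^ 2 + a * x + b ≠ 0 := fun x hx => hroot x (by simp [hX, hx])
    obtain ⟨rfl, rfl⟩ | ⟨rfl, rfl⟩ | ⟨rfl, rfl⟩ :
        (a = 0 ∧ b = 1) ∨ (a = 1 ∧ b = -1) ∨ (a = -1 ∧ b = -1) := by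
      clear hX
      revert a b
      decide
    · exact ⟨3, by simp [hX, smallPrime]⟩
    · exact ⟨4, by simp [hX, smallPrime, sub_eq_add_neg]⟩
    · exact ⟨5, by simp [hX, smallPrime, sub_eq_add_neg]⟩

/-- The product of a set of the polynomials `smallPrime`. -/
noncomputable def smallProd (T : Finset (Fin 6)) : (ZMod 3)[X] := ∏ i ∈ T, smallPrime i

lemma monic_smallProd (T : Finset (Fin 6)) : (smallProd T).Monic :=
  monic_prod_of_monic _ _ fun i _ => monic_smallPrime i

lemma natDegree_smallProd (T : Finset (Fin 6)) :
    (smallProd T).natDegree = ∑ i ∈ T, smallDegree i := by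
  rw [smallProd, natDegree_prod_of_monic _ _ fun i _ => monic_smallPrime i]
  exact Finset.sum_congr rfl fun i _ => natDegree_smallPrime i

lemma isCoprime_smallPrime {i j : Fin 6} (h : i ≠ j) :
    IsCoprime (smallPrime i) (smallPrime j) := by
  refine (irreducible_smallPrime i).coprime_iff_not_dvd.2 fun hd => h (smallPrime_injective ?_)
  exact eq_of_monic_of_associated (monic_smallPrime i) (monic_smallPrime j)
    ((irreducible_smallPrime i).associated_of_dvd (irreducible_smallPrime j) hd)

lemma smallProd_dvd {T : Finset (Fin 6)} {g : (ZMod 3)[X]} (h : ∀ i ∈ T, smallPrime i ∣ g) :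
    smallProd T ∣ g :=
  Finset.prod_dvd_of_coprime (fun _ _ _ _ hij => isCoprime_smallPrime hij) h

lemma smallPrime_dvd_smallProd_iff {T : Finset (Fin 6)} {i : Fin 6} :
    smallPrime i ∣ smallProd T ↔ i ∈ T := by
  refine ⟨fun h => ?_, fun h => Finset.dvd_prod_of_mem _ h⟩
  obtain ⟨j, hj, hd⟩ := (irreducible_smallPrime i).prime.exists_mem_finset_dvd h
  by_contra hi
  have hij : i ≠ j := fun e => hi (e ▸ hj)
  exact (irreducible_smallPrime i).not_isUnit ((isCoprime_smallPrime hij).isUnit_of_dvd' dvd_rfl hd)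

/-- The parameters of the decompositions: the small irreducibles dividing the monic entry of degree
five, and the leading coefficient of the other entry. -/
@[irreducible] def params : Finset (Finset (Fin 6) × ZMod 3) :=
  (Finset.univ.filter fun T : Finset (Fin 6) => ∑ i ∈ T, smallDegree i = 5) ×ˢ {1, -1}

/-- The sum of the decomposition with given parameters. -/
noncomputable def vidSum (t : Finset (Fin 6) × ZMod 3) : (ZMod 3)[X] :=
  smallProd t.1 + t.2 • smallProd t.1ᶜ

lemma mem_params {t : Finset (Fin 6) × ZMod 3} :
    t ∈ params ↔ ∑ i ∈ t.1, smallDegree i = 5 ∧ t.2 ≠ 0 := by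
  have h : ∀ c : ZMod 3, c = 1 ∨ c = -1 ↔ c ≠ 0 := by decide
  rw [params, Finset.mem_product, Finset.mem_filter_univ, Finset.mem_insert, Finset.mem_singleton, h]

lemma card_params : params.card = 24 := by decide +kernel

lemma vidSum_injOn : Set.InjOn vidSum params := by
  have hcard : (params.image fun t => ∏ i ∈ t.1, smallResidue i +
      t.2 • ∏ i ∈ t.1ᶜ, smallResidue i).card = params.card := by
    decide +kernel
  intro s hs t ht hst
  refine Finset.card_image_iff.1 hcard hs ht ?_
  simpa [vidSum, smallProd, aeval_smallPrime, map_prod] using congrArg (aeval residueX) hst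

lemma sum_smallDegree_add_compl (T : Finset (Fin 6)) :
    ∑ i ∈ T, smallDegree i + ∑ i ∈ Tᶜ, smallDegree i = 9 :=
  (Finset.sum_add_sum_compl T smallDegree).trans (by decide)

lemma exists_smul_of_dvd {P g : (ZMod 3)[X]} (hP : P.Monic) (hd : P ∣ g)
    (hg : g.natDegree ≤ P.natDegree) : g = g.leadingCoeff • P := by
  rw [smul_eq_C_mul]
  exact eq_leadingCoeff_mul_of_monic_of_dvd_of_natDegree_le hP hd hg

/-- A sum of two polynomials of degrees five and at most four, divisible by complementary products
of small irreducibles, is `vidSum` of suitable parameters. -/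
lemma add_mem_image_vidSum {T : Finset (Fin 6)} {g h : (ZMod 3)[X]} (hT : smallProd T ∣ g)
    (hTc : smallProd Tᶜ ∣ h) (hg : g.natDegree = 5) (hh : h.natDegree < 5) (hg0 : g ≠ 0)
    (hh0 : h ≠ 0) (hm : (g + h).Monic) : g + h ∈ vidSum '' params := by
  have hdg := natDegree_le_of_dvd hT hg0
  have hdh := natDegree_le_of_dvd hTc hh0
  rw [natDegree_smallProd] at hdg hdh
  have hsum := sum_smallDegree_add_compl T
  have hlead : g.leadingCoeff = 1 := by
    rw [← hm.leadingCoeff, leadingCoeff_add_of_degree_lt']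
    exact degree_lt_degree (hh.trans_eq hg.symm)
  refine ⟨(T, h.leadingCoeff), ?_, ?_⟩
  · exact Finset.mem_coe.2 (mem_params.2 ⟨by dsimp only; omega, leadingCoeff_ne_zero.2 hh0⟩)
  · have h1 := exists_smul_of_dvd (monic_smallProd T) hT (by rw [natDegree_smallProd]; omega)
    have h2 := exists_smul_of_dvd (monic_smallProd Tᶜ) hTc (by rw [natDegree_smallProd]; omega)
    rw [hlead, one_smul] at h1
    simp only [vidSum]
    rw [← h1, ← h2]

lemma mem_image_vidSum_of_isVID {f : (ZMod 3)[X]} {l : List (ZMod 3)[X]} (hf : f.Monic)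
    (hl : IsVID 5 f l) : f ∈ vidSum '' params := by
  obtain ⟨hlen, hdeg, hsum, hfive, hp⟩ := hl
  have hex (i : Fin 6) : ∃ k : Fin l.length, ∀ m, m ≠ k → smallPrime i ∣ l.get m := by
    obtain ⟨k, -, hk⟩ := hp _ (monic_smallPrime i) (irreducible_smallPrime i)
      (by rw [natDegree_smallPrime]; revert i; decide)
    exact ⟨k, fun m hm => by_contra fun hd => hm (hk m hd)⟩
  choose κ hκ using hex
  have hdvd (k : Fin l.length) : smallProd (Finset.univ.filter (κ · = k))ᶜ ∣ l.get k :=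
    smallProd_dvd fun i hi => hκ i k fun e => by simp [e] at hi
  have hfour (k : Fin l.length) : 4 ≤ ∑ i with κ i = k, smallDegree i := by
    obtain ⟨h0, h5⟩ := hdeg _ (l.get_mem k)
    have h := natDegree_le_of_dvd (hdvd k) h0
    rw [natDegree_smallProd] at h
    have := sum_smallDegree_add_compl {i | κ i = k}
    omega
  have hlen2 : l.length = 2 := by
    have h := Finset.card_nsmul_le_sum Finset.univ
      (fun k => ∑ i with κ i = k, smallDegree i) 4 fun k _ => hfour k
    rw [Finset.sum_fiberwise, Finset.card_univ, Fintype.card_fin,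
      show ∑ i, smallDegree i = 9 by decide, smul_eq_mul] at h
    omega
  obtain ⟨g, h, rfl⟩ := List.length_eq_two.1 hlen2
  have hfib : (Finset.univ.filter (κ · = (0 : Fin 2)))ᶜ = Finset.univ.filter (κ · = (1 : Fin 2)) := by
    ext i
    have : ∀ k : Fin 2, ¬ k = 0 ↔ k = 1 := by decide
    simpa using this (κ i)
  have hdg : smallProd (Finset.univ.filter (κ · = (1 : Fin 2))) ∣ g := hfib ▸ hdvd 0
  have hdh : smallProd (Finset.univ.filter (κ · = (1 : Fin 2)))ᶜ ∣ h := hdvd 1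
  obtain ⟨hg0, hg5⟩ := hdeg g (by simp)
  obtain ⟨hh0, hh5⟩ := hdeg h (by simp)
  obtain rfl : g + h = f := by simpa using hsum
  obtain ⟨k, hk, huniq⟩ := hfive
  have h01 : ¬ (g.natDegree = 5 ∧ h.natDegree = 5) := fun ⟨h1, h2⟩ => by
    have : (0 : Fin 2) = 1 := (huniq (0 : Fin 2) h1).trans (huniq (1 : Fin 2) h2).symm
    exact absurd this (by decide)
  obtain hg | hh : g.natDegree = 5 ∨ h.natDegree = 5 := by
    change Fin 2 at k
    fin_cases k
    · exact Or.inl hk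
    · exact Or.inr hk
  · exact add_mem_image_vidSum hdg hdh hg (by omega) hg0 hh0 hf
  · rw [add_comm] at hf ⊢
    exact add_mem_image_vidSum hdh (by rwa [compl_compl]) hh (by omega) hh0 hg0 hf

lemma not_smallPrime_dvd_vidSum {t : Finset (Fin 6) × ZMod 3} (ht : t.2 ≠ 0) (i : Fin 6) :
    ¬ smallPrime i ∣ vidSum t := by
  intro h
  by_cases hi : i ∈ t.1
  · have h' := (dvd_add_right (smallPrime_dvd_smallProd_iff.2 hi)).1 h
    rw [smul_eq_C_mul, dvd_C_mul ht, smallPrime_dvd_smallProd_iff] at h'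
    simp [hi] at h'
  · have h' := (dvd_add_left (dvd_smul_of_dvd t.2
      (smallPrime_dvd_smallProd_iff.2 (Finset.mem_compl.2 hi)))).1 h
    exact hi (smallPrime_dvd_smallProd_iff.1 h')

lemma vidSum_spec {t : Finset (Fin 6) × ZMod 3} (ht : t ∈ params) :
    (vidSum t).Monic ∧ Irreducible (vidSum t) ∧ (vidSum t).natDegree = 5 ∧
      ∃ l : List (ZMod 3)[X], IsVID 5 (vidSum t) l := by
  obtain ⟨h5, hc⟩ := mem_params.1 ht
  have hsum := sum_smallDegree_add_compl t.1
  have hg : (smallProd t.1).natDegree = 5 := by rw [natDegree_smallProd, h5]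
  have hh : (t.2 • smallProd t.1ᶜ).natDegree = 4 := by
    rw [natDegree_smul _ hc, natDegree_smallProd]
    omega
  have hlt : (t.2 • smallProd t.1ᶜ).degree < (smallProd t.1).degree :=
    degree_lt_degree (by omega)
  have hm : (vidSum t).Monic := (monic_smallProd _).add_of_left hlt
  have hd : (vidSum t).natDegree = 5 :=
    (natDegree_add_eq_left_of_degree_lt hlt).trans hg
  refine ⟨hm, ?_, hd, [smallProd t.1, t.2 • smallProd t.1ᶜ], le_rfl, ?_, by simp [vidSum], ?_, ?_⟩
  · rw [hm.irreducible_iff_lt_natDegree_lt (fun h => by simp [h] at hd)]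
    intro q _ hq hqd
    rw [hd, Finset.mem_Ioc] at hq
    obtain ⟨p, hpm, hp, hpq⟩ := q.exists_monic_irreducible_factor
      (not_isUnit_of_natDegree_pos _ hq.1)
    have hle := natDegree_le_of_dvd hpq (fun h => by simp [h] at hq)
    obtain ⟨i, rfl⟩ := exists_eq_smallPrime hpm hp (by omega)
    exact not_smallPrime_dvd_vidSum hc i (hpq.trans hqd)
  · have hg0 : smallProd t.1 ≠ 0 := (monic_smallProd _).ne_zero
    have hh0 : t.2 • smallProd t.1ᶜ ≠ 0 := smul_ne_zero hc (monic_smallProd _).ne_zero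
    intro g hmem
    simp only [List.mem_cons, List.not_mem_nil, or_false] at hmem
    rcases hmem with rfl | rfl
    · exact ⟨hg0, hg.le⟩
    · exact ⟨hh0, by omega⟩
  · refine ⟨(0 : Fin 2), hg, fun k hk => ?_⟩
    change Fin 2 at k
    fin_cases k
    · rfl
    · exact absurd (hh.symm.trans hk) (by decide)
  · intro p hpm hp hpd
    obtain ⟨i, rfl⟩ := exists_eq_smallPrime hpm hp (by omega)
    have hg' : smallPrime i ∣ smallProd t.1 ↔ i ∈ t.1 := smallPrime_dvd_smallProd_iff
    have hh' : smallPrime i ∣ t.2 • smallProd t.1ᶜ ↔ i ∉ t.1 := by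
      rw [smul_eq_C_mul, dvd_C_mul hc, smallPrime_dvd_smallProd_iff, Finset.mem_compl]
    by_cases hi : i ∈ t.1
    · refine ⟨(1 : Fin 2), fun h => hh'.1 h hi, fun k hk => ?_⟩
      change Fin 2 at k
      fin_cases k
      · exact absurd (hg'.2 hi) hk
      · rfl
    · refine ⟨(0 : Fin 2), fun h => hi (hg'.1 h), fun k hk => ?_⟩
      change Fin 2 at k
      fin_cases k
      · rfl
      · exact absurd (hh'.2 hi) hk

end VisiblyIrreducible

open VisiblyIrreducible in
theorem quintics_over_F3_with_VID_count :
    Set.ncard {f : (ZMod 3)[X] | f.Monic ∧ Irreducible f ∧ f.natDegree = 5 ∧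
      ∃ l : List (ZMod 3)[X], IsVID 5 f l} = 24 := by
  have hset : {f : (ZMod 3)[X] | f.Monic ∧ Irreducible f ∧ f.natDegree = 5 ∧
      ∃ l : List (ZMod 3)[X], IsVID 5 f l} = vidSum '' params := by
    ext f
    constructor
    · rintro ⟨hf, -, -, l, hl⟩
      exact mem_image_vidSum_of_isVID hf hl
    · rintro ⟨t, ht, rfl⟩
      exact vidSum_spec ht
  rw [hset, vidSum_injOn.ncard_image, Set.ncard_coe_finset, card_params]
end

section
/- Let F be a finite field with q elements and let d ≥ 2. If the pair (q, d) is not among (2,2), (3,2), (2,3), (3,3), (4,3), (5,3), (2,4), (2,5), (2,6), (2,7), (3,5), then no irreducible polynomial of degree d over F admits a visibly irreducible decomposition of degree d. -/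
open Polynomial

theorem Squarefree.dvd_of_forall_irreducible {K : Type*} [Field K] {P g : K[X]}
    (hP : Squarefree P) (h : ∀ p, Irreducible p → p ∣ P → p ∣ g) : P ∣ g := by
  classical
  rcases eq_or_ne g 0 with rfl | hg
  · exact dvd_zero P
  refine (hP.isRadical.dvd_radical hP.ne_zero).trans ?_
  rw [UniqueFactorizationMonoid.radical_dvd_iff_primeFactors_subset hg]
  intro p hp
  rw [UniqueFactorizationMonoid.mem_primeFactors,
    UniqueFactorizationMonoid.mem_normalizedFactors_iff' hP.ne_zero] at hp
  rw [UniqueFactorizationMonoid.mem_primeFactors,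
    UniqueFactorizationMonoid.mem_normalizedFactors_iff' hg]
  exact ⟨hp.1, hp.2.1, h p hp.1 hp.2.2⟩

theorem squarefree_X_pow_card_pow_sub_X (F : Type*) [Field F] [Fintype F] {m : ℕ} (hm : m ≠ 0) :
    Squarefree (X ^ Fintype.card F ^ m - X : F[X]) := by
  obtain ⟨p, hp⟩ := CharP.exists F
  refine (galois_poly_separable p _ ?_).squarefree
  refine dvd_pow ?_ hm
  exact (CharP.cast_eq_zero_iff F p _).1 (Nat.cast_card_eq_zero F)

/-- A squarefree polynomial whose irreducible factors all have degree at most `d / 2` divides the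
product of any two entries of a decomposition of degree `d`, so its degree is less than `2 * d`. -/
theorem IsVID.natDegree_lt {F : Type*} [Field F] {d : ℕ} {f : F[X]} {l : List F[X]}
    (hl : IsVID d f l) {P : F[X]} (hP : Squarefree P)
    (hdeg : ∀ p, Irreducible p → p ∣ P → 2 * p.natDegree ≤ d) : P.natDegree < 2 * d := by
  classical
  obtain ⟨h2, hne, -, htop, hdvd⟩ := hl
  let i : Fin l.length := ⟨0, by omega⟩
  let j : Fin l.length := ⟨1, by omega⟩
  have hij : i ≠ j := by simp [i, j]
  obtain ⟨hi0, hid⟩ := hne _ (List.get_mem l i)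
  obtain ⟨hj0, hjd⟩ := hne _ (List.get_mem l j)
  have hPdvd : P ∣ l.get i * l.get j := by
    refine hP.dvd_of_forall_irreducible fun p hp hpP ↦ ?_
    have hass := associated_normalize p
    have hu := hdvd (normalize p) (monic_normalize hp.ne_zero) (hass.irreducible hp) (by
        rw [← natDegree_eq_of_degree_eq (degree_eq_degree_of_associated hass)]
        exact hdeg p hp hpP)
    by_contra hcon
    refine hij (hu.unique (fun hi ↦ hcon ?_) fun hj ↦ hcon ?_)
    · exact (hass.dvd.trans hi).mul_right _
    · exact (hass.dvd.trans hj).mul_left _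
  have hle := natDegree_le_of_dvd hPdvd (mul_ne_zero hi0 hj0)
  rw [natDegree_mul hi0 hj0] at hle
  have hnot : ¬((l.get i).natDegree = d ∧ (l.get j).natDegree = d) := fun h ↦
    hij (htop.unique h.1 h.2)
  omega

theorem exists_irreducible_natDegree_eq_three {F : Type*} [Field F] [Fintype F]
    (hF : Fintype.card F = 2) : ∃ p : F[X], Irreducible p ∧ p.natDegree = 3 := by
  have hdeg : (X ^ 3 + X + 1 : F[X]).natDegree = 3 := by compute_degree!
  refine ⟨X ^ 3 + X + 1, irreducible_of_degree_le_three_of_not_isRoot (by simp [hdeg]) ?_, hdeg⟩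
  intro x hx
  have h2 : (2 : F) = 0 := by simpa [hF] using Nat.cast_card_eq_zero F
  have hx2 : x ^ 2 = x := by simpa [hF] using FiniteField.pow_card x
  simp only [IsRoot, eval_add, eval_pow, eval_X, eval_one] at hx
  exact one_ne_zero (by linear_combination hx - (x + 1) * hx2 - x * h2 : (1 : F) = 0)

theorem IsVID.card_pow_lt {F : Type*} [Field F] [Fintype F] {d m : ℕ} {f : F[X]}
    {l : List F[X]} (hl : IsVID d f l) (hm : m ≠ 0) (hmd : 2 * m ≤ d) :
    Fintype.card F ^ m < 2 * d := by
  rw [← FiniteField.X_pow_card_pow_sub_X_natDegree_eq F hm Fintype.one_lt_card]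
  refine hl.natDegree_lt (squarefree_X_pow_card_pow_sub_X F hm) fun p hp hpP ↦ ?_
  rw [← Nat.card_eq_fintype_card] at hpP
  have := Nat.le_of_dvd hm.bot_lt (hp.natDegree_dvd_of_dvd_X_pow_card_pow_sub_X hpP)
  omega

theorem not_isVID_nine {F : Type*} [Field F] [Fintype F] (hF : Fintype.card F = 2) {f : F[X]}
    {l : List F[X]} : ¬ IsVID 9 f l := by
  intro hl
  obtain ⟨p, hp, hp3⟩ := exists_irreducible_natDegree_eq_three hF
  set Q : F[X] := X ^ Fintype.card F ^ 4 - X with hQ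
  have hfac : ∀ r, Irreducible r → r ∣ Q → r.natDegree ∣ 4 := by
    intro r hr hrQ
    rw [hQ, ← Nat.card_eq_fintype_card] at hrQ
    exact hr.natDegree_dvd_of_dvd_X_pow_card_pow_sub_X hrQ
  have hQsq : Squarefree Q := squarefree_X_pow_card_pow_sub_X F (by norm_num)
  have hcop : IsRelPrime p Q := hp.isRelPrime_iff_not_dvd.2 fun h ↦ by
    have := hfac p hp h
    rw [hp3] at this
    omega
  have hlt := hl.natDegree_lt (squarefree_mul_iff.2 ⟨hcop, hp.squarefree, hQsq⟩) fun r hr hrd ↦ by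
    rcases hr.prime.dvd_or_dvd hrd with h | h
    · have := natDegree_le_of_dvd h hp.ne_zero
      omega
    · have := Nat.le_of_dvd (by norm_num) (hfac r hr h)
      omega
  rw [natDegree_mul hp.ne_zero hQsq.ne_zero, hp3, hQ,
    FiniteField.X_pow_card_pow_sub_X_natDegree_eq F (by norm_num) Fintype.one_lt_card, hF] at hlt
  norm_num at hlt

theorem two_mul_le_two_pow_half {d : ℕ} (hd : 10 ≤ d) : 2 * d ≤ 2 ^ (d / 2) := by
  have h : ∀ m, 5 ≤ m → 4 * m + 2 ≤ 2 ^ m := by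
    intro m hm
    induction m, hm using Nat.le_induction with
    | base => norm_num
    | succ m hm ih => rw [pow_succ]; omega
  have := h (d / 2) (by omega)
  omega

theorem no_VID_outside_list {F : Type*} [Field F] [Fintype F] (q d : ℕ)
    (hq : Fintype.card F = q) (hd : 2 ≤ d)
    (hnot : (q, d) ∉ ([(2,2), (3,2), (2,3), (3,3), (4,3), (5,3), (2,4), (2,5), (2,6), (2,7),
      (3,5)] : List (ℕ × ℕ)))
    (f : F[X]) (hf : Irreducible f) (hdeg : f.natDegree = d) :
    ¬ ∃ l : List F[X], IsVID d f l := by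
  rintro ⟨l, hl⟩
  have hq2 : 2 ≤ q := hq ▸ Fintype.one_lt_card
  have hlt := hl.card_pow_lt (m := d / 2) (by omega) (by omega)
  rw [hq] at hlt
  have hd10 : d < 10 := by
    by_contra! h
    have := two_mul_le_two_pow_half h
    have := Nat.pow_le_pow_left hq2 (d / 2)
    omega
  have hq6 : q < 6 := by
    by_contra! h
    have := Nat.pow_le_pow_left h (d / 2)
    interval_cases d <;> norm_num at * <;> omega
  have hcase : q = 2 ∧ d = 9 := by
    clear hl hdeg hq
    interval_cases d <;> interval_cases q <;> simp_all
  obtain ⟨rfl, rfl⟩ := hcase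
  exact not_isVID_nine hq hl
end

section
/- Let F be a finite field with q elements, let d ≥ 2, and suppose some polynomial f over F admits a visibly irreducible decomposition f₁ + ⋯ + f_r of degree d with r summands. Let N be the number of elements ξ of an algebraic closure of F satisfying ξ^(q^n) = ξ for some n with 1 ≤ n ≤ ⌊d/2⌋ (i.e., N = |⋃_{n=1}^{⌊d/2⌋} 𝔽_{q^n}|). Then d·r ≥ (r − 1)·(1 + N). -/
open Polynomial

/-- An element of an extension of a finite field with `q` elements that satisfies
`ξ ^ q ^ n = ξ` is a root of an irreducible polynomial of degree at most `n`. -/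
theorem natDegree_minpoly_le_of_pow_card_pow_eq {F K : Type*} [Field F] [Fintype F] [Field K]
    [Algebra F K] {n : ℕ} (hn : 1 ≤ n) {ξ : K} (h : ξ ^ Fintype.card F ^ n = ξ) :
    IsIntegral F ξ ∧ (minpoly F ξ).natDegree ≤ n := by
  have hroot : aeval ξ (X ^ Nat.card F ^ n - X : F[X]) = 0 := by
    simp [Nat.card_eq_fintype_card, h]
  have hξ_integral : IsIntegral F ξ :=
    IsAlgebraic.isIntegral ⟨_, FiniteField.X_pow_card_pow_sub_X_ne_zero F (by lia)
      Finite.one_lt_card, hroot⟩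
  exact ⟨hξ_integral, Nat.le_of_dvd hn
    ((minpoly.irreducible hξ_integral).natDegree_dvd_of_dvd_X_pow_card_pow_sub_X (minpoly.dvd F ξ hroot))⟩

/-- The distinct roots of a nonzero polynomial in a finite set number at most its degree. -/
theorem card_filter_aeval_eq_zero_le_natDegree {F K : Type*} [Field F] [Field K] [Algebra F K]
    [DecidableEq K] {g : F[X]} (hg : g ≠ 0) (S : Finset K) :
    (S.filter fun ξ => aeval ξ g = 0).card ≤ g.natDegree := by
  rw [← natDegree_map (p := g) (algebraMap F K)]
  refine card_le_degree_of_subset_roots fun ξ hξ => ?_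
  rw [mem_roots (map_ne_zero hg), IsRoot.def, eval_map_algebraMap]
  exact (Finset.mem_filter.mp hξ).2

/-- If exactly one entry of a finite family bounded by `d` attains `d`, the sum of the family,
increased by one for each remaining entry, is at most `d` times the size of the family. -/
theorem sum_add_card_sub_one_le_of_existsUnique {ι : Type*} [Fintype ι] (a : ι → ℕ) (d : ℕ)
    (ha : ∀ i, a i ≤ d) (h : ∃! i, a i = d) :
    ∑ i, a i + (Fintype.card ι - 1) ≤ d * Fintype.card ι := by
  classical
  obtain ⟨i, -, hi⟩ := h
  have hlt : ∀ j ∈ Finset.univ.erase i, a j + 1 ≤ d := fun j hj =>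
    lt_of_le_of_ne (ha j) fun hj' => Finset.ne_of_mem_erase hj (hi j hj')
  have hsum := Finset.sum_le_sum hlt
  have hcard : (Finset.univ.erase i).card = Fintype.card ι - 1 := by
    simp [Finset.card_erase_of_mem]
  have hpos : 0 < Fintype.card ι := Fintype.card_pos_iff.mpr ⟨i⟩
  rw [Finset.sum_add_distrib, Finset.sum_const, Finset.sum_const, hcard, smul_eq_mul, smul_eq_mul,
    mul_one, mul_comm] at hsum
  rw [← Finset.add_sum_erase _ _ (Finset.mem_univ i)]
  calc _ = a i + (∑ j ∈ Finset.univ.erase i, a j + (Fintype.card ι - 1)) := add_assoc _ _ _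
    _ ≤ d + d * (Fintype.card ι - 1) := add_le_add (ha i) hsum
    _ = d * (Fintype.card ι - 1 + 1) := by ring
    _ = d * Fintype.card ι := by rw [Nat.sub_add_cancel hpos]

/-- In a visibly irreducible decomposition of degree `d`, all but one of the entries vanish at
any element whose minimal polynomial has degree at most `d / 2`. -/
theorem IsVID.card_filter_aeval_eq_zero {F K : Type*} [Field F] [Field K] [Algebra F K]
    [DecidableEq K] {d : ℕ} {f : F[X]} {l : List F[X]} (hl : IsVID d f l) {ξ : K}
    (hξ_integral : IsIntegral F ξ) (hdeg : (minpoly F ξ).natDegree ≤ d / 2) :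
    (Finset.univ.filter fun i : Fin l.length => aeval ξ (l.get i) = 0).card = l.length - 1 := by
  obtain ⟨i, hi, huniq⟩ := hl.2.2.2.2 _ (minpoly.monic hξ_integral) (minpoly.irreducible hξ_integral) (by lia)
  have heq : (Finset.univ.filter fun j : Fin l.length => aeval ξ (l.get j) = 0) =
      Finset.univ.erase i := by
    ext j
    simp only [Finset.mem_filter, Finset.mem_univ, true_and, Finset.mem_erase, and_true]
    rw [← minpoly.dvd_iff]
    exact ⟨fun hj hji => hi (hji ▸ hj), fun hji => by_contra fun hj => hji (huniq j hj)⟩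
  rw [heq, Finset.card_erase_of_mem (Finset.mem_univ i), Finset.card_univ, Fintype.card_fin]

theorem VID_degree_bound {F : Type*} [Field F] [Fintype F] (q d r : ℕ)
    (hq : Fintype.card F = q) (hd : 2 ≤ d)
    (f : F[X]) (l : List F[X]) (hl : IsVID d f l) (hr : r = l.length)
    (N : ℕ)
    (hN : N = Set.ncard {ξ : AlgebraicClosure F | ∃ n : ℕ, 1 ≤ n ∧ n ≤ d / 2 ∧ ξ ^ q ^ n = ξ}) :
    (r - 1) * (1 + N) ≤ d * r := by
  classical
  subst hq hr
  obtain ⟨S, hS, hcard⟩ : ∃ S : Finset (AlgebraicClosure F),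
      (∀ ξ ∈ S, ∃ n : ℕ, 1 ≤ n ∧ n ≤ d / 2 ∧ ξ ^ Fintype.card F ^ n = ξ) ∧ S.card = N := by
    obtain hfin | hinf := Set.finite_or_infinite
      {ξ : AlgebraicClosure F | ∃ n : ℕ, 1 ≤ n ∧ n ≤ d / 2 ∧ ξ ^ Fintype.card F ^ n = ξ}
    · exact ⟨hfin.toFinset, fun ξ hξ => hfin.mem_toFinset.mp hξ,
        (hN.trans (Set.ncard_eq_toFinset_card _ hfin)).symm⟩
    · exact ⟨∅, by simp, by rw [hN, hinf.ncard, Finset.card_empty]⟩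
  have hcount : N * (l.length - 1) ≤ ∑ i : Fin l.length, (l.get i).natDegree := by
    calc N * (l.length - 1)
        = ∑ ξ ∈ S, (Finset.univ.filter fun i : Fin l.length => aeval ξ (l.get i) = 0).card := by
          rw [← hcard, ← smul_eq_mul, ← Finset.sum_const]
          refine Finset.sum_congr rfl fun ξ hξ => ?_
          obtain ⟨n, hn, hnd, h⟩ := hS ξ hξ
          obtain ⟨hξ_integral, hdeg⟩ := natDegree_minpoly_le_of_pow_card_pow_eq hn h
          exact (hl.card_filter_aeval_eq_zero hξ_integral (hdeg.trans hnd)).symm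
      _ = ∑ i : Fin l.length, (S.filter fun ξ => aeval ξ (l.get i) = 0).card :=
          Finset.sum_card_bipartiteAbove_eq_sum_card_bipartiteBelow
            fun (ξ : AlgebraicClosure F) (i : Fin l.length) => aeval ξ (l.get i) = 0
      _ ≤ _ := Finset.sum_le_sum fun i _ =>
          card_filter_aeval_eq_zero_le_natDegree (hl.2.1 _ (l.get_mem i)).1 S
  have hsum := sum_add_card_sub_one_le_of_existsUnique (fun i : Fin l.length =>
    (l.get i).natDegree) d (fun i => (hl.2.1 _ (l.get_mem i)).2) hl.2.2.2.1
  rw [Fintype.card_fin] at hsum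
  calc (l.length - 1) * (1 + N) = N * (l.length - 1) + (l.length - 1) := by ring
    _ ≤ _ := Nat.add_le_add_right hcount _
    _ ≤ _ := hsum
end

section
/- Let F be a finite field, let K be a field extension of F of degree 3, and let ξ, ξ′ ∈ K be elements not lying in the image of F in K. Then there exist a, b, c, d ∈ F with a·d − b·c ≠ 0 such that c·ξ + d ≠ 0 and ξ′ = (a·ξ + b)/(c·ξ + d) (coefficients identified with their images in K); moreover, if (a′, b′, c′, d′) is another such quadruple with a′·d′ − b′·c′ ≠ 0 and ξ′ = (a′·ξ + b′)/(c′·ξ + d′), then there is a nonzero λ ∈ F with (a′, b′, c′, d′) = (λa, λb, λc, λd). In other words, PGL₂(F) acts simply transitively on K ∖ F by linear fractional transformations. -/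
open Polynomial in
/-- An element of a cubic extension lying outside the base field satisfies no nontrivial
quadratic relation. -/
theorem coeffs_eq_zero_of_quadratic_relation {F K : Type*} [Field F] [Field K] [Algebra F K]
    (hrank : Module.finrank F K = 3) {x : K} (hx : x ∉ Set.range (algebraMap F K)) {p q r : F}
    (h : algebraMap F K p * x ^ 2 + algebraMap F K q * x + algebraMap F K r = 0) :
    p = 0 ∧ q = 0 ∧ r = 0 := by
  have : FiniteDimensional F K := Module.finite_of_finrank_pos (by omega)
  have hint : IsIntegral F x := Algebra.IsIntegral.isIntegral x
  have hdvd : (minpoly F x).natDegree ∣ 3 := hrank ▸ minpoly.degree_dvd hint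
  have hne : (minpoly F x).natDegree ≠ 1 := fun h1 => hx (minpoly.natDegree_eq_one_iff.mp h1)
  have hdeg : (minpoly F x).natDegree = 3 :=
    ((Nat.dvd_prime Nat.prime_three).mp hdvd).resolve_left hne
  have hzero : C p * X ^ 2 + C q * X + C r = 0 := by
    refine eq_zero_of_dvd_of_natDegree_lt (minpoly.dvd F x (by simpa using h)) ?_
    rw [hdeg]
    exact Nat.lt_succ_of_le natDegree_quadratic_le
  refine ⟨?_, ?_, ?_⟩
  · simpa [coeff_X, coeff_C] using congrArg (fun f => coeff f 2) hzero
  · simpa [coeff_X, coeff_C] using congrArg (fun f => coeff f 1) hzero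
  · simpa [coeff_X, coeff_C] using congrArg (fun f => coeff f 0) hzero

/-- An element outside the base field satisfies no nontrivial linear relation. -/
theorem coeffs_eq_zero_of_linear_relation {F K : Type*} [Field F] [Field K] [Algebra F K]
    {x : K} (hx : x ∉ Set.range (algebraMap F K)) {p q : F}
    (h : algebraMap F K p * x + algebraMap F K q = 0) : p = 0 ∧ q = 0 := by
  have hp : p = 0 := by
    by_contra hp
    have hp' : algebraMap F K p ≠ 0 := by simpa using hp
    refine hx ⟨-q / p, ?_⟩
    rw [map_div₀, map_neg, div_eq_iff hp']
    linear_combination -h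
  subst hp
  simpa using h

/-- Two `2 × 2` matrices of nonzero determinant are proportional as soon as the products of
linear forms `(a X + b) (c' X + d')` and `(a' X + b') (c X + d)` agree. -/
theorem exists_scalar_of_cross_mul_eq {F : Type*} [Field F] {a b c d a' b' c' d' : F}
    (hdet : a * d - b * c ≠ 0) (hdet' : a' * d' - b' * c' ≠ 0)
    (h2 : a * c' = a' * c) (h1 : a * d' + b * c' = a' * d + b' * c) (h0 : b * d' = b' * d) :
    ∃ lam : F, lam ≠ 0 ∧ a' = lam * a ∧ b' = lam * b ∧ c' = lam * c ∧ d' = lam * d := by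
  have ha : a' = (d * a' - b * c') / (a * d - b * c) * a := by
    rw [div_mul_eq_mul_div, eq_div_iff hdet]
    linear_combination b * h2
  have hb : b' = (d * a' - b * c') / (a * d - b * c) * b := by
    rw [div_mul_eq_mul_div, eq_div_iff hdet]
    linear_combination b * h1 - a * h0
  have hc : c' = (d * a' - b * c') / (a * d - b * c) * c := by
    rw [div_mul_eq_mul_div, eq_div_iff hdet]
    linear_combination d * h2
  have hd : d' = (d * a' - b * c') / (a * d - b * c) * d := by
    rw [div_mul_eq_mul_div, eq_div_iff hdet]
    linear_combination d * h1 - c * h0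
  refine ⟨_, fun h => hdet' ?_, ha, hb, hc, hd⟩
  rw [h, zero_mul] at ha hb
  simp [ha, hb]

theorem pgl2_simply_transitive {F K : Type*} [Field F] [Fintype F] [Field K]
    [Algebra F K] (hrank : Module.finrank F K = 3)
    (ξ ξ' : K) (hξ : ξ ∉ Set.range (algebraMap F K)) (hξ' : ξ' ∉ Set.range (algebraMap F K)) :
    ∃ a b c d : F, a * d - b * c ≠ 0 ∧
      algebraMap F K c * ξ + algebraMap F K d ≠ 0 ∧
      ξ' = (algebraMap F K a * ξ + algebraMap F K b) /
        (algebraMap F K c * ξ + algebraMap F K d) ∧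
      ∀ a' b' c' d' : F, a' * d' - b' * c' ≠ 0 →
        ξ' = (algebraMap F K a' * ξ + algebraMap F K b') /
          (algebraMap F K c' * ξ + algebraMap F K d') →
        ∃ lam : F, lam ≠ 0 ∧ a' = lam * a ∧ b' = lam * b ∧ c' = lam * c ∧ d' = lam * d := by
  have : FiniteDimensional F K := Module.finite_of_finrank_pos (by omega)
  have hden {c d : F} (h : ¬(c = 0 ∧ d = 0)) : algebraMap F K c * ξ + algebraMap F K d ≠ 0 :=
    mt (coeffs_eq_zero_of_linear_relation hξ) h
  have hdep : ¬LinearIndependent F ![ξ, 1, -(ξ' * ξ), -ξ'] := fun h => by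
    simpa [hrank] using h.fintype_card_le_finrank
  obtain ⟨g, hg, i, hi⟩ := Fintype.not_linearIndependent_iff.mp hdep
  obtain ⟨a, b, c, d, rfl⟩ : ∃ a b c d, g = ![a, b, c, d] :=
    ⟨g 0, g 1, g 2, g 3, by ext j; fin_cases j <;> rfl⟩
  have hrel : algebraMap F K a * ξ + algebraMap F K b
      = ξ' * (algebraMap F K c * ξ + algebraMap F K d) := by
    simp only [Fin.sum_univ_four, Algebra.smul_def, Matrix.cons_val] at hg
    linear_combination hg
  have hcd : ¬(c = 0 ∧ d = 0) := by
    rintro ⟨rfl, rfl⟩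
    obtain ⟨rfl, rfl⟩ := coeffs_eq_zero_of_linear_relation hξ (by simpa using hrel)
    fin_cases i <;> simp at hi
  have hdet : a * d - b * c ≠ 0 := by
    intro h
    have hK : algebraMap F K a * algebraMap F K d = algebraMap F K b * algebraMap F K c := by
      simpa using congrArg (algebraMap F K) (sub_eq_zero.mp h)
    have hlin_c : algebraMap F K c * ξ' + algebraMap F K (-a) = 0 := by
      refine (mul_eq_zero.mp ?_).resolve_right (hden hcd)
      rw [map_neg]
      linear_combination -algebraMap F K c * hrel - hK
    have hlin_d : algebraMap F K d * ξ' + algebraMap F K (-b) = 0 := by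
      refine (mul_eq_zero.mp ?_).resolve_right (hden hcd)
      rw [map_neg]
      linear_combination -algebraMap F K d * hrel + ξ * hK
    exact hcd ⟨(coeffs_eq_zero_of_linear_relation hξ' hlin_c).1,
      (coeffs_eq_zero_of_linear_relation hξ' hlin_d).1⟩
  refine ⟨a, b, c, d, hdet, hden hcd, (eq_div_iff (hden hcd)).mpr hrel.symm, ?_⟩
  intro a' b' c' d' hdet' heq
  have hcd' : ¬(c' = 0 ∧ d' = 0) := by
    rintro ⟨rfl, rfl⟩
    simp at hdet'
  rw [eq_div_iff (hden hcd')] at heq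
  obtain ⟨h2, h1, h0⟩ := coeffs_eq_zero_of_quadratic_relation hrank hξ
    (p := a * c' - a' * c) (q := a * d' + b * c' - (a' * d + b' * c)) (r := b * d' - b' * d) (by
      simp only [map_sub, map_add, map_mul]
      linear_combination (algebraMap F K c' * ξ + algebraMap F K d') * hrel
        + (algebraMap F K c * ξ + algebraMap F K d) * heq)
  exact exists_scalar_of_cross_mul_eq hdet hdet' (sub_eq_zero.mp h2) (sub_eq_zero.mp h1)
    (sub_eq_zero.mp h0)
end

section
/- Let F be a finite field and let f and g be monic irreducible polynomials of degree 2 over F. Then there exist α, β, γ, δ ∈ F with α·δ − β·γ ≠ 0 and a nonzero constant c ∈ F such that c·g(x) = Σ_{i=0}^{2} (coeff of x^i in f)·(α·x + γ)^i·(β·x + δ)^{2−i}. In other words, PGL₂(F) acts transitively on the irreducible quadratic forms over F up to scaling. -/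
open Polynomial

/-- A monic irreducible quadratic over a finite field has a root in the extension generated by
a root of any other one, and this root is an affine function of the generator. -/
theorem exists_dvd_comp_linear {F : Type*} [Field F] [Fintype F]
    (f g : F[X]) (hfi : Irreducible f) (hfd : f.natDegree = 2)
    (hg : g.Monic) (hgi : Irreducible g) (hgd : g.natDegree = 2) :
    ∃ a b : F, a ≠ 0 ∧ g ∣ f.comp (C a * X + C b) := by
  have : Fact (Irreducible f) := ⟨hfi⟩
  have : Fact (Irreducible g) := ⟨hgi⟩
  have hf0 : f ≠ 0 := hfi.ne_zero
  have hg0 : g ≠ 0 := hgi.ne_zero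
  have : Module.Finite F (AdjoinRoot g) := (AdjoinRoot.powerBasis hg0).finite
  have : Finite (AdjoinRoot g) := Module.finite_of_finite F
  obtain ⟨φ⟩ : Nonempty (AdjoinRoot f →ₐ[F] AdjoinRoot g) := by
    refine FiniteField.nonempty_algHom_of_finrank_dvd ?_
    rw [(AdjoinRoot.powerBasis hf0).finrank, (AdjoinRoot.powerBasis hg0).finrank,
      AdjoinRoot.powerBasis_dim, AdjoinRoot.powerBasis_dim, hfd, hgd]
  obtain ⟨p, hp⟩ := AdjoinRoot.mk_surjective (g := g) (φ (AdjoinRoot.root f))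
  have hr : AdjoinRoot.mk g (p %ₘ g) = φ (AdjoinRoot.root f) := by
    rw [← hp, AdjoinRoot.mk_eq_mk]
    exact ⟨-(p /ₘ g), by linear_combination modByMonic_add_div p g⟩
  have hdeg : (p %ₘ g).natDegree ≤ 1 := by
    have := natDegree_modByMonic_lt p hg (by rintro rfl; simp at hgd)
    omega
  obtain ⟨a, b, hab⟩ := exists_eq_X_add_C_of_natDegree_le_one hdeg
  have hdvd : g ∣ f.comp (C a * X + C b) := by
    rw [← AdjoinRoot.mk_eq_zero, ← AdjoinRoot.aeval_eq, aeval_comp, AdjoinRoot.aeval_eq,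
      ← hab, hr, aeval_algHom_apply, AdjoinRoot.aeval_eq, AdjoinRoot.mk_self, map_zero]
  refine ⟨a, b, ?_, hdvd⟩
  rintro rfl
  have hroot : f.eval b = 0 := by
    by_contra hne
    rw [C_0, zero_mul, zero_add, comp_C] at hdvd
    have := natDegree_le_of_dvd hdvd (C_ne_zero.mpr hne)
    rw [natDegree_C, hgd] at this
    omega
  have := degree_eq_one_of_irreducible_of_root hfi hroot
  rw [degree_eq_natDegree hf0, hfd] at this
  norm_num at this

theorem pgl2_transitive_on_irreducible_quadratics {F : Type*} [Field F] [Fintype F]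
    (f g : F[X]) (hf : f.Monic) (hfi : Irreducible f) (hfd : f.natDegree = 2)
    (hg : g.Monic) (hgi : Irreducible g) (hgd : g.natDegree = 2) :
    ∃ α β γ δ c : F, α * δ - β * γ ≠ 0 ∧ c ≠ 0 ∧
      C c * g = ∑ i ∈ Finset.range 3,
        C (f.coeff i) * (C α * X + C γ) ^ i * (C β * X + C δ) ^ (2 - i) := by
  obtain ⟨a, b, ha, h, hh⟩ := exists_dvd_comp_linear f g hfi hfd hg hgi hgd
  have hd : (f.comp (C a * X + C b)).natDegree = 2 := by
    rw [natDegree_comp, natDegree_linear ha, hfd]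
  have h0 : h ≠ 0 := by
    rintro rfl
    rw [hh, mul_zero, natDegree_zero] at hd
    omega
  have hhd : h.natDegree = 0 := by
    rw [hh, natDegree_mul hgi.ne_zero h0, hgd] at hd
    omega
  obtain ⟨c, rfl⟩ := natDegree_eq_zero.mp hhd
  refine ⟨a, 0, b, 1, c, by simpa using ha, by simpa using h0, ?_⟩
  rw [mul_comm, ← hh, comp, eval₂_eq_sum_range, hfd]
  simp
end

section
/- Let F be a finite field and let f and g be monic irreducible polynomials of degree 3 over F. Then there exist α, β, γ, δ ∈ F with α·δ − β·γ ≠ 0 and a nonzero constant c ∈ F such that c·g(x) = Σ_{i=0}^{3} (coeff of x^i in f)·(α·x + γ)^i·(β·x + δ)^{3−i}. In other words, PGL₂(F) acts transitively on the irreducible cubic forms over F up to scaling. -/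
open Polynomial

/-- In a cubic extension, any two elements satisfy a nontrivial bilinear relation over the base. -/
theorem exists_bilinear_relation_of_finrank_eq_three {F K : Type*} [Field F] [Field K]
    [Algebra F K] (h : Module.finrank F K = 3) (a b : K) :
    ∃ α β γ δ : F, (α ≠ 0 ∨ β ≠ 0 ∨ γ ≠ 0 ∨ δ ≠ 0) ∧
      algebraMap F K α * b + algebraMap F K γ =
        a * (algebraMap F K β * b + algebraMap F K δ) := by
  have : FiniteDimensional F K := Module.finite_of_finrank_pos (by omega)
  have hdep : ¬ LinearIndependent F ![b, 1, a * b, a] := fun hli => by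
    have := hli.fintype_card_le_finrank
    simp [h] at this
  obtain ⟨c, hc, i, hi⟩ := Fintype.not_linearIndependent_iff.mp hdep
  simp only [Fin.sum_univ_four, Algebra.smul_def] at hc
  simp at hc
  refine ⟨c 0, -c 2, c 1, -c 3, ?_, ?_⟩
  · fin_cases i <;> simp_all
  · simp only [map_neg]
    linear_combination hc

/-- Evaluating a transformed polynomial at `b` gives `(β b + δ) ^ d` times the value of the
original polynomial at the image of `b`. -/
theorem aeval_sum_mul_pow_eq {F K : Type*} [Field F] [Field K] [Algebra F K] {f : F[X]} {d : ℕ}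
    (hd : f.natDegree = d) (α β γ δ : F) (a b : K)
    (h : algebraMap F K α * b + algebraMap F K γ =
      a * (algebraMap F K β * b + algebraMap F K δ)) :
    aeval b (∑ i ∈ Finset.range (d + 1),
        C (f.coeff i) * (C α * X + C γ) ^ i * (C β * X + C δ) ^ (d - i)) =
      (algebraMap F K β * b + algebraMap F K δ) ^ d * aeval a f := by
  rw [aeval_eq_sum_range (p := f), hd, map_sum, Finset.mul_sum]
  refine Finset.sum_congr rfl fun i hi => ?_
  have hid : i + (d - i) = d := by have := Finset.mem_range.mp hi; omega
  simp only [map_mul, map_pow, map_add, aeval_C, aeval_X, h, Algebra.smul_def]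
  rw [mul_pow, ← congrArg ((algebraMap F K β * b + algebraMap F K δ) ^ ·) hid, pow_add]
  ring

/-- A linear fractional transform of an irreducible polynomial of degree other than one is
nonzero. -/
theorem sum_mul_pow_ne_zero {F : Type*} [Field F] {f : F[X]} (hf : Irreducible f) {d : ℕ}
    (hd : f.natDegree = d) (hd1 : f.natDegree ≠ 1) (α γ : F) {β δ : F} (h : β ≠ 0 ∨ δ ≠ 0) :
    ∑ i ∈ Finset.range (d + 1),
      C (f.coeff i) * (C α * X + C γ) ^ i * (C β * X + C δ) ^ (d - i) ≠ 0 := by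
  obtain ⟨x, hx⟩ : ∃ x : F, β * x + δ ≠ 0 := by
    by_contra! h'
    have h0 := h' 0
    have h1 := h' 1
    simp_all
  intro hzero
  have hev := aeval_sum_mul_pow_eq hd α β γ δ ((α * x + γ) / (β * x + δ)) x
    (by simp [div_mul_cancel₀ _ hx])
  rw [hzero, map_zero] at hev
  exact mul_ne_zero (pow_ne_zero d hx)
    (hf.aeval_ne_zero_of_natDegree_ne_one hd1 ⟨_, rfl⟩) hev.symm

theorem pgl2_transitive_on_irreducible_cubics {F : Type*} [Field F] [Fintype F]
    (f g : F[X]) (hf : f.Monic) (hfi : Irreducible f) (hfd : f.natDegree = 3)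
    (hg : g.Monic) (hgi : Irreducible g) (hgd : g.natDegree = 3) :
    ∃ α β γ δ c : F, α * δ - β * γ ≠ 0 ∧ c ≠ 0 ∧
      C c * g = ∑ i ∈ Finset.range 4,
        C (f.coeff i) * (C α * X + C γ) ^ i * (C β * X + C δ) ^ (3 - i) := by
  have : Fact (Irreducible f) := ⟨hfi⟩
  have : Fact (Irreducible g) := ⟨hgi⟩
  have hKf : Module.finrank F (AdjoinRoot f) = 3 := by
    rw [(AdjoinRoot.powerBasis hfi.ne_zero).finrank, AdjoinRoot.powerBasis_dim, hfd]
  have hKg : Module.finrank F (AdjoinRoot g) = 3 := by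
    rw [(AdjoinRoot.powerBasis hgi.ne_zero).finrank, AdjoinRoot.powerBasis_dim, hgd]
  have : FiniteDimensional F (AdjoinRoot f) := Module.finite_of_finrank_pos (by omega)
  have : FiniteDimensional F (AdjoinRoot g) := Module.finite_of_finrank_pos (by omega)
  have : Finite (AdjoinRoot f) := Module.finite_of_finite F
  have : Finite (AdjoinRoot g) := Module.finite_of_finite F
  obtain ⟨φ⟩ : Nonempty (AdjoinRoot f →ₐ[F] AdjoinRoot g) :=
    FiniteField.nonempty_algHom_of_finrank_dvd (by rw [hKf, hKg])
  obtain ⟨a, ha⟩ : ∃ a : AdjoinRoot g, aeval a f = 0 :=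
    ⟨φ (AdjoinRoot.root f), by simp [aeval_algHom_apply]⟩
  have hgb : aeval (AdjoinRoot.root g) g = 0 := by simp
  set b := AdjoinRoot.root g with hb
  have hf1 : f.natDegree ≠ 1 := by omega
  have hg1 : g.natDegree ≠ 1 := by omega
  have ha_ne (x : F) : a ≠ algebraMap F _ x := by
    rintro rfl
    exact hfi.aeval_ne_zero_of_natDegree_ne_one hf1 ⟨x, rfl⟩ ha
  have hb_ne (x : F) : b ≠ algebraMap F _ x := by
    intro h
    exact hgi.aeval_ne_zero_of_natDegree_ne_one hg1 ⟨x, h.symm⟩ hgb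
  have hlin {s t : F} (h : algebraMap F (AdjoinRoot g) s * b + algebraMap F _ t = 0) :
      s = 0 ∧ t = 0 := by
    have hs : s = 0 := by
      by_contra hs
      apply hb_ne (-t / s)
      have : algebraMap F (AdjoinRoot g) s ≠ 0 := by simpa using hs
      rw [map_div₀, map_neg]
      field_simp
      linear_combination h
    subst hs
    simpa using h
  obtain ⟨α, β, γ, δ, hne, hrel⟩ := exists_bilinear_relation_of_finrank_eq_three hKg a b
  have hβδ : β ≠ 0 ∨ δ ≠ 0 := by
    by_contra! h
    obtain ⟨rfl, rfl⟩ := h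
    obtain ⟨rfl, rfl⟩ := hlin (by simpa using hrel)
    simp at hne
  have hden : algebraMap F (AdjoinRoot g) β * b + algebraMap F _ δ ≠ 0 := fun h => by
    have := hlin h
    tauto
  have hmul {s t : F} (h : a * algebraMap F _ s = algebraMap F _ t) : s = 0 := by
    by_contra hs
    apply ha_ne (t / s)
    rw [map_div₀, eq_div_iff (by simpa using hs), h]
  have hdet : α * δ - β * γ ≠ 0 := by
    intro h
    have h' := congrArg (algebraMap F (AdjoinRoot g)) h
    simp only [map_sub, map_mul, map_zero] at h'
    have hβ : β = 0 := hmul (t := α) <| mul_right_cancel₀ hden <| by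
      linear_combination (-algebraMap F (AdjoinRoot g) β) * hrel - h'
    have hδ : δ = 0 := hmul (t := γ) <| mul_right_cancel₀ hden <| by
      linear_combination (-algebraMap F (AdjoinRoot g) δ) * hrel + b * h'
    tauto
  set P := ∑ i ∈ Finset.range 4,
    C (f.coeff i) * (C α * X + C γ) ^ i * (C β * X + C δ) ^ (3 - i) with hP
  have hPb : aeval b P = 0 := by
    rw [hP, aeval_sum_mul_pow_eq hfd α β γ δ a b hrel, ha, mul_zero]
  have hP0 : P ≠ 0 := sum_mul_pow_ne_zero hfi hfd hf1 α γ hβδ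
  have hPd : P.natDegree ≤ 3 := by
    simp only [hP, Finset.sum_range_succ, Finset.sum_range_zero]
    compute_degree
  obtain ⟨q, hq⟩ : g ∣ P := by rwa [← AdjoinRoot.mk_eq_zero, ← AdjoinRoot.aeval_eq]
  have hq0 : q ≠ 0 := by rintro rfl; exact hP0 (by simpa using hq)
  have hqd : q.natDegree = 0 := by
    rw [hq, natDegree_mul hgi.ne_zero hq0] at hPd
    omega
  rw [natDegree_eq_zero] at hqd
  obtain ⟨c, rfl⟩ := hqd
  exact ⟨α, β, γ, δ, c, hdet, by simpa using hq0, by rw [← hP, hq, mul_comm]⟩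
end

section
/- Let d = 4 or d = 5, and let f and g be monic irreducible polynomials of degree d over 𝔽₂ = ZMod 2. Then there exist α, β, γ, δ ∈ 𝔽₂ with α·δ − β·γ ≠ 0 such that g(x) = Σ_{i=0}^{d} (coeff of x^i in f)·(α·x + γ)^i·(β·x + δ)^{d−i}. In other words, PGL₂(𝔽₂) acts transitively on the irreducible quartic forms over 𝔽₂ and on the irreducible quintic forms over 𝔽₂. -/
open Polynomial

theorem Irreducible.eval_eq_one_of_zmod_two {f : (ZMod 2)[X]} (hf : Irreducible f)
    (hd : f.natDegree ≠ 1) (x : ZMod 2) : f.eval x = 1 := by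
  have h : f.eval x ≠ 0 := fun h =>
    hd (natDegree_eq_of_degree_eq_some (degree_eq_one_of_irreducible_of_root hf h))
  generalize f.eval x = y at h ⊢
  revert y
  decide

theorem Irreducible.not_X_sq_add_X_add_one_dvd {f : (ZMod 2)[X]} (hf : Irreducible f)
    (hd : f.natDegree ≠ 2) : ¬ (X ^ 2 + X + 1 : (ZMod 2)[X]) ∣ f := by
  have h2 : (X ^ 2 + X + 1 : (ZMod 2)[X]).natDegree = 2 := by compute_degree!
  intro h
  rcases hf.dvd_iff.1 h with hu | ha
  · rw [natDegree_eq_zero_of_isUnit hu] at h2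
    omega
  · exact hd ((natDegree_eq_of_degree_eq (degree_eq_degree_of_associated ha)).trans h2)

theorem exists_coeffs_of_irreducible_quartic {f : (ZMod 2)[X]} (hf : f.Monic)
    (hfi : Irreducible f) (hfd : f.natDegree = 4) :
    ∃ a b c : ZMod 2, f = X ^ 4 + C a * X ^ 3 + C b * X ^ 2 + C c * X + 1 ∧
      a + b + c = 1 ∧ ¬ (b = c + 1 ∧ a = c) := by
  have h0 := hfi.eval_eq_one_of_zmod_two (by omega) 0
  have h1 := hfi.eval_eq_one_of_zmod_two (by omega) 1
  have hdvd := hfi.not_X_sq_add_X_add_one_dvd (by omega)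
  have h4 : f.coeff 4 = 1 := hfd ▸ hf.coeff_natDegree
  have hsum := f.as_sum_range_C_mul_X_pow
  rw [hfd] at hsum
  simp only [Finset.sum_range_succ, Finset.sum_range_zero, h4] at hsum
  generalize f.coeff 0 = k, f.coeff 1 = c, f.coeff 2 = b, f.coeff 3 = a at hsum
  subst hsum
  have hk : k = 1 := by simpa using h0
  subst hk
  refine ⟨a, b, c, by simp only [map_one]; ring, ?_, ?_⟩
  · simp only [eval_add, eval_mul, eval_C, eval_pow, eval_X, eval_zero] at h1
    linear_combination h1 - CharTwo.two_eq_zero (R := ZMod 2)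
  · rintro ⟨rfl, rfl⟩
    refine hdvd ⟨X ^ 2 + (C a + 1) * X + 1, ?_⟩
    have h2 : (2 : (ZMod 2)[X]) = 0 := CharTwo.two_eq_zero
    simp only [map_one, map_add]
    grind

theorem exists_coeffs_of_irreducible_quintic {f : (ZMod 2)[X]} (hf : f.Monic)
    (hfi : Irreducible f) (hfd : f.natDegree = 5) :
    ∃ a b c e : ZMod 2, f = X ^ 5 + C a * X ^ 4 + C b * X ^ 3 + C c * X ^ 2 + C e * X + 1 ∧
      a + b + c + e = 1 ∧ ¬ (b = c ∧ e = 1 + a + c) := by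
  have h0 := hfi.eval_eq_one_of_zmod_two (by omega) 0
  have h1 := hfi.eval_eq_one_of_zmod_two (by omega) 1
  have hdvd := hfi.not_X_sq_add_X_add_one_dvd (by omega)
  have h5 : f.coeff 5 = 1 := hfd ▸ hf.coeff_natDegree
  have hsum := f.as_sum_range_C_mul_X_pow
  rw [hfd] at hsum
  simp only [Finset.sum_range_succ, Finset.sum_range_zero, h5] at hsum
  generalize f.coeff 0 = k, f.coeff 1 = e, f.coeff 2 = c, f.coeff 3 = b, f.coeff 4 = a at hsum
  subst hsum
  have hk : k = 1 := by simpa using h0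
  subst hk
  refine ⟨a, b, c, e, by simp only [map_one]; ring, ?_, ?_⟩
  · simp only [eval_add, eval_mul, eval_C, eval_pow, eval_X, eval_zero] at h1
    linear_combination h1 - CharTwo.two_eq_zero (R := ZMod 2)
  · rintro ⟨rfl, rfl⟩
    refine hdvd ⟨X ^ 3 + (C a + 1) * X ^ 2 + (C b + C a) * X + 1, ?_⟩
    have h2 : (2 : (ZMod 2)[X]) = 0 := CharTwo.two_eq_zero
    simp only [map_one, map_add]
    grind

set_option synthInstance.maxSize 1000 in
theorem irreducible_quartic_coeffs_orbit : ∀ a b c a' b' c' : ZMod 2,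
    a + b + c = 1 → ¬ (b = c + 1 ∧ a = c) → a' + b' + c' = 1 → ¬ (b' = c' + 1 ∧ a' = c') →
    (a' = a ∧ b' = b ∧ c' = c) ∨ (a' = c ∧ b' = b ∧ c' = a) ∨
    (a' = a ∧ b' = a + b ∧ c' = a + c) ∨ (a' = a + c ∧ b' = a + b ∧ c' = a) ∨
    (a' = c ∧ b' = c + b ∧ c' = a + c) ∨ (a' = a + c ∧ b' = c + b ∧ c' = c) := by
  decide

set_option synthInstance.maxSize 1000 in
theorem irreducible_quintic_coeffs_orbit : ∀ a b c e : ZMod 2,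
    a + b + c + e = 1 → ¬ (b = c ∧ e = 1 + a + c) → ∀ a' b' c' e' : ZMod 2,
    a' + b' + c' + e' = 1 → ¬ (b' = c' ∧ e' = 1 + a' + c') →
    (a' = a ∧ b' = b ∧ c' = c ∧ e' = e) ∨ (a' = e ∧ b' = c ∧ c' = b ∧ e' = a) ∨
    (a' = 1 + a ∧ b' = b ∧ c' = b + c ∧ e' = 1 + b + e) ∨
    (a' = 1 + b + e ∧ b' = b + c ∧ c' = b ∧ e' = 1 + a) ∨
    (a' = 1 + e ∧ b' = c ∧ c' = b + c ∧ e' = 1 + c + a) ∨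
    (a' = 1 + c + a ∧ b' = b + c ∧ c' = c ∧ e' = 1 + e) := by
  decide

theorem pgl2_transitive_on_irreducible_quartics_quintics_F2 (d : ℕ) (hd : d = 4 ∨ d = 5)
    (f g : (ZMod 2)[X]) (hf : f.Monic) (hfi : Irreducible f) (hfd : f.natDegree = d)
    (hg : g.Monic) (hgi : Irreducible g) (hgd : g.natDegree = d) :
    ∃ α β γ δ : ZMod 2, α * δ - β * γ ≠ 0 ∧
      g = ∑ i ∈ Finset.range (d + 1),
        C (f.coeff i) * (C α * X + C γ) ^ i * (C β * X + C δ) ^ (d - i) := by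
  have h2 : (2 : (ZMod 2)[X]) = 0 := CharTwo.two_eq_zero
  rcases hd with rfl | rfl
  · obtain ⟨a, b, c, rfl, hs, hn⟩ := exists_coeffs_of_irreducible_quartic hf hfi hfd
    obtain ⟨a', b', c', rfl, hs', hn'⟩ := exists_coeffs_of_irreducible_quartic hg hgi hgd
    have hC : C a + C b + C c = (1 : (ZMod 2)[X]) := by simp only [← map_add, hs, map_one]
    simp only [Finset.sum_range_succ, Finset.sum_range_zero, coeff_add, coeff_C_mul, coeff_X_pow,
      coeff_X, coeff_one]
    rcases irreducible_quartic_coeffs_orbit a b c a' b' c' hs hn hs' hn' with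
      ⟨rfl, rfl, rfl⟩ | ⟨rfl, rfl, rfl⟩ | ⟨rfl, rfl, rfl⟩ | ⟨rfl, rfl, rfl⟩ | ⟨rfl, rfl, rfl⟩ |
      ⟨rfl, rfl, rfl⟩
    on_goal 1 => refine ⟨1, 0, 0, 1, by decide, ?_⟩
    on_goal 2 => refine ⟨0, 1, 1, 0, by decide, ?_⟩
    on_goal 3 => refine ⟨1, 0, 1, 1, by decide, ?_⟩
    on_goal 4 => refine ⟨1, 1, 1, 0, by decide, ?_⟩
    on_goal 5 => refine ⟨0, 1, 1, 1, by decide, ?_⟩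
    on_goal 6 => refine ⟨1, 1, 0, 1, by decide, ?_⟩
    all_goals simp <;> grind
  · obtain ⟨a, b, c, e, rfl, hs, hn⟩ := exists_coeffs_of_irreducible_quintic hf hfi hfd
    obtain ⟨a', b', c', e', rfl, hs', hn'⟩ := exists_coeffs_of_irreducible_quintic hg hgi hgd
    have hC : C a + C b + C c + C e = (1 : (ZMod 2)[X]) := by
      simp only [← map_add, hs, map_one]
    simp only [Finset.sum_range_succ, Finset.sum_range_zero, coeff_add, coeff_C_mul, coeff_X_pow,
      coeff_X, coeff_one]
    rcases irreducible_quintic_coeffs_orbit a b c e hs hn a' b' c' e' hs' hn' with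
      ⟨rfl, rfl, rfl, rfl⟩ | ⟨rfl, rfl, rfl, rfl⟩ | ⟨rfl, rfl, rfl, rfl⟩ | ⟨rfl, rfl, rfl, rfl⟩ |
      ⟨rfl, rfl, rfl, rfl⟩ | ⟨rfl, rfl, rfl, rfl⟩
    on_goal 1 => refine ⟨1, 0, 0, 1, by decide, ?_⟩
    on_goal 2 => refine ⟨0, 1, 1, 0, by decide, ?_⟩
    on_goal 3 => refine ⟨1, 0, 1, 1, by decide, ?_⟩
    on_goal 4 => refine ⟨1, 1, 1, 0, by decide, ?_⟩
    on_goal 5 => refine ⟨0, 1, 1, 1, by decide, ?_⟩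
    on_goal 6 => refine ⟨1, 1, 0, 1, by decide, ?_⟩
    all_goals simp <;> grind
end

section
/- Let F be a finite field with q elements, let d ≥ 3, and let f be a monic irreducible polynomial of degree d over F. Then the number of quadruples (α, β, γ, δ) ∈ F⁴ with α·δ − β·γ ≠ 0 for which there exists a nonzero c ∈ F with Σ_{i=0}^{d} (coeff of x^i in f)·(α·x + γ)^i·(β·x + δ)^{d−i} = c·f(x) divides d·(q − 1). (Equivalently, the stabilizer of f in PGL₂(F) has order dividing d.) -/
open Polynomial

/-- The invertible quadruples `(α, β, γ, δ)` whose Möbius transformation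
`x ↦ (α x + γ) / (β x + δ)` sends `θ` to `r`. -/
def moebiusQuadruples (F : Type*) {K : Type*} [Field F] [Field K] [Algebra F K] (θ r : K) :
    Set (F × F × F × F) :=
  {m | m.1 * m.2.2.2 - m.2.1 * m.2.2.1 ≠ 0 ∧
    algebraMap F K m.1 * θ + algebraMap F K m.2.2.1 =
      r * (algebraMap F K m.2.1 * θ + algebraMap F K m.2.2.2)}

section

variable {F K : Type*} [Field F] [Field K] [Algebra F K]

/-- The binary form associated with `f`, of degree `d`, evaluated at
`(α X + γ, β X + δ)`. -/
noncomputable def moebiusTransform (d : ℕ) (f : F[X]) (m : F × F × F × F) : F[X] :=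
  ∑ i ∈ Finset.range (d + 1),
    C (f.coeff i) * (C m.1 * X + C m.2.2.1) ^ i * (C m.2.1 * X + C m.2.2.2) ^ (d - i)

lemma aeval_moebiusTransform {d : ℕ} {f : F[X]} (hfd : f.natDegree = d) (m : F × F × F × F)
    (x : K) (r : K)
    (h : algebraMap F K m.1 * x + algebraMap F K m.2.2.1 =
      r * (algebraMap F K m.2.1 * x + algebraMap F K m.2.2.2)) :
    aeval x (moebiusTransform d f m) =
      (algebraMap F K m.2.1 * x + algebraMap F K m.2.2.2) ^ d * aeval r f := by
  rw [aeval_eq_sum_range (p := f), hfd, Finset.mul_sum, moebiusTransform, map_sum]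
  refine Finset.sum_congr rfl fun i hi => ?_
  have hid : d = i + (d - i) := by have := Finset.mem_range.1 hi; omega
  simp only [map_mul, map_pow, map_add, aeval_C, aeval_X, h, Algebra.smul_def, mul_pow]
  conv_rhs => rw [hid, pow_add]
  ring

lemma natDegree_moebiusTransform_le (d : ℕ) (f : F[X]) (m : F × F × F × F) :
    (moebiusTransform d f m).natDegree ≤ d := by
  refine natDegree_sum_le_of_forall_le _ _ fun i hi => ?_
  have hid : 0 + i * 1 + (d - i) * 1 = d := by have := Finset.mem_range.1 hi; omega
  refine le_trans ?_ hid.le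
  refine natDegree_mul_le_of_le (natDegree_mul_le_of_le (natDegree_C _).le ?_) ?_
  all_goals exact natDegree_pow_le_of_le _ natDegree_linear_le

lemma moebiusTransform_ne_zero {d : ℕ} {f : F[X]} (hfi : Irreducible f) (hfd : f.natDegree = d)
    (hd : 2 ≤ d) {m : F × F × F × F} (hm : m.1 * m.2.2.2 - m.2.1 * m.2.2.1 ≠ 0) :
    moebiusTransform d f m ≠ 0 := by
  intro h0
  obtain ⟨x, hx⟩ : ∃ x : F, m.2.1 * x + m.2.2.2 ≠ 0 := by
    by_cases h : m.2.2.2 = 0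
    · exact ⟨1, fun h1 => hm (by simp_all)⟩
    · exact ⟨0, by simpa using h⟩
  have key := aeval_moebiusTransform (K := F) hfd m x
    ((m.1 * x + m.2.2.1) / (m.2.1 * x + m.2.2.2)) (div_mul_cancel₀ _ hx).symm
  rw [h0, map_zero] at key
  have hr := (mul_eq_zero.1 key.symm).resolve_left (pow_ne_zero _ hx)
  have := degree_eq_one_of_irreducible_of_root hfi (by simpa [IsRoot, aeval_def] using hr)
  have : f.natDegree = 1 := natDegree_eq_of_degree_eq_some this
  omega

lemma eq_zero_of_quadratic {θ : K} (hθ : 3 ≤ (minpoly F θ).natDegree) {a b c : F}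
    (h : algebraMap F K a * θ ^ 2 + algebraMap F K b * θ + algebraMap F K c = 0) :
    a = 0 ∧ b = 0 ∧ c = 0 := by
  have h0 : C a * X ^ 2 + C b * X + C c = 0 := by
    refine eq_zero_of_dvd_of_natDegree_lt (p := minpoly F θ) (minpoly.dvd F θ (by simpa using h)) ?_
    exact natDegree_quadratic_le.trans_lt (by omega)
  refine ⟨?_, ?_, ?_⟩
  · simpa using congrArg (coeff · 2) h0
  · simpa using congrArg (coeff · 1) h0
  · simpa using congrArg (coeff · 0) h0

lemma linear_ne_zero {θ : K} (hθ : 3 ≤ (minpoly F θ).natDegree) {m : F × F × F × F}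
    (hm : m.1 * m.2.2.2 - m.2.1 * m.2.2.1 ≠ 0) :
    algebraMap F K m.2.1 * θ + algebraMap F K m.2.2.2 ≠ 0 := by
  intro h
  obtain ⟨-, h1, h2⟩ := eq_zero_of_quadratic hθ (a := 0) (by simpa using h)
  exact hm (by simp [h1, h2])

lemma exists_smul_eq_of_mem_moebiusQuadruples {θ r : K} (hθ : 3 ≤ (minpoly F θ).natDegree)
    {m n : F × F × F × F} (hm : m ∈ moebiusQuadruples F θ r) (hn : n ∈ moebiusQuadruples F θ r) :
    ∃ c : Fˣ, c • m = n := by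
  obtain ⟨a, b, c, e⟩ := m
  obtain ⟨a', b', c', e'⟩ := n
  obtain ⟨hm, hm'⟩ := hm
  obtain ⟨hn, hn'⟩ := hn
  dsimp only at hm hm' hn hn'
  obtain ⟨h1, h2, h3⟩ := eq_zero_of_quadratic hθ (a := a * b' - a' * b)
    (b := a * e' + c * b' - a' * e - c' * b) (c := c * e' - c' * e) (by
      simp only [map_sub, map_add, map_mul]
      linear_combination (algebraMap F K b' * θ + algebraMap F K e') * hm' -
        (algebraMap F K b * θ + algebraMap F K e) * hn')
  set D := a * e - b * c with hD
  -- The scaling factor is read off from `adj m * n`, which is a scalar matrix.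
  set t := a' * e - b' * c with ht
  have ea : t * a = D * a' := by simp only [hD, ht]; linear_combination (-c) * h1
  have eb : t * b = D * b' := by simp only [hD, ht]; linear_combination (-e) * h1
  have ec : t * c = D * c' := by
    simp only [hD, ht]; linear_combination (-c) * h2 + a * h3
  have ee : t * e = D * e' := by
    simp only [hD, ht]; linear_combination (-e) * h2 + b * h3
  have ht0 : t ≠ 0 := by
    intro h
    simp only [h, zero_mul, zero_eq_mul, hm, false_or] at ea eb
    exact hn (by simp [ea, eb])
  refine ⟨Units.mk0 (t / D) (div_ne_zero ht0 hm), ?_⟩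
  simp only [Prod.smul_mk, Units.smul_mk0, smul_eq_mul, Prod.mk.injEq]
  refine ⟨?_, ?_, ?_, ?_⟩ <;> field_simp <;> assumption

lemma smul_mem_moebiusQuadruples {θ r : K} {m : F × F × F × F}
    (hm : m ∈ moebiusQuadruples F θ r) (c : Fˣ) : c • m ∈ moebiusQuadruples F θ r := by
  obtain ⟨h, hrel⟩ := hm
  refine ⟨?_, ?_⟩
  · have : (c : F) * c * (m.1 * m.2.2.2 - m.2.1 * m.2.2.1) ≠ 0 := by simp [h]
    convert this using 1
    simp only [Prod.smul_fst, Prod.smul_snd, Units.smul_def, smul_eq_mul]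
    ring
  · simp only [Prod.smul_fst, Prod.smul_snd, Units.smul_def, smul_eq_mul, map_mul]
    linear_combination algebraMap F K c * hrel

/-- The automorphisms whose value at `θ` is a Möbius transform of `θ` over `F`. -/
def moebiusAut (F : Type*) {K : Type*} [Field F] [Field K] [Algebra F K] (θ : K) :
    Subgroup (K ≃ₐ[F] K) where
  carrier := {σ | (moebiusQuadruples F θ (σ θ)).Nonempty}
  one_mem' := ⟨(1, 0, 0, 1), by simp [moebiusQuadruples]⟩
  mul_mem' := by
    rintro σ τ ⟨⟨α, β, γ, δ⟩, h, h'⟩ ⟨⟨a, b, c, e⟩, k, k'⟩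
    dsimp only at h h' k k'
    refine ⟨(a * α + c * β, b * α + e * β, a * γ + c * δ, b * γ + e * δ), ?_, ?_⟩
    · convert mul_ne_zero h k using 1
      ring
    · have k2 := congrArg σ k'
      simp only [map_add, map_mul, AlgEquiv.commutes] at k2
      simp only [map_add, map_mul, AlgEquiv.mul_apply]
      linear_combination (algebraMap F K β * θ + algebraMap F K δ) * k2 +
        (algebraMap F K a - σ (τ θ) * algebraMap F K b) * h'
  inv_mem' := by
    rintro σ ⟨⟨α, β, γ, δ⟩, h, h'⟩
    dsimp only at h h'
    refine ⟨(δ, -β, -γ, α), ?_, ?_⟩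
    · convert h using 1
      ring
    · have h2 := congrArg (σ⁻¹ : K ≃ₐ[F] K) h'
      have hs : σ⁻¹ (σ θ) = θ := σ.symm_apply_apply θ
      simp only [map_add, map_mul, AlgEquiv.commutes, hs] at h2
      simp only [map_neg]
      linear_combination -h2

/-- Distinct automorphisms have disjoint sets of quadruples, and each nonempty such set is a
torsor under scaling by `Fˣ`. -/
lemma ncard_iUnion_moebiusQuadruples {θ : K} (hθ : 3 ≤ (minpoly F θ).natDegree)
    (hinj : Function.Injective fun σ : K ≃ₐ[F] K => σ θ) :
    (⋃ σ : K ≃ₐ[F] K, moebiusQuadruples F θ (σ θ)).ncard =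
      Nat.card (moebiusAut F θ) * Nat.card Fˣ := by
  choose M hM using fun σ : moebiusAut F θ =>
    (show (moebiusQuadruples F θ (σ.1 θ)).Nonempty from σ.2)
  rw [← Nat.card_prod, ← Nat.card_coe_set_eq]
  refine (Nat.card_congr (Equiv.ofBijective (fun p => ⟨p.2 • M p.1,
    Set.mem_iUnion.2 ⟨p.1.1, smul_mem_moebiusQuadruples (hM p.1) p.2⟩⟩) ⟨?_, ?_⟩)).symm
  · rintro ⟨σ, c⟩ ⟨τ, e⟩ h
    have h : c • M σ = e • M τ := congrArg Subtype.val h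
    have h1 := smul_mem_moebiusQuadruples (hM σ) c
    have h2 := smul_mem_moebiusQuadruples (hM τ) e
    rw [← h] at h2
    obtain rfl : σ = τ := Subtype.ext <| hinj <|
      mul_right_cancel₀ (linear_ne_zero hθ h1.1) (h1.2.symm.trans h2.2)
    obtain ⟨⟨a, b, g, k⟩, hm⟩ : {m // m = M σ} := ⟨_, rfl⟩
    have hdet := (hM σ).1
    simp only [← hm, Prod.smul_mk, Prod.mk.injEq, Units.smul_def, smul_eq_mul] at h hdet
    obtain ⟨ha, hb, -, -⟩ := h
    refine Prod.ext rfl (Units.ext ?_)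
    by_cases h0 : a = 0
    · have : b ≠ 0 := by rintro rfl; simp [h0] at hdet
      exact mul_right_cancel₀ this hb
    · exact mul_right_cancel₀ h0 ha
  · rintro ⟨m, hm⟩
    obtain ⟨σ, hσ⟩ := Set.mem_iUnion.1 hm
    obtain ⟨c, hc⟩ := exists_smul_eq_of_mem_moebiusQuadruples hθ (hM ⟨σ, m, hσ⟩) hσ
    exact ⟨(⟨σ, m, hσ⟩, c), Subtype.ext hc⟩

/-- A quadruple stabilizes the minimal polynomial of `θ` up to scaling if and only if it maps `θ`
to a conjugate. -/
lemma moebiusTransform_minpoly_eq_iff [Normal F K] {θ : K} (hθ : 3 ≤ (minpoly F θ).natDegree)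
    {m : F × F × F × F} (hm : m.1 * m.2.2.2 - m.2.1 * m.2.2.1 ≠ 0) :
    (∃ c : F, c ≠ 0 ∧ moebiusTransform (minpoly F θ).natDegree (minpoly F θ) m =
      C c * minpoly F θ) ↔ ∃ σ : K ≃ₐ[F] K, m ∈ moebiusQuadruples F θ (σ θ) := by
  have hint : IsIntegral F θ := Normal.isIntegral inferInstance θ
  constructor
  · rintro ⟨c, -, h⟩
    have hw := linear_ne_zero hθ hm
    have hr := (div_mul_cancel₀ (algebraMap F K m.1 * θ + algebraMap F K m.2.2.1) hw).symm
    have key := aeval_moebiusTransform (K := K) (f := minpoly F θ) rfl m θ _ hr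
    rw [h, map_mul, minpoly.aeval, mul_zero] at key
    obtain ⟨σ, hσ⟩ := minpoly.exists_algEquiv_of_root' hint.isAlgebraic
      ((mul_eq_zero.1 key.symm).resolve_left (pow_ne_zero _ hw))
    exact ⟨σ, hm, by rw [hσ]; exact hr⟩
  · rintro ⟨σ, -, h⟩
    have hσ : aeval (σ θ) (minpoly F θ) = 0 := by
      rw [aeval_algHom_apply, minpoly.aeval, map_zero]
    have key := aeval_moebiusTransform (K := K) (f := minpoly F θ) rfl m θ _ h
    rw [hσ, mul_zero] at key
    obtain ⟨g, hg⟩ := minpoly.dvd F θ key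
    have hP := moebiusTransform_ne_zero (minpoly.irreducible hint) rfl (by omega) hm
    have hdeg := natDegree_moebiusTransform_le (minpoly F θ).natDegree (minpoly F θ) m
    have hg0 : g ≠ 0 := by rintro rfl; exact hP (by rw [hg, mul_zero])
    rw [hg, natDegree_mul (minpoly.ne_zero hint) hg0] at hdeg
    have hgC := eq_C_of_natDegree_eq_zero (p := g) (by omega)
    refine ⟨g.coeff 0, fun h0 => hg0 (by rw [hgC, h0, C_0]), ?_⟩
    rw [hg, mul_comm, ← hgC]

end

theorem stabilizer_order_divides {F : Type*} [Field F] [Fintype F] (q d : ℕ)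
    (hq : Fintype.card F = q) (hd : 3 ≤ d)
    (f : F[X]) (hf : f.Monic) (hfi : Irreducible f) (hfd : f.natDegree = d) :
    Set.ncard {m : F × F × F × F |
      m.1 * m.2.2.2 - m.2.1 * m.2.2.1 ≠ 0 ∧
      ∃ c : F, c ≠ 0 ∧
        (∑ i ∈ Finset.range (d + 1),
          C (f.coeff i) * (C m.1 * X + C m.2.2.1) ^ i * (C m.2.1 * X + C m.2.2.2) ^ (d - i))
          = C c * f} ∣ d * (q - 1) := by
  classical
  have : Fact (Irreducible f) := ⟨hfi⟩
  let pb := AdjoinRoot.powerBasis hfi.ne_zero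
  let θ := AdjoinRoot.root f
  have hpb : pb.gen = θ := AdjoinRoot.powerBasis_gen hfi.ne_zero
  have : FiniteDimensional F (AdjoinRoot f) := pb.finite
  have : Finite (AdjoinRoot f) := Module.finite_of_finite F
  have hmin : minpoly F θ = f :=
    (minpoly.eq_of_irreducible_of_monic hfi (by simp [θ, AdjoinRoot.aeval_eq]) hf).symm
  have hθ : 3 ≤ (minpoly F θ).natDegree := by rw [hmin]; omega
  have hinj : Function.Injective fun σ : AdjoinRoot f ≃ₐ[F] AdjoinRoot f => σ θ :=
    fun σ τ h => AlgEquiv.coe_toAlgHom_injective (pb.algHom_ext (by simpa [hpb] using h))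
  have hcard : Nat.card (AdjoinRoot f ≃ₐ[F] AdjoinRoot f) = d := by
    rw [IsGalois.card_aut_eq_finrank, pb.finrank, AdjoinRoot.powerBasis_dim, hfd]
  have hset := ncard_iUnion_moebiusQuadruples hθ hinj
  rw [Nat.card_units, Nat.card_eq_fintype_card (α := F), hq] at hset
  have hdvd := hset.dvd.trans (Nat.mul_dvd_mul_right (Subgroup.card_subgroup_dvd_card _) _)
  rw [hcard] at hdvd
  refine (congrArg Set.ncard (Set.ext fun m => ?_)).dvd.trans hdvd
  simp only [Set.mem_iUnion, Set.mem_ofPred_eq]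
  constructor
  · rintro ⟨hm, h⟩
    exact (moebiusTransform_minpoly_eq_iff hθ hm).1 (by rw [hmin, hfd]; exact h)
  · rintro ⟨σ, h⟩
    have := (moebiusTransform_minpoly_eq_iff hθ h.1).2 ⟨σ, h⟩
    rw [hmin, hfd] at this
    exact ⟨h.1, this⟩
end

section
/- Every monic irreducible cubic polynomial f over 𝔽₅ = ZMod 5 can be written in the form f(x) = (x − a)(x − b)(x − c) + λ·(x − d)(x − e), where {a, b, c, d, e} = {0, 1, 2, 3, 4} is all of 𝔽₅ and λ ∈ 𝔽₅ is nonzero; moreover this representation is unique up to permuting a, b, c among themselves and permuting d, e among themselves. -/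
open Polynomial

/-- Five distinct elements `a, b, c, d, e` exhaust `𝔽₅`, so `{a, b, c}` is the complement of `{d, e}` and the
elementary symmetric functions of `a, b, c` are determined by those of `d, e`. -/
lemma nodup_five_zmod : ∀ a b c d e : ZMod 5, ([a, b, c, d, e] : List (ZMod 5)).Nodup →
    d ≠ e ∧ (∀ x, (x = a ∨ x = b ∨ x = c) ↔ ¬(x = d ∨ x = e)) ∧
      -(a + b + c) = d + e ∧ a * b + a * c + b * c = (d + e) ^ 2 - d * e ∧
      -(a * b * c) = (d + e) ^ 3 - 2 * (d + e) * (d * e) := by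
  decide +kernel

lemma exists_nodup_five_zmod : ∀ d e : ZMod 5, d ≠ e →
    ∃ a b c : ZMod 5, ([a, b, c, d, e] : List (ZMod 5)).Nodup := by
  decide +kernel

lemma exists_pair_of_cubic_ne_zero : ∀ p q r : ZMod 5,
    (∀ x, x ^ 3 + p * x ^ 2 + q * x + r ≠ 0) →
    ∃ d e : ZMod 5, d ≠ e ∧ ∃ lam : ZMod 5, lam ≠ 0 ∧ p = d + e + lam ∧
      q = (d + e) ^ 2 - d * e - lam * (d + e) ∧
      r = (d + e) ^ 3 - 2 * (d + e) * (d * e) + lam * (d * e) := by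
  decide +kernel

lemma pair_unique_of_cubic : ∀ d e : ZMod 5, d ≠ e → ∀ lam : ZMod 5, lam ≠ 0 →
    ∀ d' e' : ZMod 5, d' ≠ e' → ∀ lam' : ZMod 5, d + e + lam = d' + e' + lam' → lam' ≠ 0 →
    (d + e) ^ 2 - d * e - lam * (d + e) = (d' + e') ^ 2 - d' * e' - lam' * (d' + e') →
    (d + e) ^ 3 - 2 * (d + e) * (d * e) + lam * (d * e) =
      (d' + e') ^ 3 - 2 * (d' + e') * (d' * e') + lam' * (d' * e') →
    (d' = d ∧ e' = e ∨ d' = e ∧ e' = d) ∧ lam' = lam := by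
  decide +kernel

lemma toPoly_eq_of_nodup {a b c d e : ZMod 5} (lam : ZMod 5)
    (h : ([a, b, c, d, e] : List (ZMod 5)).Nodup) :
    (X - C a) * (X - C b) * (X - C c) + C lam * ((X - C d) * (X - C e)) =
      (Cubic.mk 1 (d + e + lam) ((d + e) ^ 2 - d * e - lam * (d + e))
        ((d + e) ^ 3 - 2 * (d + e) * (d * e) + lam * (d * e))).toPoly := by
  obtain ⟨-, -, h₁, h₂, h₃⟩ := nodup_five_zmod a b c d e h
  rw [← h₂, ← h₃, show d + e + lam = -(a + b + c) + lam by rw [h₁]]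
  simp only [Cubic.toPoly, map_add, map_sub, map_neg, map_mul, map_one]
  ring

lemma Polynomial.Monic.eq_toPoly_of_natDegree_eq_three {R : Type*} [Semiring R] {f : R[X]}
    (hf : f.Monic) (hfd : f.natDegree = 3) :
    f = (Cubic.mk 1 (f.coeff 2) (f.coeff 1) (f.coeff 0)).toPoly := by
  have h₃ : f.coeff 3 = 1 := hfd ▸ hf.coeff_natDegree
  conv_lhs => rw [f.as_sum_range_C_mul_X_pow, hfd]
  simp only [Finset.sum_range_succ, Finset.sum_range_zero, Cubic.toPoly, h₃, pow_zero, pow_one,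
    mul_one, zero_add]
  abel

theorem lenstra_cubics_over_F5 (f : (ZMod 5)[X]) (hf : f.Monic) (hfi : Irreducible f)
    (hfd : f.natDegree = 3) :
    ∃ a b c d e lam : ZMod 5,
      ([a, b, c, d, e] : List (ZMod 5)).Nodup ∧
      ({a, b, c, d, e} : Set (ZMod 5)) = Set.univ ∧
      lam ≠ 0 ∧
      f = (X - C a) * (X - C b) * (X - C c) + C lam * ((X - C d) * (X - C e)) ∧
      ∀ a' b' c' d' e' lam' : ZMod 5,
        ([a', b', c', d', e'] : List (ZMod 5)).Nodup →
        ({a', b', c', d', e'} : Set (ZMod 5)) = Set.univ →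
        lam' ≠ 0 →
        f = (X - C a') * (X - C b') * (X - C c') + C lam' * ((X - C d') * (X - C e')) →
        ({a', b', c'} : Set (ZMod 5)) = {a, b, c} ∧ ({d', e'} : Set (ZMod 5)) = {d, e} ∧
          lam' = lam := by
  have : Fact (Nat.Prime 5) := ⟨Nat.prime_five⟩
  have hfc := hf.eq_toPoly_of_natDegree_eq_three hfd
  have hroot : ∀ x, x ^ 3 + f.coeff 2 * x ^ 2 + f.coeff 1 * x + f.coeff 0 ≠ 0 := by
    intro x hx
    refine hfi.not_isRoot_of_natDegree_ne_one (by omega) (x := x) ?_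
    rw [IsRoot, hfc]
    simpa [Cubic.toPoly] using hx
  obtain ⟨d, e, hde, lam, hlam, h₂, h₁, h₀⟩ := exists_pair_of_cubic_ne_zero _ _ _ hroot
  obtain ⟨a, b, c, hnd⟩ := exists_nodup_five_zmod d e hde
  have hcompl := (nodup_five_zmod a b c d e hnd).2.1
  rw [h₂, h₁, h₀] at hfc
  refine ⟨a, b, c, d, e, lam, hnd, ?_, hlam, hfc.trans (toPoly_eq_of_nodup lam hnd).symm, ?_⟩
  · ext x
    have := hcompl x
    simp only [Set.mem_insert_iff, Set.mem_singleton_iff, Set.mem_univ, iff_true]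
    tauto
  · intro a' b' c' d' e' lam' hnd' _ hlam' hf'
    obtain ⟨hde', hcompl', -⟩ := nodup_five_zmod a' b' c' d' e' hnd'
    have hcub := hfc.symm.trans (hf'.trans (toPoly_eq_of_nodup lam' hnd'))
    obtain ⟨-, k₂, k₁, k₀⟩ := Cubic.mk.inj (Cubic.toPoly_injective _ _ |>.mp hcub)
    obtain ⟨hpair, hl⟩ := pair_unique_of_cubic d e hde lam hlam d' e' hde' lam' k₂ hlam' k₁ k₀
    have hset : ({d', e'} : Set (ZMod 5)) = {d, e} := by
      obtain ⟨rfl, rfl⟩ | ⟨rfl, rfl⟩ := hpair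
      · rfl
      · exact Set.pair_comm _ _
    refine ⟨?_, hset, hl⟩
    ext x
    have hx : (x = d' ∨ x = e') ↔ (x = d ∨ x = e) := by simpa using Set.ext_iff.mp hset x
    simp only [Set.mem_insert_iff, Set.mem_singleton_iff]
    rw [hcompl, hcompl', hx]
end

section
/- Let C ∈ 𝔽₃[X, Y] (i.e., MvPolynomial (Fin 2) (ZMod 3)) be an irreducible homogeneous form of degree 3. Then there exists a unique irreducible homogeneous form C′ ∈ 𝔽₃[X, Y] of degree 3 such that C + C′ = M³ for some homogeneous linear form M, and C − C′ = M₁·M₂·M₃ for three homogeneous linear forms M₁, M₂, M₃ that are pairwise non-proportional (no one is a scalar multiple of another). -/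
open MvPolynomial

namespace BinaryForm

variable {R : Type*} [CommRing R]

/-- The binary linear form `mX + nY`. -/
noncomputable def linear (m n : R) : MvPolynomial (Fin 2) R :=
  C m * X 0 + C n * X 1

/-- The binary quadratic form `aX² + bXY + cY²`. -/
noncomputable def quadratic (a b c : R) : MvPolynomial (Fin 2) R :=
  C a * X 0 ^ 2 + C b * X 0 * X 1 + C c * X 1 ^ 2

/-- The binary cubic form `aX³ + bX²Y + cXY² + dY³`. -/
noncomputable def cubic (a b c d : R) : MvPolynomial (Fin 2) R :=
  C a * X 0 ^ 3 + C b * X 0 ^ 2 * X 1 + C c * X 0 * X 1 ^ 2 + C d * X 1 ^ 3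

theorem eq_sum_antidiagonal_of_isHomogeneous {p : MvPolynomial (Fin 2) R} {n : ℕ}
    (hp : p.IsHomogeneous n) :
    p = ∑ ij ∈ Finset.HasAntidiagonal.antidiagonal n,
      C (p.coeff (Finsupp.single 0 ij.1 + Finsupp.single 1 ij.2)) * X 0 ^ ij.1 * X 1 ^ ij.2 := by
  classical
  have hmon (i j : ℕ) (r : R) : C r * X (0 : Fin 2) ^ i * X 1 ^ j =
      monomial (Finsupp.single 0 i + Finsupp.single 1 j) r := by
    rw [C_mul_X_pow_eq_monomial, X_pow_eq_monomial, monomial_mul, mul_one]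
  ext d
  have hd : Finsupp.single 0 (d 0) + Finsupp.single 1 (d 1) = d := by
    ext i; fin_cases i <;> simp
  simp only [hmon, coeff_sum, coeff_monomial]
  have hiff (ij : ℕ × ℕ) :
      Finsupp.single (0 : Fin 2) ij.1 + Finsupp.single 1 ij.2 = d ↔ ij = (d 0, d 1) := by
    constructor
    · rintro rfl; simp
    · rintro rfl; exact hd
  simp only [hiff, Finset.sum_ite_eq', hd]
  split_ifs with h
  · rfl
  · refine hp.coeff_eq_zero fun hdeg => h ?_
    simpa [Finsupp.degree_eq_sum] using hdeg

theorem exists_eq_linear {p : MvPolynomial (Fin 2) R} (hp : p.IsHomogeneous 1) :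
    ∃ m n, p = linear m n := by
  refine ⟨p.coeff (Finsupp.single 0 1 + Finsupp.single 1 0),
    p.coeff (Finsupp.single 0 0 + Finsupp.single 1 1), ?_⟩
  conv_lhs => rw [eq_sum_antidiagonal_of_isHomogeneous hp]
  simp [Finset.Nat.antidiagonal_succ, linear, add_comm]

theorem exists_eq_cubic {p : MvPolynomial (Fin 2) R} (hp : p.IsHomogeneous 3) :
    ∃ a b c d, p = cubic a b c d := by
  refine ⟨p.coeff (Finsupp.single 0 3 + Finsupp.single 1 0),
    p.coeff (Finsupp.single 0 2 + Finsupp.single 1 1),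
    p.coeff (Finsupp.single 0 1 + Finsupp.single 1 2),
    p.coeff (Finsupp.single 0 0 + Finsupp.single 1 3), ?_⟩
  conv_lhs => rw [eq_sum_antidiagonal_of_isHomogeneous hp]
  simp only [Finset.Nat.antidiagonal_succ, Finset.Nat.antidiagonal_zero, Finset.sum_cons,
    Finset.map_singleton, Finset.map_cons, Finset.sum_singleton, cubic]
  simp
  ring

theorem isHomogeneous_linear (m n : R) : (linear m n).IsHomogeneous 1 :=
  (isHomogeneous_C_mul_X m 0).add (isHomogeneous_C_mul_X n 1)

theorem isHomogeneous_cubic (a b c d : R) : (cubic a b c d).IsHomogeneous 3 :=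
  (((isHomogeneous_C_mul_X_pow a 0 3).add
    ((isHomogeneous_C_mul_X_pow b 0 2).mul (isHomogeneous_X R 1))).add
    ((isHomogeneous_C_mul_X c 0).mul (isHomogeneous_X_pow 1 2))).add
    (isHomogeneous_C_mul_X_pow d 1 3)

@[simp]
theorem eval_linear (m n u v : R) : eval ![u, v] (linear m n) = m * u + n * v := by
  simp [linear]

@[simp]
theorem eval_quadratic (a b c u v : R) :
    eval ![u, v] (quadratic a b c) = a * u ^ 2 + b * u * v + c * v ^ 2 := by
  simp [quadratic]

@[simp]
theorem eval_cubic (a b c d u v : R) :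
    eval ![u, v] (cubic a b c d) =
      a * u ^ 3 + b * u ^ 2 * v + c * u * v ^ 2 + d * v ^ 3 := by
  simp [cubic]

theorem linear_inj {m n m' n' : R} : linear m n = linear m' n' ↔ m = m' ∧ n = n' := by
  refine ⟨fun h => ⟨?_, ?_⟩, by rintro ⟨rfl, rfl⟩; rfl⟩
  · simpa using congrArg (eval ![1, 0]) h
  · simpa using congrArg (eval ![0, 1]) h

@[simp]
theorem linear_zero_zero : linear (0 : R) 0 = 0 := by simp [linear]

theorem C_mul_linear (c m n : R) : C c * linear m n = linear (c * m) (c * n) := by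
  simp only [linear, map_mul]; ring

theorem linear_mul_quadratic (m n a b c : R) :
    linear m n * quadratic a b c = cubic (m * a) (m * b + n * a) (m * c + n * b) (n * c) := by
  simp only [linear, quadratic, cubic, map_mul, map_add]; ring

theorem linear_mul_linear (m n m' n' : R) :
    linear m n * linear m' n' = quadratic (m * m') (m * n' + n * m') (n * n') := by
  simp only [linear, quadratic, map_mul, map_add]; ring

theorem cubic_add_cubic (a b c d a' b' c' d' : R) :
    cubic a b c d + cubic a' b' c' d' = cubic (a + a') (b + b') (c + c') (d + d') := by
  simp only [cubic, map_add]; ring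

theorem cubic_sub_cubic (a b c d a' b' c' d' : R) :
    cubic a b c d - cubic a' b' c' d' = cubic (a - a') (b - b') (c - c') (d - d') := by
  simp only [cubic, map_sub]; ring

theorem not_irreducible_linear_mul_quadratic [Nontrivial R] (m n a b c : R) :
    ¬ Irreducible (linear m n * quadratic a b c) := by
  intro h
  rcases h.isUnit_or_isUnit rfl with h | h
  · simpa using h.map (eval ![(0 : R), 0])
  · simpa using h.map (eval ![(0 : R), 0])

/-- The linear substitution `X ↦ pX + qY`, `Y ↦ rX + sY`. -/
noncomputable def subst (p q r s : R) : MvPolynomial (Fin 2) R →ₐ[R] MvPolynomial (Fin 2) R :=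
  aeval ![linear p q, linear r s]

theorem subst_linear (p q r s m n : R) :
    subst p q r s (linear m n) = linear (m * p + n * r) (m * q + n * s) := by
  simp [subst, linear, algebraMap_eq]; ring

theorem subst_comp_subst {p q r s p' q' r' s' : R}
    (h₁ : p' * p + q' * r = 1) (h₂ : p' * q + q' * s = 0)
    (h₃ : r' * p + s' * r = 0) (h₄ : r' * q + s' * s = 1) :
    (subst p q r s).comp (subst p' q' r' s') = AlgHom.id R _ := by
  ext i : 1
  have h0 : subst p' q' r' s' (X 0) = linear p' q' := by simp [subst]
  have h1 : subst p' q' r' s' (X 1) = linear r' s' := by simp [subst]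
  fin_cases i
  · simp only [AlgHom.comp_apply, Fin.zero_eta, h0, subst_linear, h₁, h₂]; simp [linear]
  · simp only [AlgHom.comp_apply, Fin.mk_one, h1, subst_linear, h₃, h₄]; simp [linear]

theorem irreducible_subst_iff {p q r s p' q' r' s' : R}
    (h₁ : p' * p + q' * r = 1) (h₂ : p' * q + q' * s = 0)
    (h₃ : r' * p + s' * r = 0) (h₄ : r' * q + s' * s = 1)
    (k₁ : p * p' + q * r' = 1) (k₂ : p * q' + q * s' = 0)
    (k₃ : r * p' + s * r' = 0) (k₄ : r * q' + s * s' = 1) (f : MvPolynomial (Fin 2) R) :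
    Irreducible (subst p q r s f) ↔ Irreducible f :=
  MulEquiv.irreducible_iff (AlgEquiv.ofAlgHom (subst p q r s) (subst p' q' r' s')
    (subst_comp_subst h₁ h₂ h₃ h₄) (subst_comp_subst k₁ k₂ k₃ k₄))

theorem subst_cubic_one_zero_neg_one_one (p q r s : R) :
    subst p q r s (cubic 1 0 (-1) 1) =
      cubic (p ^ 3 - p * r ^ 2 + r ^ 3)
        (3 * p ^ 2 * q - 2 * p * r * s - q * r ^ 2 + 3 * r ^ 2 * s)
        (3 * p * q ^ 2 - p * s ^ 2 - 2 * q * r * s + 3 * r * s ^ 2)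
        (q ^ 3 - q * s ^ 2 + s ^ 3) := by
  have h2 : (C 2 : MvPolynomial (Fin 2) R) = 2 := map_ofNat C 2
  have h3 : (C 3 : MvPolynomial (Fin 2) R) = 3 := map_ofNat C 3
  simp [subst, linear, cubic, h2, h3]
  ring

section ZModThree

/-- The cubic with the given coefficients has no zero on the projective line over `𝔽₃`. -/
abbrev NoRoots (a b c d : ZMod 3) : Prop :=
  a ≠ 0 ∧ d ≠ 0 ∧ a + b + c + d ≠ 0 ∧ a - b + c - d ≠ 0

theorem noRoots_of_irreducible_cubic {a b c d : ZMod 3} (h : Irreducible (cubic a b c d)) :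
    NoRoots a b c d := by
  refine ⟨fun h0 => ?_, fun h0 => ?_, fun h0 => ?_, fun h0 => ?_⟩
  · refine not_irreducible_linear_mul_quadratic 0 1 b c d ?_
    rw [linear_mul_quadratic]
    convert h using 2 <;> simp [h0]
  · refine not_irreducible_linear_mul_quadratic 1 0 a b c ?_
    rw [linear_mul_quadratic]
    convert h using 2 <;> simp [h0]
  · refine not_irreducible_linear_mul_quadratic 1 (-1) a (a + b) (-d) ?_
    rw [linear_mul_quadratic]
    convert h using 2 <;> first | linear_combination h0 | linear_combination -h0 | ring1
  · refine not_irreducible_linear_mul_quadratic 1 1 a (b - a) d ?_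
    rw [linear_mul_quadratic]
    convert h using 2 <;> first | linear_combination h0 | linear_combination -h0 | ring1

theorem NoRoots.exists_substitution : ∀ {a b c d : ZMod 3}, NoRoots a b c d →
    ∃ p q r s : ZMod 3, p * s - q * r ≠ 0 ∧
      a = p ^ 3 - p * r ^ 2 + r ^ 3 ∧
      b = 3 * p ^ 2 * q - 2 * p * r * s - q * r ^ 2 + 3 * r ^ 2 * s ∧
      c = 3 * p * q ^ 2 - p * s ^ 2 - 2 * q * r * s + 3 * r * s ^ 2 ∧
      d = q ^ 3 - q * s ^ 2 + s ^ 3 := by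
  decide +kernel

theorem NoRoots.irreducible_cubic_iff {a b c d : ZMod 3} (h : NoRoots a b c d) :
    Irreducible (cubic a b c d) ↔ Irreducible (cubic (1 : ZMod 3) 0 (-1) 1) := by
  obtain ⟨p, q, r, s, hdet, rfl, rfl, rfl, rfl⟩ := h.exists_substitution
  rw [← subst_cubic_one_zero_neg_one_one]
  have hinv : (p * s - q * r) * (p * s - q * r)⁻¹ = 1 := mul_inv_cancel₀ hdet
  set e := (p * s - q * r)⁻¹
  refine irreducible_subst_iff (p' := e * s) (q' := -e * q) (r' := -e * r) (s' := e * p)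
    ?_ ?_ ?_ ?_ ?_ ?_ ?_ ?_ _ <;> first | ring1 | linear_combination hinv

theorem linear_pow_three (m n : ZMod 3) : linear m n ^ 3 = cubic m 0 0 n := by
  have hm : (C m : MvPolynomial (Fin 2) (ZMod 3)) ^ 3 = C m := by
    rw [← map_pow, ZMod.pow_card]
  have hn : (C n : MvPolynomial (Fin 2) (ZMod 3)) ^ 3 = C n := by
    rw [← map_pow, ZMod.pow_card]
  simp only [linear, cubic, add_pow_char, mul_pow, hm, hn, map_zero, zero_mul, add_zero]

theorem not_exists_linear_eq_C_mul_iff {m n m' n' : ZMod 3} :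
    (¬ ∃ c : ZMod 3, linear m' n' = C c * linear m n) ↔
      ∀ c : ZMod 3, ¬ (m' = c * m ∧ n' = c * n) := by
  simp only [C_mul_linear, linear_inj, not_exists]

/-- At least three of four elements vanish. -/
abbrev ThreeVanish (w₁ w₂ w₃ w₄ : ZMod 3) : Prop :=
  (w₁ = 0 ∧ w₂ = 0 ∧ w₃ = 0) ∨ (w₁ = 0 ∧ w₂ = 0 ∧ w₄ = 0) ∨
    (w₁ = 0 ∧ w₃ = 0 ∧ w₄ = 0) ∨ (w₂ = 0 ∧ w₃ = 0 ∧ w₄ = 0)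

theorem threeVanish_of_not_proportional : ∀ {m₁ n₁ m₂ n₂ m₃ n₃ : ZMod 3},
    (∀ c : ZMod 3, ¬ (m₂ = c * m₁ ∧ n₂ = c * n₁)) →
    (∀ c : ZMod 3, ¬ (m₃ = c * m₁ ∧ n₃ = c * n₁)) →
    (∀ c : ZMod 3, ¬ (m₃ = c * m₂ ∧ n₃ = c * n₂)) →
    ThreeVanish (m₁ * m₂ * m₃) (n₁ * n₂ * n₃) ((m₁ + n₁) * (m₂ + n₂) * (m₃ + n₃))
      ((m₁ - n₁) * (m₂ - n₂) * (m₃ - n₃)) := by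
  decide +kernel

set_option synthInstance.maxSize 4000 in
set_option synthInstance.maxHeartbeats 400000 in
theorem eq_of_threeVanish : ∀ {v₁ v₂ v₃ v₄ : ZMod 3}, v₁ ≠ 0 → v₂ ≠ 0 → v₃ ≠ 0 → v₄ ≠ 0 →
    ∀ {m n m' n' : ZMod 3},
      ThreeVanish (2 * v₁ - m) (2 * v₂ - n) (2 * v₃ - (m + n)) (2 * v₄ - (m - n)) →
      ThreeVanish (2 * v₁ - m') (2 * v₂ - n') (2 * v₃ - (m' + n')) (2 * v₄ - (m' - n')) →
      m = m' ∧ n = n' := by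
  decide +kernel

set_option synthInstance.maxSize 4000 in
set_option synthInstance.maxHeartbeats 400000 in
theorem NoRoots.exists_companion : ∀ {a b c d : ZMod 3}, NoRoots a b c d →
    ∃ m n : ZMod 3, (m ≠ 0 ∨ n ≠ 0) ∧ NoRoots (m - a) (-b) (-c) (n - d) ∧
      ∃ e : ZMod 3, e ≠ 0 ∧
        ((a - (m - a) = 0 ∧ b - -b = e ∧ c - -c = e ∧ d - (n - d) = 0) ∨
         (a - (m - a) = 0 ∧ b - -b = e ∧ c - -c = -e ∧ d - (n - d) = 0) ∨
         (a - (m - a) = e ∧ b - -b = 0 ∧ c - -c = -e ∧ d - (n - d) = 0) ∨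
         (a - (m - a) = 0 ∧ b - -b = e ∧ c - -c = 0 ∧ d - (n - d) = -e)) := by
  decide +kernel

/-- A cubic is a product of three pairwise non-proportional nonzero linear forms. -/
abbrev IsSplit (f : MvPolynomial (Fin 2) (ZMod 3)) : Prop :=
  ∃ M₁ M₂ M₃ : MvPolynomial (Fin 2) (ZMod 3),
    M₁ ≠ 0 ∧ M₂ ≠ 0 ∧ M₃ ≠ 0 ∧
    M₁.IsHomogeneous 1 ∧ M₂.IsHomogeneous 1 ∧ M₃.IsHomogeneous 1 ∧
    (¬ ∃ c : ZMod 3, M₂ = C c * M₁) ∧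
    (¬ ∃ c : ZMod 3, M₃ = C c * M₁) ∧
    (¬ ∃ c : ZMod 3, M₃ = C c * M₂) ∧
    f = M₁ * M₂ * M₃

theorem linear_ne_zero_iff {m n : ZMod 3} : linear m n ≠ 0 ↔ m ≠ 0 ∨ n ≠ 0 := by
  rw [← linear_zero_zero, Ne, linear_inj]; tauto

theorem isSplit_linear_mul {m₁ n₁ m₂ n₂ m₃ n₃ : ZMod 3}
    (h : (m₁ ≠ 0 ∨ n₁ ≠ 0) ∧ (m₂ ≠ 0 ∨ n₂ ≠ 0) ∧ (m₃ ≠ 0 ∨ n₃ ≠ 0) ∧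
      (∀ c : ZMod 3, ¬ (m₂ = c * m₁ ∧ n₂ = c * n₁)) ∧
      (∀ c : ZMod 3, ¬ (m₃ = c * m₁ ∧ n₃ = c * n₁)) ∧
      (∀ c : ZMod 3, ¬ (m₃ = c * m₂ ∧ n₃ = c * n₂))) :
    IsSplit (linear m₁ n₁ * linear m₂ n₂ * linear m₃ n₃) :=
  ⟨_, _, _, linear_ne_zero_iff.2 h.1, linear_ne_zero_iff.2 h.2.1, linear_ne_zero_iff.2 h.2.2.1,
    isHomogeneous_linear _ _, isHomogeneous_linear _ _, isHomogeneous_linear _ _,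
    not_exists_linear_eq_C_mul_iff.2 h.2.2.2.1, not_exists_linear_eq_C_mul_iff.2 h.2.2.2.2.1,
    not_exists_linear_eq_C_mul_iff.2 h.2.2.2.2.2, rfl⟩

set_option synthInstance.maxSize 4000 in
set_option synthInstance.maxHeartbeats 400000 in
theorem isSplit_cubic {a b c d e : ZMod 3} (he : e ≠ 0)
    (h : (a = 0 ∧ b = e ∧ c = e ∧ d = 0) ∨ (a = 0 ∧ b = e ∧ c = -e ∧ d = 0) ∨
      (a = e ∧ b = 0 ∧ c = -e ∧ d = 0) ∨ (a = 0 ∧ b = e ∧ c = 0 ∧ d = -e)) :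
    IsSplit (cubic a b c d) := by
  rcases h with ⟨rfl, rfl, rfl, rfl⟩ | ⟨rfl, rfl, rfl, rfl⟩ | ⟨rfl, rfl, rfl, rfl⟩ |
    ⟨rfl, rfl, rfl, rfl⟩
  · convert isSplit_linear_mul (m₁ := 0) (n₁ := 1) (m₂ := 1) (n₂ := 1) (m₃ := c) (n₃ := 0)
      (by decide +revert +kernel) using 1
    rw [mul_comm, linear_mul_linear, linear_mul_quadratic]; congr 1 <;> ring
  · convert isSplit_linear_mul (m₁ := 0) (n₁ := 1) (m₂ := 1) (n₂ := -1) (m₃ := b) (n₃ := 0)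
      (by decide +revert +kernel) using 1
    rw [mul_comm, linear_mul_linear, linear_mul_quadratic]; congr 1 <;> ring
  · convert isSplit_linear_mul (m₁ := 1) (n₁ := 1) (m₂ := 1) (n₂ := -1) (m₃ := a) (n₃ := 0)
      (by decide +revert +kernel) using 1
    rw [mul_comm, linear_mul_linear, linear_mul_quadratic]; congr 1 <;> ring
  · convert isSplit_linear_mul (m₁ := 1) (n₁ := 1) (m₂ := 1) (n₂ := -1) (m₃ := 0) (n₃ := b)
      (by decide +revert +kernel) using 1
    rw [mul_comm, linear_mul_linear, linear_mul_quadratic]; congr 1 <;> ring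

theorem exists_threeVanish {a b c d : ZMod 3} {Q M : MvPolynomial (Fin 2) (ZMod 3)}
    (hM : M.IsHomogeneous 1) (hadd : cubic a b c d + Q = M ^ 3)
    (hsub : IsSplit (cubic a b c d - Q)) :
    ∃ m n, M = linear m n ∧
      ThreeVanish (2 * a - m) (2 * d - n) (2 * (a + b + c + d) - (m + n))
        (2 * (a - b + c - d) - (m - n)) := by
  obtain ⟨m, n, rfl⟩ := exists_eq_linear hM
  obtain ⟨M₁, M₂, M₃, -, -, -, h₁, h₂, h₃, h₁₂, h₁₃, h₂₃, hsub⟩ := hsub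
  obtain ⟨m₁, n₁, rfl⟩ := exists_eq_linear h₁
  obtain ⟨m₂, n₂, rfl⟩ := exists_eq_linear h₂
  obtain ⟨m₃, n₃, rfl⟩ := exists_eq_linear h₃
  refine ⟨m, n, rfl, ?_⟩
  have key : cubic a b c d + cubic a b c d - cubic m 0 0 n =
      linear m₁ n₁ * linear m₂ n₂ * linear m₃ n₃ := by
    rw [← linear_pow_three, ← hadd, ← hsub]; ring
  convert threeVanish_of_not_proportional (not_exists_linear_eq_C_mul_iff.1 h₁₂)
    (not_exists_linear_eq_C_mul_iff.1 h₁₃) (not_exists_linear_eq_C_mul_iff.1 h₂₃) using 1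
  · have := congrArg (eval ![1, 0]) key
    simp at this; linear_combination this
  · have := congrArg (eval ![0, 1]) key
    simp at this; linear_combination this
  · have := congrArg (eval ![1, 1]) key
    simp at this; linear_combination this
  · have := congrArg (eval ![1, -1]) key
    simp at this; linear_combination this

end ZModThree

end BinaryForm

open BinaryForm in
theorem cubic_companion_over_F3 (P : MvPolynomial (Fin 2) (ZMod 3))
    (hirr : Irreducible P) (hhom : P.IsHomogeneous 3) :
    ∃! P' : MvPolynomial (Fin 2) (ZMod 3),
      Irreducible P' ∧ P'.IsHomogeneous 3 ∧
      (∃ M : MvPolynomial (Fin 2) (ZMod 3), M ≠ 0 ∧ M.IsHomogeneous 1 ∧ P + P' = M ^ 3) ∧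
      (∃ M₁ M₂ M₃ : MvPolynomial (Fin 2) (ZMod 3),
        M₁ ≠ 0 ∧ M₂ ≠ 0 ∧ M₃ ≠ 0 ∧
        M₁.IsHomogeneous 1 ∧ M₂.IsHomogeneous 1 ∧ M₃.IsHomogeneous 1 ∧
        (¬ ∃ c : ZMod 3, M₂ = C c * M₁) ∧
        (¬ ∃ c : ZMod 3, M₃ = C c * M₁) ∧
        (¬ ∃ c : ZMod 3, M₃ = C c * M₂) ∧
        P - P' = M₁ * M₂ * M₃) := by
  obtain ⟨a, b, c, d, rfl⟩ := exists_eq_cubic hhom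
  have hP := noRoots_of_irreducible_cubic hirr
  refine existsUnique_of_exists_of_unique ?_ ?_
  · obtain ⟨m, n, hmn, hP', e, he, h⟩ := hP.exists_companion
    refine ⟨cubic (m - a) (-b) (-c) (n - d),
      hP'.irreducible_cubic_iff.2 (hP.irreducible_cubic_iff.1 hirr), isHomogeneous_cubic _ _ _ _,
      ⟨linear m n, linear_ne_zero_iff.2 hmn, isHomogeneous_linear m n, ?_⟩, ?_⟩
    · rw [linear_pow_three, cubic_add_cubic]; congr 1 <;> ring
    · rw [cubic_sub_cubic]; exact isSplit_cubic he h
  · rintro Q Q' ⟨-, -, ⟨M, -, hM, hadd⟩, hsub⟩ ⟨-, -, ⟨M', -, hM', hadd'⟩, hsub'⟩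
    obtain ⟨m, n, rfl, h⟩ := exists_threeVanish hM hadd hsub
    obtain ⟨m', n', rfl, h'⟩ := exists_threeVanish hM' hadd' hsub'
    obtain ⟨rfl, rfl⟩ := eq_of_threeVanish hP.1 hP.2.1 hP.2.2.1 hP.2.2.2 h h'
    exact add_left_cancel (hadd.trans hadd'.symm)
end

section
/- Let F ∈ 𝔽₂[X, Y] (i.e., MvPolynomial (Fin 2) (ZMod 2)) be an irreducible homogeneous form of degree 6. Then there exist an ordering (L₁, L₂, L₃) of the three linear forms (X, Y, X + Y) and an ordering (C₁, C₂) of the two irreducible cubic forms (X³ + X·Y² + Y³, X³ + X²·Y + Y³) such that F = L₁²·L₂·C₁ + L₃·Q·C₂, where Q = X² + X·Y + Y² is the unique irreducible quadratic form over 𝔽₂. -/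
open MvPolynomial

open Finset in
/-- A binary form is determined by its coefficients at the monomials `X ^ (n - i) * Y ^ i`. -/
lemma MvPolynomial.IsHomogeneous.eq_sum_range_fin_two {R : Type*} [CommSemiring R]
    {F : MvPolynomial (Fin 2) R} {n : ℕ} (hF : F.IsHomogeneous n) :
    F = ∑ i ∈ range (n + 1),
      C (coeff (Finsupp.single 0 (n - i) + Finsupp.single 1 i) F) * (X 0 ^ (n - i) * X 1 ^ i) := by
  have key (i : ℕ) (a : R) : C a * ((X 0 : MvPolynomial (Fin 2) R) ^ (n - i) * X 1 ^ i) =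
      monomial (Finsupp.single 0 (n - i) + Finsupp.single 1 i) a := by
    rw [X_pow_eq_monomial, X_pow_eq_monomial, monomial_mul, C_mul_monomial]
    simp
  simp only [key]
  ext m
  simp only [coeff_sum, coeff_monomial]
  by_cases hm : m 0 + m 1 = n
  · have hm' : Finsupp.single 0 (n - m 1) + Finsupp.single 1 (m 1) = m := by
      ext j
      fin_cases j
      · simp; omega
      · simp
    rw [sum_eq_single (m 1), if_pos hm', hm']
    · intro i _ hi
      refine if_neg fun h => hi ?_
      simp [← h]
    · intro h
      exact absurd (mem_range.mpr (by omega)) h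
  · rw [sum_eq_zero]
    · refine hF.coeff_eq_zero ?_
      simpa [Finsupp.degree_eq_sum] using hm
    · intro i hi
      refine if_neg fun h => hm ?_
      have := mem_range.mp hi
      simp [← h]
      omega

/-- A product of two polynomials vanishing at the origin is reducible. -/
lemma MvPolynomial.not_irreducible_mul_of_eval_zero {σ R : Type*} [CommRing R] [Nontrivial R]
    {G H : MvPolynomial σ R} (hG : eval 0 G = 0) (hH : eval 0 H = 0) :
    ¬ Irreducible (G * H) := by
  intro h
  rcases h.isUnit_or_isUnit rfl with hu | hu
  · exact not_isUnit_zero (hG ▸ hu.map (eval (0 : σ → R)))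
  · exact not_isUnit_zero (hH ▸ hu.map (eval (0 : σ → R)))

set_option maxHeartbeats 2000000 in
theorem sextic_VIS_over_F2 (F : MvPolynomial (Fin 2) (ZMod 2))
    (hirr : Irreducible F) (hhom : F.IsHomogeneous 6) :
    ∃ L₁ L₂ L₃ C₁ C₂ : MvPolynomial (Fin 2) (ZMod 2),
      ([L₁, L₂, L₃] : List (MvPolynomial (Fin 2) (ZMod 2))).Perm
        [X 0, X 1, X 0 + X 1] ∧
      ([C₁, C₂] : List (MvPolynomial (Fin 2) (ZMod 2))).Perm
        [(X 0) ^ 3 + X 0 * (X 1) ^ 2 + (X 1) ^ 3,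
         (X 0) ^ 3 + (X 0) ^ 2 * X 1 + (X 1) ^ 3] ∧
      F = L₁ ^ 2 * L₂ * C₁ + L₃ * ((X 0) ^ 2 + X 0 * X 1 + (X 1) ^ 2) * C₂ := by
  have two_eq_zero : (2 : MvPolynomial (Fin 2) (ZMod 2)) = 0 := CharTwo.two_eq_zero
  have hF := hhom.eq_sum_range_fin_two
  have false_of_eq_mul (G H : MvPolynomial (Fin 2) (ZMod 2)) (hGH : F = G * H)
      (hG : eval 0 G = 0) (hH : eval 0 H = 0) : False :=
    not_irreducible_mul_of_eval_zero hG hH (hGH ▸ hirr)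
  generalize hc : (fun i : ℕ => coeff (Finsupp.single 0 (6 - i) + Finsupp.single 1 i) F) = c at *
  replace hF : F = ∑ i ∈ Finset.range 7, C (c i) * (X 0 ^ (6 - i) * X 1 ^ i) := by
    rw [← hc]; exact hF
  clear hc hhom
  simp only [Finset.sum_range_succ, Finset.sum_range_zero] at hF
  norm_num at hF
  generalize c 0 = c₀, c 1 = c₁, c 2 = c₂, c 3 = c₃, c 4 = c₄, c 5 = c₅, c 6 = c₆ at hF
  clear c
  have bit (a : ZMod 2) : a = 0 ∨ a = 1 := by revert a; decide
  have hc₀ : c₀ = 1 := by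
    refine (bit c₀).resolve_left fun h => false_of_eq_mul (X 1)
      (C c₁ * X 0 ^ 5 + C c₂ * X 0 ^ 4 * X 1 + C c₃ * X 0 ^ 3 * X 1 ^ 2 + C c₄ * X 0 ^ 2 * X 1 ^ 3 +
        C c₅ * X 0 * X 1 ^ 4 + C c₆ * X 1 ^ 5) ?_ (by simp) (by simp)
    rw [hF, h, C_0]
    ring
  have hc₆ : c₆ = 1 := by
    refine (bit c₆).resolve_left fun h => false_of_eq_mul (X 0)
      (C c₀ * X 0 ^ 5 + C c₁ * X 0 ^ 4 * X 1 + C c₂ * X 0 ^ 3 * X 1 ^ 2 + C c₃ * X 0 ^ 2 * X 1 ^ 3 +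
        C c₄ * X 0 * X 1 ^ 4 + C c₅ * X 1 ^ 5) ?_ (by simp) (by simp)
    rw [hF, h, C_0]
    ring
  subst hc₀ hc₆
  have hc₅ : c₅ = 1 + c₁ + c₂ + c₃ + c₄ := by
    by_contra h
    replace h : c₅ = c₁ + c₂ + c₃ + c₄ := by
      rcases bit (c₅ + (c₁ + c₂ + c₃ + c₄)) with h' | h'
      · exact CharTwo.add_eq_zero.mp h'
      · exact absurd (by grind) h
    refine false_of_eq_mul (X 0 + X 1)
      (X 0 ^ 5 + (1 + C c₁) * X 0 ^ 4 * X 1 + (1 + C c₁ + C c₂) * X 0 ^ 3 * X 1 ^ 2 +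
        (1 + C c₁ + C c₂ + C c₃) * X 0 ^ 2 * X 1 ^ 3 +
        (1 + C c₁ + C c₂ + C c₃ + C c₄) * X 0 * X 1 ^ 4 + X 1 ^ 5) ?_ (by simp) (by simp)
    rw [hF, h]
    simp only [C_add, C_1]
    grind
  subst hc₅
  rcases bit c₁ with rfl | rfl <;> rcases bit c₂ with rfl | rfl <;>
    rcases bit c₃ with rfl | rfl <;> rcases bit c₄ with rfl | rfl <;>
    simp only [C_add, C_0, C_1] at hF
  · refine ⟨X 0 + X 1, X 0, X 1, _, _, by grind, .swap _ _ _, ?_⟩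
    grind
  · exact (false_of_eq_mul (X 0 ^ 3 + X 0 * X 1 ^ 2 + X 1 ^ 3) (X 0 ^ 3 + X 0 * X 1 ^ 2 + X 1 ^ 3)
      (by grind) (by simp) (by simp)).elim
  · refine ⟨X 1, X 0, X 0 + X 1, _, _, by grind, .swap _ _ _, ?_⟩
    grind
  · exact (false_of_eq_mul (X 0 ^ 2 + X 0 * X 1 + X 1 ^ 2)
      (X 0 ^ 4 + X 0 ^ 3 * X 1 + X 1 ^ 4)
      (by grind) (by simp) (by simp)).elim
  · exact (false_of_eq_mul (X 0 ^ 3 + X 0 ^ 2 * X 1 + X 1 ^ 3) (X 0 ^ 3 + X 0 ^ 2 * X 1 + X 1 ^ 3)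
      (by grind) (by simp) (by simp)).elim
  · refine ⟨X 0, X 0 + X 1, X 1, _, _, by grind, .refl _, ?_⟩
    grind
  · refine ⟨X 0 + X 1, X 1, X 0, _, _, by grind, .swap _ _ _, ?_⟩
    grind
  · exact (false_of_eq_mul (X 0 ^ 2 + X 0 * X 1 + X 1 ^ 2)
      (X 0 ^ 4 + X 0 ^ 3 * X 1 + X 0 ^ 2 * X 1 ^ 2 + X 0 * X 1 ^ 3 + X 1 ^ 4)
      (by grind) (by simp) (by simp)).elim
  · refine ⟨X 0 + X 1, X 1, X 0, _, _, by grind, .refl _, ?_⟩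
    grind
  · refine ⟨X 0, X 1, X 0 + X 1, _, _, by grind, .swap _ _ _, ?_⟩
    grind
  · exact (false_of_eq_mul (X 0 ^ 2 + X 0 * X 1 + X 1 ^ 2) (X 0 ^ 4 + X 0 ^ 2 * X 1 ^ 2 + X 1 ^ 4)
      (by grind) (by simp) (by simp)).elim
  · refine ⟨X 0 + X 1, X 0, X 1, _, _, by grind, .refl _, ?_⟩
    grind
  · refine ⟨X 1, X 0, X 0 + X 1, _, _, by grind, .refl _, ?_⟩
    grind
  · refine ⟨X 1, X 0 + X 1, X 0, _, _, by grind, .swap _ _ _, ?_⟩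
    grind
  · exact (false_of_eq_mul (X 0 ^ 2 + X 0 * X 1 + X 1 ^ 2) (X 0 ^ 4 + X 0 * X 1 ^ 3 + X 1 ^ 4)
      (by grind) (by simp) (by simp)).elim
  · exact (false_of_eq_mul (X 0 ^ 3 + X 0 * X 1 ^ 2 + X 1 ^ 3) (X 0 ^ 3 + X 0 ^ 2 * X 1 + X 1 ^ 3)
      (by grind) (by simp) (by simp)).elim
end

section
/- Let F ∈ 𝔽₂[X, Y] (i.e., MvPolynomial (Fin 2) (ZMod 2)) be an irreducible homogeneous form of degree 7. Then there exist an integer i with 0 < i < 4, an ordering (L₁, L₂, L₃) of the three linear forms (X, Y, X + Y), and an ordering (C₁, C₂) of the two irreducible cubic forms (X³ + X·Y² + Y³, X³ + X²·Y + Y³) such that F = L₁^i·L₂^{4−i}·C₁ + L₃²·Q·C₂, where Q = X² + X·Y + Y²; moreover, this data (i, L₁, L₂, L₃, C₁, C₂) is unique up to simultaneously replacing i by 4 − i and interchanging L₁ with L₂. -/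
open MvPolynomial

namespace BinaryForm

section Semiring

variable {R : Type*} [CommSemiring R]

/-- The binary form of degree `l.length - 1` whose coefficient at `X ^ j * Y ^ (l.length - 1 - j)`
is the `j`-th entry of `l`. -/
noncomputable def ofList : List R → MvPolynomial (Fin 2) R
  | [] => 0
  | a :: l => C a * X 1 ^ l.length + X 0 * ofList l

/-- The coefficient list of a product of binary forms. -/
def mul : List R → List R → List R
  | [], b => List.replicate (b.length - 1) 0
  | a :: l, b => List.zipWith (· + ·) (b.map (a * ·) ++ List.replicate l.length 0) (0 :: mul l b)

/-- The coefficient list of a power of a binary form. -/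
def pow (l : List R) : ℕ → List R
  | 0 => [1]
  | n + 1 => mul l (pow l n)

theorem ofList_zipWith_add {a b : List R} (h : a.length = b.length) :
    ofList (List.zipWith (· + ·) a b) = ofList a + ofList b := by
  induction a generalizing b with
  | nil => cases b <;> simp_all [ofList]
  | cons x a ih =>
    cases b with
    | nil => simp at h
    | cons y b =>
      have h' : a.length = b.length := by simpa using h
      simp only [List.zipWith_cons_cons, ofList, ih h', List.length_zipWith, h', min_self, C_add]
      ring

theorem ofList_map_mul (r : R) (l : List R) : ofList (l.map (r * ·)) = C r * ofList l := by
  induction l with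
  | nil => simp [ofList]
  | cons x l ih =>
    simp only [List.map_cons, ofList, ih, List.length_map, C_mul]
    ring

theorem ofList_replicate_zero (n : ℕ) : ofList (List.replicate n (0 : R)) = 0 := by
  induction n with
  | zero => rfl
  | succ n ih => simp [List.replicate_succ, ofList, ih]

theorem ofList_append_replicate_zero (l : List R) (n : ℕ) :
    ofList (l ++ List.replicate n 0) = ofList l * X 1 ^ n := by
  induction l with
  | nil => simp [ofList, ofList_replicate_zero]
  | cons x l ih =>
    simp only [List.cons_append, ofList, ih, List.length_append, List.length_replicate]
    ring

theorem length_mul (a : List R) {b : List R} (hb : 0 < b.length) :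
    (mul a b).length = a.length + b.length - 1 := by
  induction a with
  | nil => simp [mul]
  | cons x a ih =>
    simp only [mul, List.length_zipWith, List.length_append, List.length_map,
      List.length_replicate, List.length_cons, ih]
    omega

theorem ofList_mul (a : List R) {b : List R} (hb : 0 < b.length) :
    ofList (mul a b) = ofList a * ofList b := by
  induction a with
  | nil => simp [mul, ofList, ofList_replicate_zero]
  | cons x a ih =>
    rw [mul, ofList_zipWith_add]
    · simp only [ofList_append_replicate_zero, ofList_map_mul, ofList, ih, C_0]
      ring
    · simp only [List.length_append, List.length_map, List.length_replicate, List.length_cons,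
        length_mul a hb]
      omega

theorem length_pow {l : List R} (hl : 0 < l.length) (n : ℕ) :
    (pow l n).length = n * (l.length - 1) + 1 := by
  induction n with
  | zero => simp [pow]
  | succ n ih =>
    rw [pow, length_mul _ (by omega), ih, add_mul]
    omega

theorem ofList_pow {l : List R} (hl : 0 < l.length) (n : ℕ) :
    ofList (pow l n) = ofList l ^ n := by
  induction n with
  | zero => simp [pow, ofList]
  | succ n ih => rw [pow, ofList_mul _ (by simp [length_pow hl]), ih, pow_succ']

theorem exists_ofList_monomial (i j : ℕ) (r : R) :
    ∃ l : List R, l.length = i + j + 1 ∧ ofList l = C r * X 0 ^ i * X 1 ^ j := by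
  induction i with
  | zero =>
    exact ⟨r :: List.replicate j 0, by simp, by simp [ofList, ofList_replicate_zero]⟩
  | succ i ih =>
    obtain ⟨l, hl, h⟩ := ih
    refine ⟨0 :: l, by simp [hl]; omega, ?_⟩
    simp only [ofList, h, C_0]
    ring

theorem exists_ofList_eq {n : ℕ} {F : MvPolynomial (Fin 2) R} (hF : F.IsHomogeneous n) :
    ∃ l : List R, l.length = n + 1 ∧ ofList l = F := by
  rw [F.as_sum]
  refine Finset.sum_induction _ (fun G => ∃ l : List R, l.length = n + 1 ∧ ofList l = G) ?_ ?_ ?_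
  · rintro _ _ ⟨a, ha, rfl⟩ ⟨b, hb, rfl⟩
    exact ⟨List.zipWith (· + ·) a b, by simp [ha, hb], ofList_zipWith_add (by rw [ha, hb])⟩
  · exact ⟨List.replicate (n + 1) 0, by simp, ofList_replicate_zero _⟩
  · intro d hd
    have hn : d 0 + d 1 = n := by
      have : Finsupp.weight (fun _ => 1) d = n := hF (mem_support_iff.mp hd)
      rwa [← Finsupp.degree_eq_weight_one, Finsupp.degree_eq_sum, Fin.sum_univ_two] at this
    rw [monomial_eq, Finsupp.prod_fintype _ _ (by simp), Fin.prod_univ_two, ← mul_assoc, ← hn]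
    exact exists_ofList_monomial _ _ _

theorem eval_zero_ofList {l : List R} (hl : 1 < l.length) : eval 0 (ofList l) = 0 := by
  match l, hl with
  | _ :: _ :: _, _ => simp [ofList]

theorem not_irreducible_ofList_mul [Nontrivial R] {a b : List R} (ha : 1 < a.length)
    (hb : 1 < b.length) : ¬ Irreducible (ofList (mul a b)) := by
  have key {l : List R} (hl : 1 < l.length) : ¬ IsUnit (ofList l) := fun h => by
    have := h.map (eval (0 : Fin 2 → R))
    rw [eval_zero_ofList hl] at this
    exact not_isUnit_zero this
  intro h
  exact (h.isUnit_or_isUnit (ofList_mul a (by omega))).elim (key ha) (key hb)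

end Semiring

theorem ofList_injective {R : Type*} [CommRing R] [IsDomain R] {a b : List R}
    (hab : a.length = b.length) (h : ofList a = ofList b) : a = b := by
  induction a generalizing b with
  | nil => simpa [eq_comm] using hab
  | cons x a ih =>
    cases b with
    | nil => simp at hab
    | cons y b =>
      have hl : a.length = b.length := by simpa using hab
      have hxy : x = y := by simpa [ofList] using congrArg (eval ![0, 1]) h
      subst hxy
      simp only [ofList, hl] at h
      rw [ih hl (mul_left_cancel₀ (X_ne_zero 0) (add_left_cancel h))]

/-- The first `n` coefficients of the power series quotient of `c` by `d`, provided that `d`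
has constant coefficient `1`. -/
def quot {R : Type*} [CommRing R] (d : List R) : ℕ → List R → List R
  | n + 1, x :: c =>
    x :: quot d n (List.zipWith (· - ·) c (d.tail.map (x * ·) ++ List.replicate c.length 0))
  | _, _ => []

end BinaryForm

open BinaryForm

theorem List.perm_triple_iff {α : Type*} {a b c x y z : α} :
    [a, b, c].Perm [x, y, z] ↔
      (a, b, c) ∈ [(x, y, z), (x, z, y), (y, x, z), (y, z, x), (z, x, y), (z, y, x)] := by
  rw [← List.mem_permutations]
  simp [List.permutations, List.permutationsAux, List.permutationsAux.rec,
    List.permutationsAux2]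
  tauto

theorem List.perm_pair_iff {α : Type*} {a b x y : α} :
    [a, b].Perm [x, y] ↔ (a, b) ∈ [(x, y), (y, x)] := by
  rw [← List.mem_permutations]
  simp [List.permutations, List.permutationsAux, List.permutationsAux.rec,
    List.permutationsAux2]

namespace Septimic

/-- A choice of exponent, three linear forms and two cubic forms, all as coefficient lists. -/
abbrev Datum : Type :=
  ℕ × (List (ZMod 2) × List (ZMod 2) × List (ZMod 2)) × List (ZMod 2) × List (ZMod 2)

/-- The orderings of the three linear forms. -/
def linearTriples : List (List (ZMod 2) × List (ZMod 2) × List (ZMod 2)) :=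
  [([0, 1], [1, 0], [1, 1]), ([0, 1], [1, 1], [1, 0]), ([1, 0], [0, 1], [1, 1]),
   ([1, 0], [1, 1], [0, 1]), ([1, 1], [0, 1], [1, 0]), ([1, 1], [1, 0], [0, 1])]

/-- The orderings of the two irreducible cubic forms. -/
def cubicPairs : List (List (ZMod 2) × List (ZMod 2)) :=
  [([1, 1, 0, 1], [1, 0, 1, 1]), ([1, 0, 1, 1], [1, 1, 0, 1])]

/-- All admissible data. -/
def data : List Datum := [1, 2, 3] ×ˢ linearTriples ×ˢ cubicPairs

/-- The coefficient list of the septimic form attached to a datum. -/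
def septimic : Datum → List (ZMod 2)
  | (i, (l₁, l₂, l₃), c₁, c₂) =>
    List.zipWith (· + ·) (mul (mul (pow l₁ i) (pow l₂ (4 - i))) c₁)
      (mul (mul (pow l₃ 2) [1, 1, 1]) c₂)

/-- The datum with the two linear forms of the first summand interchanged. -/
def swap : Datum → Datum
  | (i, (l₁, l₂, l₃), c) => (4 - i, (l₂, l₁, l₃), c)

theorem eq_or_eq_swap :
    ∀ d ∈ data, ∀ d' ∈ data, septimic d' = septimic d → d' = d ∨ d' = swap d := by
  decide +kernel

theorem mem_or_reducible : ∀ a b c d e f g h : ZMod 2,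
    (∃ D ∈ data, septimic D = [a, b, c, d, e, f, g, h]) ∨
    [a, b, c, d, e, f, g, h] = mul [0, 1] [b, c, d, e, f, g, h] ∨
    ∃ m ∈ [[1, 0], [1, 1], [1, 1, 1], [1, 1, 0, 1], [1, 0, 1, 1]],
      [a, b, c, d, e, f, g, h] = mul m (quot m (9 - m.length) [a, b, c, d, e, f, g, h]) ∧
      1 < m.length ∧ 1 < (quot m (9 - m.length) [a, b, c, d, e, f, g, h]).length := by
  decide +kernel

theorem exists_septimic_eq {l : List (ZMod 2)} (hl : l.length = 8)
    (hirr : Irreducible (ofList l)) : ∃ D ∈ data, septimic D = l := by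
  match l, hl with
  | [a, b, c, d, e, f, g, h], _ =>
    obtain hD | hX | ⟨m, -, hm, hm₁, hm₂⟩ := mem_or_reducible a b c d e f g h
    · exact hD
    · rw [hX] at hirr
      exact absurd hirr (not_irreducible_ofList_mul (by simp) (by simp))
    · rw [hm] at hirr
      exact absurd hirr (not_irreducible_ofList_mul hm₁ hm₂)

theorem length_of_mem_data : ∀ D ∈ data, 0 < D.1 ∧ D.1 < 4 ∧ D.2.1.1.length = 2 ∧
    D.2.1.2.1.length = 2 ∧ D.2.1.2.2.length = 2 ∧ D.2.2.1.length = 4 ∧ D.2.2.2.length = 4 ∧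
    (septimic D).length = 8 := by
  decide +kernel

theorem ofList_septimic {i : ℕ} {l₁ l₂ l₃ c₁ c₂ : List (ZMod 2)}
    (h : (i, (l₁, l₂, l₃), c₁, c₂) ∈ data) :
    ofList (septimic (i, (l₁, l₂, l₃), c₁, c₂)) =
      ofList l₁ ^ i * ofList l₂ ^ (4 - i) * ofList c₁ +
        ofList l₃ ^ 2 * (X 0 ^ 2 + X 0 * X 1 + X 1 ^ 2) * ofList c₂ := by
  obtain ⟨-, hi, h₁, h₂, h₃, k₁, k₂, -⟩ := length_of_mem_data _ h
  dsimp only at hi h₁ h₂ h₃ k₁ k₂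
  have hp {l : List (ZMod 2)} (hl : l.length = 2) (n : ℕ) : (pow l n).length = n + 1 := by
    simp [length_pow (l := l) (by omega), hl]
  have hp₂ : 0 < (pow l₂ (4 - i)).length := by simp [hp h₂]
  have hc₁ : 0 < c₁.length := by omega
  have hc₂ : 0 < c₂.length := by omega
  have hq : 0 < ([1, 1, 1] : List (ZMod 2)).length := by simp
  have hQ : ofList ([1, 1, 1] : List (ZMod 2)) = X 0 ^ 2 + X 0 * X 1 + X 1 ^ 2 := by
    simp only [ofList, List.length_cons, List.length_nil, C_1]
    ring
  have hlen : (mul (mul (pow l₁ i) (pow l₂ (4 - i))) c₁).length =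
      (mul (mul (pow l₃ 2) [1, 1, 1]) c₂).length := by
    simp only [length_mul _ hc₁, length_mul _ hc₂, length_mul _ hp₂, length_mul _ hq, hp h₁,
      hp h₂, hp h₃, k₁, k₂, List.length_cons, List.length_nil]
    omega
  rw [septimic, ofList_zipWith_add hlen, ofList_mul _ hc₁, ofList_mul _ hc₂, ofList_mul _ hp₂,
    ofList_mul _ hq, ofList_pow (l := l₁) (by omega), ofList_pow (l := l₂) (by omega),
    ofList_pow (l := l₃) (by omega), hQ]

theorem perm_linear_iff {L₁ L₂ L₃ : MvPolynomial (Fin 2) (ZMod 2)} :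
    [L₁, L₂, L₃].Perm [X 0, X 1, X 0 + X 1] ↔
      ∃ t ∈ linearTriples, (ofList t.1, ofList t.2.1, ofList t.2.2) = (L₁, L₂, L₃) := by
  rw [List.perm_triple_iff]
  simp [linearTriples, ofList, eq_comm, add_comm]

theorem perm_cubic_iff {C₁ C₂ : MvPolynomial (Fin 2) (ZMod 2)} :
    [C₁, C₂].Perm [X 0 ^ 3 + X 0 * X 1 ^ 2 + X 1 ^ 3, X 0 ^ 3 + X 0 ^ 2 * X 1 + X 1 ^ 3] ↔
      ∃ t ∈ cubicPairs, (ofList t.1, ofList t.2) = (C₁, C₂) := by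
  have h₁ : ofList ([1, 1, 0, 1] : List (ZMod 2)) = X 0 ^ 3 + X 0 * X 1 ^ 2 + X 1 ^ 3 := by
    simp only [ofList, List.length_cons, List.length_nil, C_1, C_0]
    ring
  have h₂ : ofList ([1, 0, 1, 1] : List (ZMod 2)) = X 0 ^ 3 + X 0 ^ 2 * X 1 + X 1 ^ 3 := by
    simp only [ofList, List.length_cons, List.length_nil, C_1, C_0]
    ring
  rw [List.perm_pair_iff]
  simp [cubicPairs, h₁, h₂, eq_comm]

end Septimic

open Septimic

theorem septimic_VIS_over_F2 (F : MvPolynomial (Fin 2) (ZMod 2))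
    (hirr : Irreducible F) (hhom : F.IsHomogeneous 7) :
    ∃ (i : ℕ) (L₁ L₂ L₃ C₁ C₂ : MvPolynomial (Fin 2) (ZMod 2)),
      0 < i ∧ i < 4 ∧
      ([L₁, L₂, L₃] : List (MvPolynomial (Fin 2) (ZMod 2))).Perm
        [X 0, X 1, X 0 + X 1] ∧
      ([C₁, C₂] : List (MvPolynomial (Fin 2) (ZMod 2))).Perm
        [(X 0) ^ 3 + X 0 * (X 1) ^ 2 + (X 1) ^ 3,
         (X 0) ^ 3 + (X 0) ^ 2 * X 1 + (X 1) ^ 3] ∧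
      F = L₁ ^ i * L₂ ^ (4 - i) * C₁ + L₃ ^ 2 * ((X 0) ^ 2 + X 0 * X 1 + (X 1) ^ 2) * C₂ ∧
      ∀ (i' : ℕ) (L₁' L₂' L₃' C₁' C₂' : MvPolynomial (Fin 2) (ZMod 2)),
        0 < i' → i' < 4 →
        ([L₁', L₂', L₃'] : List (MvPolynomial (Fin 2) (ZMod 2))).Perm
          [X 0, X 1, X 0 + X 1] →
        ([C₁', C₂'] : List (MvPolynomial (Fin 2) (ZMod 2))).Perm
          [(X 0) ^ 3 + X 0 * (X 1) ^ 2 + (X 1) ^ 3,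
           (X 0) ^ 3 + (X 0) ^ 2 * X 1 + (X 1) ^ 3] →
        F = L₁' ^ i' * L₂' ^ (4 - i') * C₁' +
          L₃' ^ 2 * ((X 0) ^ 2 + X 0 * X 1 + (X 1) ^ 2) * C₂' →
        (i' = i ∧ L₁' = L₁ ∧ L₂' = L₂ ∧ L₃' = L₃ ∧ C₁' = C₁ ∧ C₂' = C₂) ∨
        (i' = 4 - i ∧ L₁' = L₂ ∧ L₂' = L₁ ∧ L₃' = L₃ ∧ C₁' = C₁ ∧ C₂' = C₂) := by
  obtain ⟨l, hl, rfl⟩ := exists_ofList_eq hhom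
  obtain ⟨⟨i, ⟨l₁, l₂, l₃⟩, c₁, c₂⟩, hD, rfl⟩ := exists_septimic_eq hl hirr
  obtain ⟨hi₀, hi₄, -⟩ := length_of_mem_data _ hD
  have hmem := hD
  simp only [data, List.mem_product] at hmem
  refine ⟨i, ofList l₁, ofList l₂, ofList l₃, ofList c₁, ofList c₂, hi₀, hi₄,
    perm_linear_iff.mpr ⟨_, hmem.2.1, rfl⟩, perm_cubic_iff.mpr ⟨_, hmem.2.2, rfl⟩,
    ofList_septimic hD, ?_⟩
  intro i' L₁ L₂ L₃ C₁ C₂ h₀ h₄ hL hC h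
  obtain ⟨⟨m₁, m₂, m₃⟩, hm, hmL⟩ := perm_linear_iff.mp hL
  obtain ⟨⟨e₁, e₂⟩, he, heC⟩ := perm_cubic_iff.mp hC
  simp only [Prod.mk.injEq] at hmL heC
  obtain ⟨rfl, rfl, rfl⟩ := hmL
  obtain ⟨rfl, rfl⟩ := heC
  have hD' : (i', (m₁, m₂, m₃), e₁, e₂) ∈ data := by
    simp only [data, List.mem_product]
    refine ⟨?_, hm, he⟩
    interval_cases i' <;> simp
  rw [← ofList_septimic hD'] at h
  have heq := ofList_injective (hl.trans (length_of_mem_data _ hD').2.2.2.2.2.2.2.symm) h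
  have := eq_or_eq_swap _ hD _ hD' heq.symm
  simp only [swap, Prod.mk.injEq] at this
  obtain ⟨rfl, ⟨rfl, rfl, rfl⟩, rfl, rfl⟩ | ⟨rfl, ⟨rfl, rfl, rfl⟩, rfl, rfl⟩ := this <;> simp
end

section
/- Let F₄ = GaloisField 2 2 be the field with four elements, and let f be a monic irreducible quadratic polynomial over F₄. Then f can be expressed in the form f(x) = α·(x − a)(x − b) + β·(x − c)(x − d), where {a, b, c, d} = F₄ (i.e., a, b, c, d are pairwise distinct and exhaust F₄) and α, β ∈ F₄ are nonzero with α ≠ β; moreover, this representation is unique up to interchanging a with b, interchanging c with d, and swapping the pair (α, {a, b}) with the pair (β, {c, d}). -/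
open Polynomial

/-- A field with four elements is `{0, s, ω s, (ω + 1) s}` for a primitive cube root of unity `ω`
and any nonzero `s`. -/
theorem exists_cubeRoot_of_card_eq_four {K : Type*} [Field K] [Fintype K]
    (hK : Fintype.card K = 4) (h2 : (2 : K) = 0) :
    ∃ w : K, w ^ 2 + w + 1 = 0 ∧
      ∀ s : K, s ≠ 0 → ∀ x : K, x = 0 ∨ x = s ∨ x = w * s ∨ x = (w + 1) * s := by
  classical
  have hpow : ∀ x : K, x ^ 4 = x := fun x => by rw [← hK]; exact FiniteField.pow_card x
  obtain ⟨w, hw⟩ : ∃ w : K, w ∉ ({0, 1} : Finset K) := by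
    refine Finset.exists_mem_notMem_of_card_lt_card (s := {0, 1}) (t := Finset.univ) ?_
      |>.imp fun _ h => h.2
    rw [Finset.card_univ, hK]
    exact lt_of_le_of_lt Finset.card_le_two (by norm_num)
  simp only [Finset.mem_insert, Finset.mem_singleton, not_or] at hw
  have hw' : w ^ 2 + w + 1 = 0 := by
    refine mul_left_cancel₀ (mul_ne_zero hw.1 (sub_ne_zero.2 hw.2)) ?_
    linear_combination hpow w
  refine ⟨w, hw', fun s hs x => ?_⟩
  have hs3 : s ^ 3 = 1 := mul_left_cancel₀ hs (by linear_combination hpow s)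
  have hprod : x * ((x - s) * ((x - w * s) * (x - (w + 1) * s))) = 0 := by
    linear_combination hpow x + x * hs3 + (x ^ 2 * s ^ 2 - x * s ^ 3) * hw' +
      (x + x ^ 2 * s ^ 2 * w - x ^ 3 * s * (1 + w)) * h2
  rcases mul_eq_zero.1 hprod with h | h
  · exact Or.inl h
  rcases mul_eq_zero.1 h with h | h
  · exact Or.inr (Or.inl (sub_eq_zero.1 h))
  rcases mul_eq_zero.1 h with h | h
  · exact Or.inr (Or.inr (Or.inl (sub_eq_zero.1 h)))
  · exact Or.inr (Or.inr (Or.inr (sub_eq_zero.1 h)))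

/-- Coefficients of a linear combination of two split monic quadratics. -/
theorem coeff_add_split_quadratics {K : Type*} [CommRing K] {f : K[X]} {α β a b c d : K}
    (h : f = C α * ((X - C a) * (X - C b)) + C β * ((X - C c) * (X - C d))) :
    f.coeff 2 = α + β ∧ f.coeff 1 = -(α * (a + b) + β * (c + d)) ∧
      f.coeff 0 = α * (a * b) + β * (c * d) := by
  have h' : f = C (α + β) * X ^ 2 + C (-(α * (a + b) + β * (c + d))) * X +
      C (α * (a * b) + β * (c * d)) := by
    rw [h]; simp only [map_add, map_mul, map_neg]; ring
  rw [h']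
  refine ⟨?_, ?_, ?_⟩ <;>
    simp only [coeff_add, coeff_C_mul, coeff_X_pow, coeff_X, coeff_C] <;> simp

/-- In a four-element field, a representation `α (x - a) (x - b) + β (x - c) (x - d)` with
`0 ∈ {a, b}` is determined by its coefficients. -/
theorem split_pair_unique_of_mul_eq_zero {K : Type*} [Field K] (h2 : (2 : K) = 0) {w : K}
    (hw : w ^ 2 + w + 1 = 0)
    (hall : ∀ s : K, s ≠ 0 → ∀ x : K, x = 0 ∨ x = s ∨ x = w * s ∨ x = (w + 1) * s)
    {s t α β a b c d : K} (hnd : [a, b, c, d].Nodup) (hab : a * b = 0) (h1 : α + β = 1)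
    (hs : s = -(α * (a + b) + β * (c + d))) (ht : t = α * (a * b) + β * (c * d)) :
    t = β * s ^ 2 ∧ ({a, b} : Set K) = {0, s} ∧
      ({c, d} : Set K) = {w * s, (w + 1) * s} := by
  wlog ha : a = 0 generalizing a b
  · have hb : b = 0 := (mul_eq_zero.1 hab).resolve_left ha
    rw [Set.pair_comm a b]
    exact this ((List.Perm.swap b a [c, d]).nodup hnd) (by rw [mul_comm, hab])
      (by rw [hs, add_comm a b]) (by rw [ht, mul_comm a b]) hb
  subst ha
  simp only [List.nodup_cons, List.mem_cons, List.not_mem_nil, or_false, not_or,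
    not_false_eq_true, List.nodup_nil, and_true] at hnd
  obtain ⟨⟨hb, hc, hd⟩, ⟨hbc, hbd⟩, hcd⟩ := hnd
  have hcd' : (c = w * b ∧ d = (w + 1) * b) ∨ (c = (w + 1) * b ∧ d = w * b) := by
    have := hall b (Ne.symm hb) c
    have := hall b (Ne.symm hb) d
    grind
  have hsb : s = b := by
    rcases hcd' with ⟨rfl, rfl⟩ | ⟨rfl, rfl⟩ <;>
      linear_combination hs - b * h1 - (b + b * β * w) * h2
  subst hsb
  rcases hcd' with ⟨rfl, rfl⟩ | ⟨rfl, rfl⟩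
  · refine ⟨?_, rfl, rfl⟩
    linear_combination ht + β * s ^ 2 * hw - β * s ^ 2 * h2
  · refine ⟨?_, rfl, Set.pair_comm _ _⟩
    linear_combination ht + β * s ^ 2 * hw - β * s ^ 2 * h2

theorem quadratics_over_F4 (f : (GaloisField 2 2)[X]) (hf : f.Monic) (hfi : Irreducible f)
    (hfd : f.natDegree = 2) :
    ∃ α β a b c d : GaloisField 2 2,
      α ≠ 0 ∧ β ≠ 0 ∧ α ≠ β ∧
      ([a, b, c, d] : List (GaloisField 2 2)).Nodup ∧
      ({a, b, c, d} : Set (GaloisField 2 2)) = Set.univ ∧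
      f = C α * ((X - C a) * (X - C b)) + C β * ((X - C c) * (X - C d)) ∧
      ∀ α' β' a' b' c' d' : GaloisField 2 2,
        α' ≠ 0 → β' ≠ 0 → α' ≠ β' →
        ([a', b', c', d'] : List (GaloisField 2 2)).Nodup →
        ({a', b', c', d'} : Set (GaloisField 2 2)) = Set.univ →
        f = C α' * ((X - C a') * (X - C b')) + C β' * ((X - C c') * (X - C d')) →
        (α' = α ∧ β' = β ∧ ({a', b'} : Set (GaloisField 2 2)) = {a, b} ∧
          ({c', d'} : Set (GaloisField 2 2)) = {c, d}) ∨
        (α' = β ∧ β' = α ∧ ({a', b'} : Set (GaloisField 2 2)) = {c, d} ∧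
          ({c', d'} : Set (GaloisField 2 2)) = {a, b}) := by
  have : Fintype (GaloisField 2 2) := Fintype.ofFinite _
  have hcard : Fintype.card (GaloisField 2 2) = 4 := by
    rw [← Nat.card_eq_fintype_card, GaloisField.card 2 2 (by norm_num)]; norm_num
  have h2 : (2 : GaloisField 2 2) = 0 := CharTwo.two_eq_zero
  obtain ⟨w, hw, hall⟩ := exists_cubeRoot_of_card_eq_four hcard h2
  obtain ⟨s, hs⟩ : ∃ s, f.coeff 1 = s := ⟨_, rfl⟩
  obtain ⟨t, ht⟩ : ∃ t, f.coeff 0 = t := ⟨_, rfl⟩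
  have hf2 : f.coeff 2 = 1 := by
    simpa only [Monic, leadingCoeff, hfd] using hf
  have hfq : f = X ^ 2 + C s * X + C t := by
    rw [f.as_sum_range_C_mul_X_pow, hfd]
    simp [Finset.sum_range_succ, hs, ht, hf2]
    ring
  have hroot : ∀ x, x ^ 2 + s * x + t ≠ 0 := by
    intro x hx
    refine hfi.not_isRoot_of_natDegree_ne_one (by rw [hfd]; norm_num) (x := x) ?_
    rw [hfq]; simpa using hx
  have hs0 : s ≠ 0 := by
    rintro rfl
    refine hroot (t ^ 2) ?_
    have : t ^ 4 = t := by
      simpa only [hcard] using FiniteField.pow_card t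
    linear_combination this + t * h2
  have ht0 : t ≠ 0 := fun h => hroot 0 (by simp [h])
  have hts : t ≠ s ^ 2 := fun h => hroot (w * s) (by rw [h]; linear_combination s ^ 2 * hw)
  obtain ⟨β, hβ⟩ : ∃ β, t = β * s ^ 2 := ⟨t / s ^ 2, by field_simp⟩
  have hβ0 : β ≠ 0 := by rintro rfl; simp [hβ] at ht0
  have hβ1 : β ≠ 1 := by rintro rfl; simp [hβ] at hts
  have hβu : ∀ γ, t = γ * s ^ 2 → γ = β := fun γ h =>
    mul_right_cancel₀ (pow_ne_zero 2 hs0) (h.symm.trans hβ)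
  have hw0 : w ≠ 0 := by rintro rfl; simp at hw
  have hw1 : w + 1 ≠ 0 := fun h => by
    refine one_ne_zero (α := GaloisField 2 2) ?_
    linear_combination hw - w * h
  refine ⟨1 - β, β, 0, s, w * s, (w + 1) * s, sub_ne_zero.2 hβ1.symm, hβ0, ?_, ?_, ?_, ?_, ?_⟩
  · intro h
    refine one_ne_zero (α := GaloisField 2 2) ?_
    linear_combination h + β * h2
  · have e1 : w * s ≠ s := fun h => hw1 (mul_right_cancel₀ hs0 (by linear_combination h + s * h2))
    have e2 : (w + 1) * s ≠ s := fun h => mul_ne_zero hw0 hs0 (by linear_combination h)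
    have e3 : w * s ≠ (w + 1) * s := fun h => hs0 (by linear_combination -h)
    simp [hs0.symm, (mul_ne_zero hw0 hs0).symm, (mul_ne_zero hw1 hs0).symm, e1.symm, e2.symm, e3]
  · exact Set.eq_univ_of_forall fun x => by simpa using hall s hs0 x
  · have h2' : (2 : (GaloisField 2 2)[X]) = 0 := by
      rw [← C_ofNat, h2, C_0]
    have hw' : (C w ^ 2 + C w + 1 : (GaloisField 2 2)[X]) = 0 := by
      rw [← C_1, ← C_pow, ← C_add, ← C_add, hw, C_0]
    rw [hfq, hβ]
    simp only [map_add, map_sub, map_mul, map_pow, map_one, map_zero]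
    linear_combination
      (C s * X + C β * C w * C s * X + C β * C s ^ 2) * h2' - C β * C s ^ 2 * hw'
  · intro α' β' a b c d _ _ _ hnd huniv h
    obtain ⟨c2, c1, c0⟩ := coeff_add_split_quadratics h
    rw [hf2] at c2
    rw [hs] at c1
    rw [ht] at c0
    have h0 : (0 : GaloisField 2 2) ∈ ({a, b, c, d} : Set (GaloisField 2 2)) :=
      huniv ▸ Set.mem_univ 0
    have h0' : a * b = 0 ∨ c * d = 0 := by
      simp only [Set.mem_insert_iff, Set.mem_singleton_iff] at h0
      rcases h0 with rfl | rfl | rfl | rfl <;> simp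
    rcases h0' with hab | hcd
    · obtain ⟨e, e1, e2⟩ :=
        split_pair_unique_of_mul_eq_zero h2 hw hall hnd hab c2.symm c1 c0
      have := hβu _ e
      exact Or.inl ⟨by rw [c2, this]; ring, this, e1, e2⟩
    · obtain ⟨e, e1, e2⟩ := split_pair_unique_of_mul_eq_zero h2 hw hall
        ((List.perm_append_comm (l₁ := [a, b]) (l₂ := [c, d])).nodup hnd) hcd
        ((add_comm _ _).trans c2.symm)
        (c1.trans (congrArg _ (add_comm _ _))) (c0.trans (add_comm _ _))
      have := hβu _ e
      exact Or.inr ⟨this, by rw [c2, this]; ring, e2, e1⟩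
end
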